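/- arXiv:1606.06874 — 2 statements merged into one kernel-verified Lean document; each statement's English description precedes it below -/
import Mathlib

section
/- For every natural number m ≥ 1 there exist unique monic polynomials R_1, …, R_m with rational coefficients, where R_k has degree k, such that the n-th prime satisfies p_n = n·(log n + log log n − 1 + ∑_{k=1}^{m} (−1)^{k+1}·R_k(log log n)/(k·log^k n)) + O(n·(log log n)^{m+1}/log^{m+1} n) as n → ∞; moreover R_1(x) = x − 2 and R_2(x) = x² − 6x + 11. -/
open Real Polynomial

/-- `nthPrime n` is the `n`-th prime number, with `nthPrime 1 = 2`, `nthPrime 2 = 3`, … -/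
noncomputable def nthPrime (n : ℕ) : ℕ := Nat.nth Nat.Prime (n - 1)

/-- The family `R : ℕ → ℚ[X]` consists (for indices `1, …, m`) of monic polynomials with
`deg R_k = k` such that
`p_n = n·(log n + log log n − 1 + ∑_{k=1}^{m} (−1)^{k+1}·R_k(log log n)/(k·log^k n))
  + O(n·(log log n)^{m+1}/log^{m+1} n)`. -/
def IsCipollaFamily (m : ℕ) (R : ℕ → Polynomial ℚ) : Prop :=
  (∀ k ∈ Finset.Icc 1 m, (R k).Monic ∧ (R k).natDegree = k) ∧
  ∃ C : ℝ, 0 < C ∧ ∃ N : ℕ, ∀ n : ℕ, N ≤ n →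
    |(nthPrime n : ℝ) -
        (n : ℝ) * (Real.log n + Real.log (Real.log n) - 1 +
          ∑ k ∈ Finset.Icc 1 m, (-1 : ℝ) ^ (k + 1) *
            (Polynomial.aeval (Real.log (Real.log n)) (R k)) /
              ((k : ℝ) * Real.log n ^ k))| ≤
      C * (n : ℝ) * Real.log (Real.log n) ^ (m + 1) / Real.log n ^ (m + 1)

namespace CipZ

/-- Terms of the convergent series for `ζ(s) - 1/(s-1)`. -/
noncomputable def zt (n : ℕ) (s : ℂ) : ℂ :=
  ((n + 1 : ℝ) : ℂ) ^ (-s) -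
    (((n + 1 + 1 : ℝ) : ℂ) ^ (1 - s) - ((n + 1 : ℝ) : ℂ) ^ (1 - s)) / (1 - s)

lemma zt_eq_integral (n : ℕ) {s : ℂ} (hs : s ≠ 1) :
    zt n s = ∫ u in (n + 1 : ℝ)..(n + 1 + 1 : ℝ), (((n + 1 : ℝ) : ℂ) ^ (-s) - (u : ℂ) ^ (-s)) := by
  have hn : (0 : ℝ) < n + 1 := by positivity
  have h0 : (0 : ℝ) ∉ Set.uIcc (n + 1 : ℝ) (n + 1 + 1) := by
    rw [Set.uIcc_of_le (by linarith)]; simp only [Set.mem_Icc, not_and, not_le]; intro h; linarith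
  have hc : ContinuousOn (fun u : ℝ => (u : ℂ) ^ (-s)) (Set.uIcc (n + 1 : ℝ) (n + 1 + 1)) := by
    intro u hu
    have : u ≠ 0 := fun h => h0 (h ▸ hu)
    rw [Set.uIcc_of_le (by linarith)] at hu
    have hu0 : 0 < u := by linarith [hu.1]
    exact (Complex.continuousAt_ofReal_cpow_const u (-s) (Or.inr this)).continuousWithinAt
  rw [intervalIntegral.integral_sub (by simp) hc.intervalIntegrable, integral_cpow
    (Or.inr ⟨by intro h; apply hs; linear_combination -h, h0⟩)]
  simp only [intervalIntegral.integral_const, zt]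
  simp only [add_sub_cancel_left, one_smul]
  rw [show -s + 1 = 1 - s by ring]

lemma norm_sub_cpow_le_two {a u : ℝ} (ha : 0 < a) (hu : a ≤ u) {s : ℂ} (hs : 0 ≤ s.re) :
    ‖(a : ℂ) ^ (-s) - (u : ℂ) ^ (-s)‖ ≤ 2 * a ^ (-s.re) := by
  refine (norm_sub_le _ _).trans ?_
  rw [Complex.norm_cpow_eq_rpow_re_of_pos ha, Complex.norm_cpow_eq_rpow_re_of_pos (ha.trans_le hu)]
  have : u ^ (-s).re ≤ a ^ (-s).re :=
    Real.rpow_le_rpow_of_nonpos ha hu (by simpa using hs)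
  simp only [Complex.neg_re] at *
  linarith

lemma norm_sub_cpow_le_mul {a u : ℝ} (ha : 0 < a) (hu : a ≤ u) (hu1 : u ≤ a + 1) {s : ℂ}
    (hs : 0 ≤ s.re) :
    ‖(a : ℂ) ^ (-s) - (u : ℂ) ^ (-s)‖ ≤ ‖s‖ * a ^ (-s.re - 1) := by
  have hC : 0 ≤ ‖s‖ * a ^ (-s.re - 1) := by positivity
  have key := (convex_Icc a (a + 1)).norm_image_sub_le_of_norm_hasDerivWithin_le
    (f := fun x : ℝ => (x : ℂ) ^ (-s)) (f' := fun x : ℝ => -s * (x : ℂ) ^ (-s - 1))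
    (C := ‖s‖ * a ^ (-s.re - 1)) (x := u) (y := a) ?_ ?_ ⟨hu, hu1⟩ ⟨le_rfl, by linarith⟩
  · refine key.trans ?_
    have : ‖a - u‖ ≤ 1 := by rw [Real.norm_eq_abs, abs_le]; constructor <;> linarith
    nlinarith
  · intro x hx
    by_cases h0 : s = 0
    · subst h0; simpa using hasDerivWithinAt_const x (Set.Icc a (a+1)) (1:ℂ)
    exact (hasDerivAt_ofReal_cpow_const (x := x) (by linarith [hx.1]) (r := -s)
      (neg_ne_zero.mpr h0)).hasDerivWithinAt
  · intro x hx
    rw [norm_mul, norm_neg, Complex.norm_cpow_eq_rpow_re_of_pos (by linarith [hx.1])]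
    refine mul_le_mul_of_nonneg_left ?_ (norm_nonneg _)
    simpa using Real.rpow_le_rpow_of_nonpos ha hx.1 (by linarith : -s.re - 1 ≤ 0)

lemma min_two_le_rpow {r θ : ℝ} (hr : 0 ≤ r) (h0 : 0 ≤ θ) (h1 : θ ≤ 1) :
    min 2 r ≤ 2 * r ^ θ := by
  rcases le_total 1 r with h | h
  · exact (min_le_left _ _).trans (by linarith [Real.one_le_rpow h h0])
  · rcases hr.eq_or_lt with rfl | hr
    · exact (min_le_right _ _).trans (by positivity)
    · refine (min_le_right _ _).trans ?_
      have := Real.rpow_le_rpow_of_exponent_ge hr h h1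
      rw [Real.rpow_one] at this
      linarith [Real.rpow_nonneg hr.le θ]

lemma norm_zt_le (n : ℕ) {s : ℂ} (hs : s ≠ 1) (hre : 0 ≤ s.re) {θ : ℝ} (h0 : 0 ≤ θ) (h1 : θ ≤ 1) :
    ‖zt n s‖ ≤ 2 * ‖s‖ ^ θ * (n + 1 : ℝ) ^ (-s.re - θ) := by
  have hn : (0 : ℝ) < n + 1 := by positivity
  rw [zt_eq_integral n hs]
  refine (intervalIntegral.norm_integral_le_of_norm_le_const
    (C := 2 * ‖s‖ ^ θ * (n + 1 : ℝ) ^ (-s.re - θ)) ?_).trans (by simp)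
  intro u hu
  rw [Set.uIoc_of_le (by linarith)] at hu
  have b1 := norm_sub_cpow_le_two hn hu.1.le hre
  have b2 := norm_sub_cpow_le_mul hn hu.1.le hu.2 hre
  have hp : 0 < (n + 1 : ℝ) ^ (-s.re) := by positivity
  have e1 : (n + 1 : ℝ) ^ (-s.re - 1) = (n + 1 : ℝ) ^ (-s.re) / (n + 1) := by
    rw [Real.rpow_sub hn, Real.rpow_one]
  have e2 : (n + 1 : ℝ) ^ (-s.re - θ) = (n + 1 : ℝ) ^ (-s.re) / (n + 1) ^ θ := by
    rw [Real.rpow_sub hn]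
  have hm := min_two_le_rpow (r := ‖s‖ / (n + 1)) (by positivity) h0 h1
  rw [Real.div_rpow (norm_nonneg _) hn.le] at hm
  calc ‖((n + 1 : ℝ) : ℂ) ^ (-s) - (u : ℂ) ^ (-s)‖
      ≤ min 2 (‖s‖ / (n + 1)) * (n + 1 : ℝ) ^ (-s.re) := by
        rcases min_cases (2:ℝ) (‖s‖ / (n + 1)) with ⟨h, -⟩ | ⟨h, -⟩ <;> rw [h]
        · exact b1
        · refine b2.trans (le_of_eq ?_); rw [e1]; ring
    _ ≤ (2 * (‖s‖ ^ θ / (n + 1 : ℝ) ^ θ)) * (n + 1 : ℝ) ^ (-s.re) := by gcongr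
    _ = _ := by rw [e2]; ring

lemma differentiableAt_zt (n : ℕ) {s : ℂ} (hs : s ≠ 1) : DifferentiableAt ℂ (zt n) s := by
  have hn : ((n + 1 : ℝ) : ℂ) ≠ 0 := by
    rw [Ne, Complex.ofReal_eq_zero]; positivity
  have hn' : ((n + 1 + 1 : ℝ) : ℂ) ≠ 0 := by
    rw [Ne, Complex.ofReal_eq_zero]; positivity
  have h1 : (1 - s) ≠ 0 := sub_ne_zero.mpr hs.symm
  unfold zt
  refine DifferentiableAt.sub ?_ (DifferentiableAt.div (DifferentiableAt.sub ?_ ?_) ?_ h1)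
  · exact DifferentiableAt.const_cpow (by fun_prop) (Or.inl hn)
  · exact DifferentiableAt.const_cpow (by fun_prop) (Or.inl hn')
  · exact DifferentiableAt.const_cpow (by fun_prop) (Or.inl hn)
  · fun_prop

lemma tsum_zt_of_one_lt {s : ℂ} (hs : 1 < s.re) :
    ∑' n, zt n s = riemannZeta s - 1 / (s - 1) := by
  have hs1 : s ≠ 1 := by rintro rfl; simp at hs
  have h1s : 1 - s ≠ 0 := sub_ne_zero.mpr hs1.symm
  have hsum1 : Summable (fun n : ℕ => ((n + 1 : ℝ) : ℂ) ^ (-s)) := by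
    have := (summable_nat_add_iff 1).mpr (Complex.summable_one_div_nat_cpow.mpr hs)
    refine this.congr fun n => ?_
    rw [Complex.cpow_neg]; simp
  have hz : ∑' n : ℕ, ((n + 1 : ℝ) : ℂ) ^ (-s) = riemannZeta s := by
    rw [zeta_eq_tsum_one_div_nat_add_one_cpow hs]
    refine tsum_congr fun n => ?_
    rw [Complex.cpow_neg]; simp
  have hsz : Summable (fun n => zt n s) := by
    refine Summable.of_norm_bounded (g := fun n : ℕ => 2 * ‖s‖ ^ (0:ℝ) * (n + 1 : ℝ) ^ (-s.re - 0))
      ?_ fun n => norm_zt_le n hs1 (by linarith) le_rfl zero_le_one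
    refine Summable.mul_left _ ?_
    have := (summable_nat_add_iff 1).mpr (Real.summable_nat_rpow.mpr (by linarith : -s.re - 0 < -1))
    exact this.congr fun n => by push_cast; rfl
  have hsw := hsum1.sub hsz
  have hw : HasSum (fun n : ℕ => ((n + 1 : ℝ) : ℂ) ^ (-s) - zt n s) (1 / (s - 1)) := by
    refine (hsw.hasSum_iff_tendsto_nat).mpr ?_
    have e : ∀ N : ℕ, ∑ n ∈ Finset.range N, (((n + 1 : ℝ) : ℂ) ^ (-s) - zt n s)
        = (((N + 1 : ℝ) : ℂ) ^ (1 - s) - 1) / (1 - s) := by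
      intro N
      induction N with
      | zero => simp
      | succ k ih =>
        rw [Finset.sum_range_succ, ih, zt]; push_cast; ring
    simp_rw [e]
    have ht : Filter.Tendsto (fun N : ℕ => ((N + 1 : ℝ) : ℂ) ^ (1 - s)) Filter.atTop (nhds 0) := by
      rw [tendsto_zero_iff_norm_tendsto_zero]
      have : ∀ N : ℕ, ‖((N + 1 : ℝ) : ℂ) ^ (1 - s)‖ = (N + 1 : ℝ) ^ (-(s.re - 1)) := by
        intro N
        rw [Complex.norm_cpow_eq_rpow_re_of_pos (by positivity)]; simp
      simp_rw [this]
      exact (tendsto_rpow_neg_atTop (by linarith)).comp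
        (Filter.tendsto_atTop_add_const_right _ _ tendsto_natCast_atTop_atTop)
    have := (ht.sub_const 1).div_const (1 - s)
    convert this using 2
    rw [zero_sub, ← neg_sub s 1, neg_div_neg_eq]
  have := hsum1.tsum_sub hsw
  rw [hz, hw.tsum_eq] at this
  rw [← this]
  refine tsum_congr fun n => by ring

/-- the bound in the upper half plane -/
lemma norm_zeta0_le_upper {ε : ℝ} (h0 : 0 < ε) (h1 : ε ≤ 1 / 4) {s : ℂ} (hs : 1 - ε ≤ s.re)
    (him : 0 < s.im) :
    ‖riemannZeta s - 1 / (s - 1)‖ ≤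
      2 * ‖s‖ ^ (3 * ε) * ∑' n : ℕ, (n + 1 : ℝ) ^ (-1 - ε) := by
  have hsu : Summable (fun n : ℕ => (n + 1 : ℝ) ^ (-1 - ε)) := by
    have := (summable_nat_add_iff 1).mpr (Real.summable_nat_rpow.mpr (by linarith : -1 - ε < -1))
    exact this.congr fun n => by push_cast; rfl
  set R : ℝ := ‖s‖ + 4 with hR
  set U : Set ℂ := {w | 1 - 2 * ε < w.re} ∩ ({w | 0 < w.im} ∩ Metric.ball 0 R) with hU
  have hUo : IsOpen U := by
    refine IsOpen.inter ?_ (IsOpen.inter ?_ Metric.isOpen_ball)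
    · exact isOpen_lt continuous_const Complex.continuous_re
    · exact isOpen_lt continuous_const Complex.continuous_im
  have hUc : Convex ℝ U := (convex_halfSpace_re_gt _).inter
    ((convex_halfSpace_im_gt _).inter (convex_ball _ _))
  have hne : ∀ w ∈ U, w ≠ 1 := by
    rintro w ⟨-, h, -⟩ rfl; simp at h
  have hbd : ∀ (n : ℕ), ∀ w ∈ U, ‖zt n w‖ ≤ 2 * R ^ (3 * ε) * (n + 1 : ℝ) ^ (-1 - ε) := by
    intro n w hw
    have hwre : 1 - 2 * ε < w.re := hw.1
    refine (norm_zt_le n (hne w hw) (by linarith) (θ := 3 * ε) (by linarith)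
      (by linarith)).trans ?_
    have hwn : ‖w‖ ≤ R := (mem_ball_zero_iff.mp hw.2.2).le
    have e1 : ‖w‖ ^ (3 * ε) ≤ R ^ (3 * ε) :=
      Real.rpow_le_rpow (norm_nonneg _) hwn (by linarith)
    have e2 : (n + 1 : ℝ) ^ (-w.re - 3 * ε) ≤ (n + 1 : ℝ) ^ (-1 - ε) :=
      Real.rpow_le_rpow_of_exponent_le (by simp) (by linarith)
    exact mul_le_mul (by linarith) e2 (by positivity) (by positivity)
  have hdiff : DifferentiableOn ℂ (fun w => ∑' n, zt n w) U :=
    Complex.differentiableOn_tsum_of_summable_norm (hsu.mul_left _)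
      (fun n w hw => (differentiableAt_zt n (hne w hw)).differentiableWithinAt) hUo hbd
  have hdiff2 : DifferentiableOn ℂ (fun w => riemannZeta w - 1 / (w - 1)) U := by
    intro w hw
    refine DifferentiableAt.differentiableWithinAt ?_
    refine (differentiableAt_riemannZeta (hne w hw)).sub ?_
    exact DifferentiableAt.div (by fun_prop) (by fun_prop) (sub_ne_zero.mpr (hne w hw))
  set z0 : ℂ := 2 + Complex.I
  have hz0 : z0 ∈ U := by
    refine ⟨?_, ?_, ?_⟩
    · simp [z0]; linarith
    · simp [z0]
    · rw [mem_ball_zero_iff]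
      calc ‖z0‖ ≤ ‖(2:ℂ)‖ + ‖Complex.I‖ := norm_add_le _ _
        _ = 3 := by simp; norm_num
        _ < R := by linarith [norm_nonneg s]
  have heq := (hdiff.analyticOnNhd hUo).eqOn_of_preconnected_of_eventuallyEq
    (hdiff2.analyticOnNhd hUo) hUc.isPreconnected hz0 (by
      have : {w : ℂ | 1 < w.re} ∈ nhds z0 :=
        (isOpen_lt continuous_const Complex.continuous_re).mem_nhds (by simp [z0])
      filter_upwards [this] with w hw using tsum_zt_of_one_lt hw)
  have hsU : s ∈ U := ⟨by show 1 - 2 * ε < s.re; linarith, him, by simp [hR]⟩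
  have := heq hsU
  simp only at this
  rw [← this]
  rw [← tsum_mul_left]
  refine tsum_of_norm_bounded (hsu.mul_left _).hasSum fun n => ?_
  refine (norm_zt_le n (hne s hsU) (by linarith) (θ := 3 * ε) (by linarith)
      (by linarith)).trans ?_
  have e2 : (n + 1 : ℝ) ^ (-s.re - 3 * ε) ≤ (n + 1 : ℝ) ^ (-1 - ε) :=
    Real.rpow_le_rpow_of_exponent_le (by simp) (by linarith)
  exact mul_le_mul_of_nonneg_left e2 (by positivity)

end CipZ

namespace CipZ

lemma norm_zeta0_le_of_pos {ε : ℝ} (h0 : 0 < ε) (h1 : ε ≤ 1 / 4) {s : ℂ} (hs : 1 - ε ≤ s.re)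
    (him : 0 < s.im) :
    ‖riemannZeta₀ s‖ ≤ 2 * ‖s‖ ^ (3 * ε) * ∑' n : ℕ, (n + 1 : ℝ) ^ (-1 - ε) := by
  have hs1 : s ≠ 1 := by rintro rfl; simp at him
  have := norm_zeta0_le_upper h0 h1 hs him
  rwa [riemannZeta_eq_inv_sub_add hs1, one_div, add_sub_cancel_left] at this

lemma norm_zeta0_le {ε : ℝ} (h0 : 0 < ε) (h1 : ε ≤ 1 / 4) {s : ℂ} (hs : 1 - ε ≤ s.re) :
    ‖riemannZeta₀ s‖ ≤ 2 * ‖s‖ ^ (3 * ε) * ∑' n : ℕ, (n + 1 : ℝ) ^ (-1 - ε) := by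
  rcases lt_trichotomy s.im 0 with h | h | h
  · have hs1 : s ≠ 1 := by rintro rfl; simp at h
    have hs1' : (starRingEnd ℂ) s ≠ 1 := by
      intro h'; apply hs1; simpa using congrArg (starRingEnd ℂ) h'
    have := norm_zeta0_le_of_pos h0 h1 (s := (starRingEnd ℂ) s) (by simpa using hs) (by simpa using h)
    have e : riemannZeta₀ ((starRingEnd ℂ) s) = (starRingEnd ℂ) (riemannZeta₀ s) := by
      simp [riemannZeta₀, hs1, hs1', riemannZeta_conj]
    rw [e, Complex.norm_conj, Complex.norm_conj] at this
    exact this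
  · have hc : Filter.Tendsto (fun y : ℝ => s + y * Complex.I) (nhdsWithin 0 (Set.Ioi 0)) (nhds s) := by
      have : Continuous (fun y : ℝ => s + y * Complex.I) := by fun_prop
      have h2 := this.tendsto 0
      simp only [Complex.ofReal_zero, zero_mul, add_zero] at h2
      exact h2.mono_left nhdsWithin_le_nhds
    have c1 : Filter.Tendsto (fun y : ℝ => ‖riemannZeta₀ (s + y * Complex.I)‖)
        (nhdsWithin 0 (Set.Ioi 0)) (nhds ‖riemannZeta₀ s‖) :=
      ((differentiable_riemannZeta₀.continuous.tendsto s).comp hc).norm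
    have c2 : Filter.Tendsto (fun y : ℝ => 2 * ‖s + y * Complex.I‖ ^ (3 * ε) *
        ∑' n : ℕ, (n + 1 : ℝ) ^ (-1 - ε))
        (nhdsWithin 0 (Set.Ioi 0)) (nhds (2 * ‖s‖ ^ (3 * ε) * ∑' n : ℕ, (n + 1 : ℝ) ^ (-1 - ε))) :=
      (((hc.norm).rpow_const (Or.inr (by linarith))).const_mul 2).mul_const _
    refine le_of_tendsto_of_tendsto c1 c2 ?_
    filter_upwards [self_mem_nhdsWithin] with y hy
    refine norm_zeta0_le_of_pos h0 h1 (by simpa using hs) ?_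
    simpa [h] using hy
  · exact norm_zeta0_le_of_pos h0 h1 hs h

/-- normalised zeta -/
noncomputable def Zt (s : ℂ) : ℂ := riemannZeta₁ s / s

noncomputable def tau (s : ℂ) : ℝ := 1 + |s.im|

lemma one_le_tau (s : ℂ) : 1 ≤ tau s := by unfold tau; linarith [abs_nonneg s.im]

lemma tau_pos (s : ℂ) : 0 < tau s := by linarith [one_le_tau s]

lemma norm_le_tau {s : ℂ} (h0 : 0 ≤ s.re) (h : s.re ≤ 3) : ‖s‖ ≤ 3 * tau s := by
  refine (Complex.norm_le_abs_re_add_abs_im s).trans ?_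
  unfold tau; rw [abs_of_nonneg h0]; linarith [abs_nonneg s.im]

lemma tau_le_norm {s : ℂ} (h0 : 1 / 2 ≤ s.re) : tau s ≤ 3 * ‖s‖ := by
  have h1 := Complex.abs_im_le_norm s
  have h2 := Complex.re_le_norm s
  unfold tau; linarith

lemma norm_Zt_le {ε : ℝ} (h0 : 0 < ε) (h1 : ε ≤ 1 / 4) : ∃ M : ℝ, 0 < M ∧ ∀ s : ℂ,
    1 - ε ≤ s.re → s.re ≤ 3 → ‖Zt s‖ ≤ M * tau s ^ (3 * ε) := by
  set S := ∑' n : ℕ, (n + 1 : ℝ) ^ (-1 - ε) with hS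
  have hSp : 0 ≤ S := tsum_nonneg fun n => by positivity
  refine ⟨2 + 3 * (2 * 3 * S), by positivity, fun s hs hs3 => ?_⟩
  have hre : 3 / 4 ≤ s.re := by linarith
  have hn : 3 / 4 ≤ ‖s‖ := hre.trans (Complex.re_le_norm s)
  have hz := norm_zeta0_le h0 h1 hs
  have ht := norm_le_tau (by linarith) hs3
  have ht2 : ‖s‖ ^ (3 * ε) ≤ 3 * tau s ^ (3 * ε) := by
    calc ‖s‖ ^ (3 * ε) ≤ (3 * tau s) ^ (3 * ε) := by
          exact Real.rpow_le_rpow (norm_nonneg _) ht (by linarith)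
      _ = 3 ^ (3 * ε) * tau s ^ (3 * ε) := Real.mul_rpow (by norm_num) (tau_pos s).le
      _ ≤ 3 ^ (1 : ℝ) * tau s ^ (3 * ε) := by
          have := Real.rpow_le_rpow_of_exponent_le (x := 3) (by norm_num) (by linarith : 3 * ε ≤ 1)
          have h2 : 0 < tau s ^ (3 * ε) := Real.rpow_pos_of_pos (tau_pos s) _
          nlinarith
      _ = _ := by rw [Real.rpow_one]
  have hτ : 1 ≤ tau s ^ (3 * ε) := Real.one_le_rpow (one_le_tau s) (by linarith)
  have hz2 : ‖riemannZeta₀ s‖ ≤ (2 * 3 * S) * tau s ^ (3 * ε) := by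
    refine hz.trans ?_
    calc 2 * ‖s‖ ^ (3 * ε) * S ≤ 2 * (3 * tau s ^ (3 * ε)) * S := by gcongr
      _ = _ := by ring
  have : ‖riemannZeta₁ s‖ ≤ 1 + (‖s‖ + 1) * ((2 * 3 * S) * tau s ^ (3 * ε)) := by
    unfold riemannZeta₁
    refine (norm_add_le _ _).trans ?_
    rw [norm_one, norm_mul]
    have : ‖s - 1‖ ≤ ‖s‖ + 1 := (norm_sub_le _ _).trans (by simp)
    gcongr
  rw [Zt, norm_div, div_le_iff₀ (by linarith)]
  refine this.trans ?_
  have hA : 0 ≤ (2 * 3 * S) * tau s ^ (3 * ε) := by positivity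
  nlinarith

lemma differentiableAt_Zt {s : ℂ} (hs : s ≠ 0) : DifferentiableAt ℂ Zt s :=
  (differentiable_riemannZeta₁ s).div differentiableAt_id hs

lemma ne_zero_of_re_pos {s : ℂ} (h : 0 < s.re) : s ≠ 0 := by
  rintro rfl; simp at h

lemma tau_le_of_dist {s w : ℂ} {r : ℝ} (h : dist w s ≤ r) (hr : r ≤ 1) : tau w ≤ 2 * tau s := by
  have h1 : |w.im - s.im| ≤ dist w s := by
    rw [dist_eq_norm, ← Complex.sub_im]; exact Complex.abs_im_le_norm _
  have h2 := abs_sub_abs_le_abs_sub w.im s.im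
  unfold tau; linarith [abs_nonneg s.im]

lemma re_of_dist {s w : ℂ} {r : ℝ} (h : dist w s ≤ r) : s.re - r ≤ w.re ∧ w.re ≤ s.re + r := by
  have h1 : |w.re - s.re| ≤ dist w s := by
    rw [dist_eq_norm, ← Complex.sub_re]; exact Complex.abs_re_le_norm _
  have := abs_le.mp (h1.trans h)
  constructor <;> linarith

lemma two_tau_rpow {ε a b : ℝ} (h0 : 0 < ε) (h1 : ε ≤ 1 / 4) (ha : 0 ≤ a) (hb : 0 ≤ b)
    (hab : a ≤ 2 * b) : a ^ (3 * ε) ≤ 2 * b ^ (3 * ε) := by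
  calc a ^ (3 * ε) ≤ (2 * b) ^ (3 * ε) := Real.rpow_le_rpow ha hab (by linarith)
    _ = 2 ^ (3 * ε) * b ^ (3 * ε) := Real.mul_rpow (by norm_num) hb
    _ ≤ 2 ^ (1 : ℝ) * b ^ (3 * ε) := by
        have := Real.rpow_le_rpow_of_exponent_le (x := 2) (by norm_num) (by linarith : 3 * ε ≤ 1)
        have h2 : 0 ≤ b ^ (3 * ε) := Real.rpow_nonneg hb _
        nlinarith
    _ = _ := by rw [Real.rpow_one]

lemma norm_deriv_Zt_le {ε : ℝ} (h0 : 0 < ε) (h1 : ε ≤ 1 / 4) : ∃ M : ℝ, 0 < M ∧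
    (∀ s : ℂ, 1 - ε ≤ s.re → s.re ≤ 3 → ‖Zt s‖ ≤ M * tau s ^ (3 * ε)) ∧
    (∀ s : ℂ, 1 - ε / 2 ≤ s.re → s.re ≤ 5 / 2 → ‖deriv Zt s‖ ≤ M * tau s ^ (3 * ε)) := by
  obtain ⟨M, hM, hb⟩ := norm_Zt_le h0 h1
  refine ⟨M + 2 * M / (ε / 2), by positivity, fun s hs hs3 => ?_, fun s hs hs3 => ?_⟩
  · refine (hb s hs hs3).trans ?_
    have : 0 ≤ tau s ^ (3 * ε) := Real.rpow_nonneg (tau_pos s).le _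
    have h2 : 0 ≤ 2 * M / (ε / 2) := by positivity
    nlinarith
  · have key := Complex.norm_deriv_le_of_forall_mem_sphere_norm_le (f := Zt) (c := s) (R := ε / 2)
      (C := M * (2 * tau s ^ (3 * ε))) (by linarith) ?_ ?_
    · refine key.trans ?_
      have : 0 ≤ tau s ^ (3 * ε) := Real.rpow_nonneg (tau_pos s).le _
      rw [add_mul]
      have h3 : M * (2 * tau s ^ (3 * ε)) / (ε / 2) = 2 * M / (ε / 2) * tau s ^ (3 * ε) := by ring
      rw [h3]
      nlinarith
    · refine DifferentiableOn.diffContOnCl fun w hw => ?_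
      rw [closure_ball _ (by linarith)] at hw
      have := re_of_dist (Metric.mem_closedBall.mp hw)
      exact (differentiableAt_Zt (ne_zero_of_re_pos (by linarith))).differentiableWithinAt
    · intro w hw
      have hd : dist w s ≤ ε / 2 := (Metric.mem_sphere.mp hw).le
      have := re_of_dist hd
      refine (hb w (by linarith) (by linarith)).trans ?_
      exact mul_le_mul_of_nonneg_left (two_tau_rpow h0 h1 (tau_pos w).le (tau_pos s).le
        (tau_le_of_dist hd (by linarith))) hM.le

lemma riemannZeta₁_ne_zero {s : ℂ} (hs : 1 ≤ s.re) : riemannZeta₁ s ≠ 0 := by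
  by_cases h : s = 1
  · subst h; simp
  · have := riemannZeta_ne_zero_of_one_le_re hs
    rw [riemannZeta_eq_inv_sub_mul h] at this
    exact right_ne_zero_of_mul this

lemma Zt_ne_zero {s : ℂ} (hs : 1 ≤ s.re) : Zt s ≠ 0 :=
  div_ne_zero (riemannZeta₁_ne_zero hs) (ne_zero_of_re_pos (by linarith))

lemma three_four_one {x : ℝ} (hx : 0 < x) (y : ℝ) :
    1 ≤ ‖riemannZeta (1 + x)‖ ^ 3 * ‖riemannZeta (1 + x + Complex.I * y)‖ ^ 4 *
      ‖riemannZeta (1 + x + 2 * Complex.I * y)‖ := by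
  have := DirichletCharacter.norm_LFunction_product_ge_one (N := 1) 1 hx y
  rw [DirichletCharacter.LFunctionTrivChar] at this
  simp only [DirichletCharacter.LFunction_modOne_eq, norm_mul, norm_pow] at this
  exact this

lemma zeta_eq_Zt {s : ℂ} (hs : s ≠ 1) (h0 : s ≠ 0) : riemannZeta s = (1 + 1 / (s - 1)) * Zt s := by
  have : s - 1 ≠ 0 := sub_ne_zero.mpr hs
  rw [riemannZeta_eq_inv_sub_mul hs, Zt]; field_simp; ring

lemma norm_zeta_le_Zt {s : ℂ} (hs : 1 ≤ |s.im|) : ‖riemannZeta s‖ ≤ 2 * ‖Zt s‖ := by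
  have hs1 : s ≠ 1 := by rintro rfl; simp at hs; linarith
  have hs0 : s ≠ 0 := by rintro rfl; simp at hs; linarith
  rw [zeta_eq_Zt hs1 hs0, norm_mul]
  refine mul_le_mul_of_nonneg_right ?_ (norm_nonneg _)
  refine (norm_add_le _ _).trans ?_
  have : 1 ≤ ‖s - 1‖ := by
    refine hs.trans ?_
    have := Complex.abs_im_le_norm (s - 1)
    simpa using this
  rw [norm_one, norm_div, norm_one]
  have : 1 / ‖s - 1‖ ≤ 1 := by rw [div_le_one (by linarith)]; exact this
  linarith

/-- 3-4-1 in normalised form -/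
lemma Zt_lower_pre {ε : ℝ} (h0 : 0 < ε) (h1 : ε ≤ 1 / 4) : ∃ c : ℝ, 0 < c ∧ ∀ s : ℂ,
    1 < s.re → s.re ≤ 2 → 1 ≤ |s.im| → c * (s.re - 1) ^ 3 / tau s ^ (3 * ε) ≤ ‖Zt s‖ ^ 4 := by
  obtain ⟨M, hM, hb⟩ := norm_Zt_le h0 h1
  refine ⟨1 / ((3 * M) ^ 3 * 2 ^ 4 * (4 * M)), by positivity, fun s hs hs2 him => ?_⟩
  set x := s.re - 1 with hx
  have hx0 : 0 < x := by linarith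
  have h341 := three_four_one hx0 s.im
  have e1 : (1 + (x : ℂ) + Complex.I * s.im) = s := by
    apply Complex.ext <;> simp [hx]
  rw [e1] at h341
  set s2 : ℂ := 1 + x + 2 * Complex.I * s.im with hs2'
  have r2 : s2.re = s.re := by simp [hs2', hx]
  have i2 : s2.im = 2 * s.im := by simp [hs2']
  have b2 : ‖riemannZeta s2‖ ≤ 4 * M * tau s ^ (3 * ε) := by
    refine (norm_zeta_le_Zt (by rw [i2, abs_mul]; norm_num; linarith)).trans ?_
    have := hb s2 (by linarith) (by linarith)
    have h3 := two_tau_rpow h0 h1 (tau_pos s2).le (tau_pos s).le (by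
      unfold tau; rw [i2, abs_mul]; norm_num; linarith)
    nlinarith
  have b1 : ‖riemannZeta s‖ ≤ 2 * ‖Zt s‖ := norm_zeta_le_Zt him
  have b0 : ‖riemannZeta (1 + x)‖ ≤ 3 * M / x := by
    have hne1 : (1 + x : ℂ) ≠ 1 := by simpa using hx0.ne'
    have hre : (1 + x : ℂ).re = 1 + x := by simp
    have := hb (1 + x) (by rw [hre]; linarith) (by rw [hre]; linarith)
    have ht : tau (1 + x) = 1 := by simp [tau]
    rw [ht, Real.one_rpow, mul_one] at this
    rw [zeta_eq_Zt hne1 (ne_zero_of_re_pos (by rw [hre]; linarith)), norm_mul]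
    have h3 : ‖(1 + 1 / ((1 + x : ℂ) - 1))‖ ≤ 3 / x := by
      refine (norm_add_le _ _).trans ?_
      simp only [add_sub_cancel_left, norm_div, norm_one, Complex.norm_real, Real.norm_eq_abs,
        abs_of_pos hx0]
      rw [show (3:ℝ) / x = 2 / x + 1 / x by ring]
      have : 1 ≤ 2 / x := by rw [le_div_iff₀ hx0]; linarith
      linarith
    calc _ ≤ 3 / x * M := by gcongr
      _ = _ := by ring
  have hT : 0 < tau s ^ (3 * ε) := Real.rpow_pos_of_pos (tau_pos s) _
  have : 1 ≤ (3 * M / x) ^ 3 * (2 * ‖Zt s‖) ^ 4 * (4 * M * tau s ^ (3 * ε)) := by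
    refine h341.trans ?_
    gcongr
  rw [div_le_iff₀ hT, one_div, inv_mul_le_iff₀ (by positivity)]
  have h5 : (3 * M / x) ^ 3 * (2 * ‖Zt s‖) ^ 4 * (4 * M * tau s ^ (3 * ε)) =
    ((3 * M) ^ 3 * 2 ^ 4 * (4 * M) * (‖Zt s‖ ^ 4 * tau s ^ (3 * ε))) / x ^ 3 := by
    field_simp
  rw [h5, le_div_iff₀ (by positivity), one_mul] at this
  exact this

end CipZ

namespace CipZ

lemma Zt_lower {ε : ℝ} (h0 : 0 < ε) (h1 : ε ≤ 1 / 4) : ∃ M c : ℝ, 0 < M ∧ 0 < c ∧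
    (∀ s : ℂ, 1 - ε / 2 ≤ s.re → s.re ≤ 5 / 2 → ‖deriv Zt s‖ ≤ M * tau s ^ (3 * ε)) ∧
    (∀ s : ℂ, 1 < s.re → s.re ≤ 2 → c / (tau s ^ (3 * ε)) ^ 4 ≤ ‖Zt s‖) := by
  obtain ⟨M0, hM0, -, hd0⟩ := norm_deriv_Zt_le h0 h1
  obtain ⟨c, hc, hl⟩ := Zt_lower_pre h0 h1
  -- enlarge M
  obtain ⟨M, hM, hMM, hMc⟩ : ∃ M : ℝ, 0 < M ∧ M0 ≤ M ∧ c ≤ 16 * M ^ 4 := by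
    refine ⟨M0 + c + 1, by positivity, by linarith, ?_⟩
    have : 1 ≤ M0 + c + 1 := by linarith
    have h2 : M0 + c + 1 ≤ (M0 + c + 1) ^ 4 := le_self_pow₀ this (by norm_num)
    nlinarith
  have hd : ∀ s : ℂ, 1 - ε / 2 ≤ s.re → s.re ≤ 5 / 2 → ‖deriv Zt s‖ ≤ M * tau s ^ (3 * ε) := by
    intro s a b
    refine (hd0 s a b).trans ?_
    have : 0 ≤ tau s ^ (3 * ε) := Real.rpow_nonneg (tau_pos s).le _
    gcongr
  set κ := c / (16 * M ^ 4) with hκ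
  have hκ0 : 0 < κ := by positivity
  have hκ1 : κ ≤ 1 := by rw [hκ, div_le_one (by positivity)]; exact hMc
  have hc' : c = 16 * M ^ 4 * κ := by rw [hκ]; field_simp
  -- compact part
  have hK : IsCompact (Set.Icc (1:ℝ) 2 ×ℂ Set.Icc (-1:ℝ) 1) :=
    isCompact_Icc.reProdIm isCompact_Icc
  obtain ⟨c1, hc1, hl1⟩ : ∃ c1 : ℝ, 0 < c1 ∧ ∀ s ∈ (Set.Icc (1:ℝ) 2 ×ℂ Set.Icc (-1:ℝ) 1),
      c1 ≤ ‖Zt s‖ := by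
    have hne : (Set.Icc (1:ℝ) 2 ×ℂ Set.Icc (-1:ℝ) 1).Nonempty :=
      ⟨1, by simp [Complex.mem_reProdIm]⟩
    obtain ⟨s0, hs0, hmin⟩ := hK.exists_isMinOn hne (f := fun s => ‖Zt s‖) (by
      intro s hs
      have : 1 ≤ s.re := (Complex.mem_reProdIm.mp hs).1.1
      exact (differentiableAt_Zt (ne_zero_of_re_pos (by linarith))).continuousAt.norm.continuousWithinAt)
    refine ⟨‖Zt s0‖, norm_pos_iff.mpr (Zt_ne_zero (Complex.mem_reProdIm.mp hs0).1.1), fun s hs => hmin hs⟩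
  refine ⟨M, min c1 (M * κ), hM, by positivity, hd, fun s hs hs2 => ?_⟩
  set ρ := tau s ^ (3 * ε) with hρ
  have hρ1 : 1 ≤ ρ := Real.one_le_rpow (one_le_tau s) (by linarith)
  have hρ0 : 0 < ρ := by linarith
  rcases le_total |s.im| 1 with him | him
  · refine (div_le_self (by positivity) (one_le_pow₀ hρ1)).trans ((min_le_left _ _).trans ?_)
    exact hl1 s (Complex.mem_reProdIm.mpr ⟨⟨hs.le, hs2⟩, abs_le.mp him⟩)
  · refine (div_le_div_of_nonneg_right (min_le_right _ _) (by positivity)).trans ?_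
    set δ := κ / ρ ^ 5 with hδ
    have hδ0 : 0 < δ := by positivity
    have hδ1 : δ ≤ 1 := (div_le_self hκ0.le (one_le_pow₀ hρ1)).trans hκ1
    have hgoal : M * κ / ρ ^ 4 = M * ρ * δ := by rw [hδ]; field_simp
    rw [hgoal]
    -- lower bound for abscissa ≥ 1+δ
    have big : ∀ w : ℂ, w.im = s.im → 1 + δ ≤ w.re → w.re ≤ 2 → 2 * M * ρ * δ ≤ ‖Zt w‖ := by
      intro w hw hw1 hw2
      have ht : tau w = tau s := by simp [tau, hw]
      have := hl w (by linarith) hw2 (by rw [hw]; exact him)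
      rw [ht, ← hρ] at this
      have h2 : (2 * M * ρ * δ) ^ 4 ≤ ‖Zt w‖ ^ 4 := by
        refine le_trans ?_ this
        rw [le_div_iff₀ hρ0]
        have : δ ^ 3 ≤ (w.re - 1) ^ 3 := by gcongr; linarith
        calc (2 * M * ρ * δ) ^ 4 * ρ = 16 * M ^ 4 * (ρ ^ 5 * δ) * δ ^ 3 := by ring
          _ = c * δ ^ 3 := by rw [hc', hδ]; field_simp
          _ ≤ _ := by gcongr
      exact le_of_pow_le_pow_left₀ (by norm_num) (norm_nonneg _) h2
    rcases le_total (1 + δ) s.re with h | h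
    · have := big s rfl h hs2
      have h3 : 0 < M * ρ * δ := by positivity
      linarith
    · set w : ℂ := ⟨1 + δ, s.im⟩ with hw
      have hbw := big w rfl le_rfl (by simp [hw]; linarith)
      have hmv := Convex.norm_image_sub_le_of_norm_deriv_le (f := Zt)
        (s := (Set.Icc (1:ℝ) 2 ×ℂ {s.im})) (x := s) (y := w) (C := M * ρ) ?_ ?_ ?_ ?_ ?_
      · have hws : ‖w - s‖ ≤ δ := by
          have : w - s = ((1 + δ - s.re : ℝ) : ℂ) := by
            apply Complex.ext <;> simp [hw]
          rw [this, Complex.norm_real, Real.norm_eq_abs, abs_le]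
          constructor <;> linarith
        have h4 : ‖Zt w‖ - ‖Zt s‖ ≤ M * ρ * δ :=
          (norm_sub_norm_le _ _).trans (hmv.trans (by gcongr))
        linarith
      · intro z hz
        have : 1 ≤ z.re := (Complex.mem_reProdIm.mp hz).1.1
        exact differentiableAt_Zt (ne_zero_of_re_pos (by linarith))
      · intro z hz
        have hz1 := (Complex.mem_reProdIm.mp hz).1
        have hz2 : z.im = s.im := (Complex.mem_reProdIm.mp hz).2
        have := hd z (by linarith [hz1.1]) (by linarith [hz1.2])
        rwa [show tau z = tau s by simp [tau, hz2]] at this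
      · exact ((convex_Icc (1:ℝ) 2).linear_preimage Complex.reLm).inter
          ((convex_singleton s.im).linear_preimage Complex.imLm)
      · exact Complex.mem_reProdIm.mpr ⟨⟨hs.le, hs2⟩, rfl⟩
      · exact Complex.mem_reProdIm.mpr ⟨⟨by simp [hw]; linarith, by simp [hw]; linarith⟩, rfl⟩

/-- The Laplace transform of the doubly smoothed error term. -/
noncomputable def W (s : ℂ) : ℂ := -(deriv riemannZeta₁ s / riemannZeta₁ s) / s ^ 2

lemma W_eq {s : ℂ} (h0 : s ≠ 0) (hz : Zt s ≠ 0) :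
    W s = -(deriv Zt s / Zt s + 1 / s) / s ^ 2 := by
  have hz1 : riemannZeta₁ s ≠ 0 := fun h => hz (by simp [Zt, h])
  have hd : deriv Zt s = (deriv riemannZeta₁ s * s - riemannZeta₁ s * 1) / s ^ 2 := by
    have := (((differentiable_riemannZeta₁ s).hasDerivAt).div (hasDerivAt_id s) h0).deriv
    simp only [id] at this
    exact this
  rw [W, hd, Zt]; field_simp; ring

lemma W_diff {s : ℂ} (h0 : s ≠ 0) (hz : Zt s ≠ 0) : DifferentiableAt ℂ W s := by
  have hz1 : riemannZeta₁ s ≠ 0 := fun h => hz (by simp [Zt, h])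
  have : DifferentiableAt ℂ (deriv riemannZeta₁) s := differentiable_riemannZeta₁.deriv s
  unfold W
  exact ((this.div (differentiable_riemannZeta₁ s) hz1).neg).div (by fun_prop) (pow_ne_zero _ h0)

lemma W_bound {ε : ℝ} (h0 : 0 < ε) (h1 : ε ≤ 1 / 4) : ∃ C κ : ℝ, 0 < C ∧ 0 < κ ∧
    ∀ s : ℂ, 1 < s.re → s.re ≤ 2 → ∀ j : ℕ,
      ‖iteratedDeriv j W s‖ ≤ j.factorial * (C * (tau s ^ (3 * ε)) ^ 5 / tau s ^ 2) /
        (κ / (tau s ^ (3 * ε)) ^ 5) ^ j := by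
  obtain ⟨M, c, hM, hc, hd, hl⟩ := Zt_lower h0 h1
  set κ := min (ε / 2) (c / (4 * M)) with hκ
  have hκ0 : 0 < κ := by positivity
  refine ⟨(4 * M / c + 2) * 36, κ, by positivity, hκ0, fun s hs hs2 j => ?_⟩
  set ρ := tau s ^ (3 * ε) with hρ
  have hρ1 : 1 ≤ ρ := Real.one_le_rpow (one_le_tau s) (by linarith)
  have hρ0 : 0 < ρ := by linarith
  have hls := hl s hs hs2
  rw [← hρ] at hls
  set r := κ / ρ ^ 5 with hr
  have hr0 : 0 < r := by positivity
  have hrκ : r ≤ κ := div_le_self hκ0.le (one_le_pow₀ hρ1)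
  have hrε : r ≤ ε / 2 := hrκ.trans (min_le_left _ _)
  have hτ : ∀ w ∈ Metric.closedBall s r, tau w ≤ 2 * tau s ∧ tau s ≤ 2 * tau w ∧
      1 - ε / 2 ≤ w.re ∧ w.re ≤ 5 / 2 := by
    intro w hw
    have hd' : dist w s ≤ r := Metric.mem_closedBall.mp hw
    have hre := re_of_dist hd'
    exact ⟨tau_le_of_dist hd' (by linarith), tau_le_of_dist ((dist_comm _ _).trans_le hd') (by linarith),
      by linarith, by linarith⟩
  have hdw : ∀ w ∈ Metric.closedBall s r, ‖deriv Zt w‖ ≤ 2 * M * ρ := by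
    intro w hw
    obtain ⟨a, -, b, c⟩ := hτ w hw
    have h3 := two_tau_rpow h0 h1 (tau_pos w).le (tau_pos s).le a
    have := hd w b c
    rw [← hρ] at h3
    nlinarith
  have hlw : ∀ w ∈ Metric.closedBall s r, c / (2 * ρ ^ 4) ≤ ‖Zt w‖ := by
    intro w hw
    have hmv := Convex.norm_image_sub_le_of_norm_deriv_le (f := Zt)
        (s := Metric.closedBall s r) (x := w) (y := s) (C := 2 * M * ρ) (fun z hz => by
          have := hτ z hz
          exact differentiableAt_Zt (ne_zero_of_re_pos (by linarith))) hdw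
          (convex_closedBall _ _) hw (Metric.mem_closedBall_self hr0.le)
    have hws : ‖s - w‖ ≤ r := by
      rw [← dist_eq_norm, dist_comm]; exact Metric.mem_closedBall.mp hw
    have h4 : ‖Zt s‖ - ‖Zt w‖ ≤ 2 * M * ρ * r :=
      (norm_sub_norm_le _ _).trans (hmv.trans (by gcongr))
    have h5 : 2 * M * ρ * r ≤ c / (2 * ρ ^ 4) := by
      have : 2 * M * ρ * r = 2 * M * κ / ρ ^ 4 := by rw [hr]; field_simp
      rw [this]
      have : 2 * M * κ ≤ c / 2 := by
        calc 2 * M * κ ≤ 2 * M * (c / (4 * M)) := by gcongr; exact min_le_right _ _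
          _ = c / 2 := by field_simp; ring
      calc 2 * M * κ / ρ ^ 4 ≤ (c / 2) / ρ ^ 4 := by gcongr
        _ = _ := by field_simp
    have h6 : c / ρ ^ 4 = c / (2 * ρ ^ 4) + c / (2 * ρ ^ 4) := by field_simp; ring
    linarith
  have hZne : ∀ w ∈ Metric.closedBall s r, Zt w ≠ 0 := by
    intro w hw
    exact norm_pos_iff.mp (lt_of_lt_of_le (by positivity) (hlw w hw))
  have hw0 : ∀ w ∈ Metric.closedBall s r, w ≠ 0 := fun w hw =>
    ne_zero_of_re_pos (by linarith [(hτ w hw).2.2.1])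
  refine Complex.norm_iteratedDeriv_le_of_forall_mem_sphere_norm_le j hr0 ?_ ?_
  · refine DifferentiableOn.diffContOnCl fun w hw => ?_
    rw [closure_ball _ hr0.ne'] at hw
    exact (W_diff (hw0 w hw) (hZne w hw)).differentiableWithinAt
  · intro w hws
    have hw := Metric.sphere_subset_closedBall hws
    rw [W_eq (hw0 w hw) (hZne w hw), norm_div, norm_neg, norm_pow]
    obtain ⟨-, a, b, -⟩ := hτ w hw
    have hwn : 3 / 4 ≤ ‖w‖ := le_trans (by linarith) (Complex.re_le_norm w)
    have hwt := tau_le_norm (s := w) (by linarith)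
    have hwt2 : tau s ^ 2 / 36 ≤ ‖w‖ ^ 2 := by
      have : tau s / 6 ≤ ‖w‖ := by linarith
      have h7 : (tau s / 6) ^ 2 ≤ ‖w‖ ^ 2 := by
        have := tau_pos s
        gcongr
      linarith [h7, show (tau s / 6) ^ 2 = tau s ^ 2 / 36 by ring]
    have hnum : ‖deriv Zt w / Zt w + 1 / w‖ ≤ (4 * M / c + 2) * ρ ^ 5 := by
      refine (norm_add_le _ _).trans ?_
      rw [norm_div, norm_div, norm_one, add_mul]
      have e1 : ‖deriv Zt w‖ / ‖Zt w‖ ≤ 4 * M / c * ρ ^ 5 := by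
        calc ‖deriv Zt w‖ / ‖Zt w‖ ≤ (2 * M * ρ) / (c / (2 * ρ ^ 4)) := by
              have := hdw w hw
              have := hlw w hw
              gcongr
          _ = _ := by field_simp; ring
      have e2 : 1 / ‖w‖ ≤ 2 * ρ ^ 5 := by
        have : 1 / ‖w‖ ≤ 2 := by rw [div_le_iff₀ (by linarith)]; linarith
        have h8 : 1 ≤ ρ ^ 5 := one_le_pow₀ hρ1
        linarith
      linarith
    have ht0 := tau_pos s
    calc _ ≤ ((4 * M / c + 2) * ρ ^ 5) / (tau s ^ 2 / 36) := by gcongr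
      _ = _ := by field_simp

/-- Uniform bound for the derivatives of `W` on the line `Re s = σ`. -/
lemma W_deriv_bound (k : ℕ) : ∃ C : ℝ, 0 < C ∧ ∀ s : ℂ, 1 < s.re → s.re ≤ 2 → ∀ j ≤ k,
    ‖iteratedDeriv j W s‖ ≤ C * tau s ^ (-(3/2) : ℝ) := by
  set ε : ℝ := 1 / (30 * (k + 1)) with hε
  have hε0 : 0 < ε := by positivity
  have hε1 : ε ≤ 1 / 4 := by
    rw [hε]; apply one_div_le_one_div_of_le (by norm_num)
    have : (0:ℝ) ≤ k := by positivity
    linarith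
  obtain ⟨C, κ, hC, hκ, hb⟩ := W_bound hε0 hε1
  refine ⟨∑ j ∈ Finset.range (k + 1), j.factorial * C / κ ^ j, Finset.sum_pos (fun j _ => by positivity)
    ⟨0, by simp⟩, fun s hs hs2 j hj => ?_⟩
  refine (hb s hs hs2 j).trans ?_
  have ht := tau_pos s
  have h1 := one_le_tau s
  set ρ := tau s ^ (3 * ε) with hρ
  have hρ1 : 1 ≤ ρ := Real.one_le_rpow h1 (by linarith)
  have hρ0 : 0 < ρ := by linarith
  have hρk : ρ ^ (5 * (j + 1)) ≤ tau s ^ (1/2 : ℝ) := by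
    rw [hρ, ← Real.rpow_natCast, ← Real.rpow_mul ht.le]
    apply Real.rpow_le_rpow_of_exponent_le h1
    have : (j : ℝ) ≤ k := by exact_mod_cast hj
    have h2 : 0 < (k + 1 : ℝ) := by positivity
    rw [hε]; push_cast
    rw [mul_one_div, div_mul_eq_mul_div, div_le_div_iff₀ (by positivity) (by norm_num)]
    linarith
  have e : (j.factorial : ℝ) * (C * ρ ^ 5 / tau s ^ 2) / (κ / ρ ^ 5) ^ j =
      j.factorial * C / κ ^ j * (ρ ^ (5 * (j + 1)) / tau s ^ 2) := by
    rw [div_pow, ← pow_mul]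
    field_simp; ring
  rw [e]
  have e2 : ρ ^ (5 * (j + 1)) / tau s ^ 2 ≤ tau s ^ (-(3/2) : ℝ) := by
    have : tau s ^ (-(3/2) : ℝ) = tau s ^ (1/2 : ℝ) / tau s ^ 2 := by
      rw [← Real.rpow_natCast, ← Real.rpow_sub ht]; norm_num
    rw [this]; gcongr
  have e3 : (j.factorial : ℝ) * C / κ ^ j ≤ ∑ j ∈ Finset.range (k + 1), j.factorial * C / κ ^ j :=
    Finset.single_le_sum (f := fun j : ℕ => (j.factorial : ℝ) * C / κ ^ j)
      (fun i _ => by positivity) (Finset.mem_range.mpr (by omega))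
  have := Real.rpow_pos_of_pos ht (-(3/2) : ℝ)
  gcongr

end CipZ

namespace CipZ
open MeasureTheory FourierTransform

noncomputable def psK : ℝ := Real.log 4 + 4

lemma psK_pos : 0 < psK := by
  unfold psK; have := Real.log_nonneg (by norm_num : (1:ℝ) ≤ 4); linarith

noncomputable def e0 : ℝ → ℝ :=
  (Set.Ioi (0:ℝ)).indicator (fun v => Chebyshev.psi (exp v) - exp v + 1)

lemma psi_exp_meas : Measurable (fun v : ℝ => Chebyshev.psi (exp v)) :=
  (Chebyshev.psi_mono.comp Real.exp_monotone).measurable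

lemma e0_meas : Measurable e0 := by
  refine Measurable.indicator ?_ measurableSet_Ioi
  exact (psi_exp_meas.sub Real.measurable_exp).add_const 1

lemma abs_e0_le (v : ℝ) : |e0 v| ≤ (Set.Ioi (0:ℝ)).indicator (fun v => (psK + 2) * exp v) v := by
  unfold e0
  by_cases hv : v ∈ Set.Ioi (0:ℝ)
  · rw [Set.indicator_of_mem hv, Set.indicator_of_mem hv]
    have h1 : 1 ≤ exp v := Real.one_le_exp (le_of_lt hv)
    have h2 : Chebyshev.psi (exp v) ≤ psK * exp v := Chebyshev.psi_le_const_mul_self (by positivity)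
    have h3 := Chebyshev.psi_nonneg (exp v)
    have h4 := mul_nonneg psK_pos.le (exp_pos v).le
    rw [abs_le]; constructor <;> nlinarith
  · rw [Set.indicator_of_notMem hv, Set.indicator_of_notMem hv]; simp

lemma int_exp_ind {σ : ℝ} (hσ : 0 < σ) (c : ℝ) :
    Integrable ((Set.Ioi (0:ℝ)).indicator (fun v => c * exp (-σ * v))) := by
  rw [integrable_indicator_iff measurableSet_Ioi]
  exact ((exp_neg_integrableOn_Ioi 0 hσ)).const_mul c

noncomputable def af (σ : ℝ) (v : ℝ) : ℂ := ((e0 v * exp (-σ * v) : ℝ) : ℂ)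

noncomputable def bf (σ : ℝ) : ℝ → ℂ :=
  (Set.Ioi (0:ℝ)).indicator (fun v => ((exp (-σ * v) : ℝ) : ℂ))

lemma af_int {σ : ℝ} (hσ : 1 < σ) : Integrable (af σ) := by
  refine Integrable.ofReal ?_
  refine (int_exp_ind (σ := σ - 1) (by linarith) (psK + 2)).mono'
    (e0_meas.mul (by fun_prop)).aestronglyMeasurable (Filter.Eventually.of_forall fun v => ?_)
  show ‖e0 v * exp (-σ * v)‖ ≤ _
  rw [norm_mul, Real.norm_eq_abs, Real.norm_eq_abs, abs_of_pos (exp_pos _)]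
  have := mul_le_mul_of_nonneg_right (abs_e0_le v) (exp_pos (-σ * v)).le
  refine this.trans (le_of_eq ?_)
  by_cases hv : v ∈ Set.Ioi (0:ℝ)
  · rw [Set.indicator_of_mem hv, Set.indicator_of_mem hv, mul_assoc, ← Real.exp_add]; ring_nf
  · rw [Set.indicator_of_notMem hv, Set.indicator_of_notMem hv]; simp

lemma bf_int {σ : ℝ} (hσ : 0 < σ) : Integrable (bf σ) := by
  unfold bf
  rw [integrable_indicator_iff measurableSet_Ioi]
  exact (exp_neg_integrableOn_Ioi 0 hσ).ofReal

noncomputable def Q (u : ℝ) : ℝ := ∫ v in (0:ℝ)..u, e0 v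

lemma e0_ii (a b : ℝ) : IntervalIntegrable e0 volume a b := by
  refine IntervalIntegrable.mono_fun (f := fun v => (psK + 2) * exp v)
    (Continuous.intervalIntegrable (by fun_prop) _ _) e0_meas.aestronglyMeasurable
    (Filter.Eventually.of_forall fun v => ?_)
  have h0 := psK_pos
  show ‖e0 v‖ ≤ ‖(psK + 2) * exp v‖
  rw [Real.norm_eq_abs, Real.norm_eq_abs, abs_of_pos (by positivity : 0 < (psK + 2) * exp v)]
  refine (abs_e0_le v).trans (Set.indicator_le_self' (fun _ _ => by positivity) v)

lemma Q_cont : Continuous Q := intervalIntegral.continuous_primitive e0_ii 0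

lemma e0_nonpos {v : ℝ} (hv : v ≤ 0) : e0 v = 0 := by
  unfold e0; rw [Set.indicator_of_notMem]; simpa using hv

lemma Q_eq (u : ℝ) : Q u = ∫ v in Set.Iio u, e0 v := by
  unfold Q
  rcases le_total 0 u with h | h
  · rw [intervalIntegral.integral_of_le h, ← integral_Iic_eq_integral_Iio]
    symm
    refine setIntegral_eq_of_subset_of_forall_sdiff_eq_zero measurableSet_Iic
      (fun x hx => hx.2) fun x hx => e0_nonpos ?_
    by_contra h'
    exact hx.2 ⟨not_le.mp h', hx.1⟩
  · rw [intervalIntegral.integral_of_ge h, setIntegral_eq_zero_of_forall_eq_zero,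
      setIntegral_eq_zero_of_forall_eq_zero, neg_zero]
    · intro x hx; exact e0_nonpos (le_trans (le_of_lt hx) h)
    · intro x hx; exact e0_nonpos hx.2

noncomputable def gf (σ : ℝ) (u : ℝ) : ℂ := ((Q u * exp (-σ * u) : ℝ) : ℂ)

lemma gf_cont (σ : ℝ) : Continuous (gf σ) := by
  unfold gf; have := Q_cont; fun_prop

lemma gf_eq_conv (σ : ℝ) : gf σ = convolution (af σ) (bf σ) (ContinuousLinearMap.mul ℂ ℂ) := by
  funext u
  rw [convolution_def]
  have : ∀ t, (ContinuousLinearMap.mul ℂ ℂ) (af σ t) (bf σ (u - t)) =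
      (((Set.Iio u).indicator e0 t * exp (-σ * u) : ℝ) : ℂ) := by
    intro t
    simp only [ContinuousLinearMap.mul_apply', af, bf]
    by_cases ht : t < u
    · rw [Set.indicator_of_mem (by simpa using ht), Set.indicator_of_mem (by simpa using ht)]
      rw [← Complex.ofReal_mul, mul_assoc, ← Real.exp_add]; ring_nf
    · rw [Set.indicator_of_notMem (by simpa using ht), Set.indicator_of_notMem (by simpa using ht)]
      simp
  simp_rw [this]
  rw [integral_complex_ofReal, integral_mul_const, integral_indicator measurableSet_Iio, ← Q_eq, gf]

lemma gf_int {σ : ℝ} (hσ : 1 < σ) : Integrable (gf σ) := by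
  rw [gf_eq_conv]
  exact (af_int hσ).integrable_convolution _ (bf_int (by linarith))

lemma psi_laplace {s : ℂ} (hs : 1 < s.re) :
    s * ∫ v in Set.Ioi (0:ℝ), (Chebyshev.psi (exp v) : ℂ) * Complex.exp (-s * v) =
      -deriv riemannZeta s / riemannZeta s := by
  rw [← ArithmeticFunction.LSeries_vonMangoldt_eq_deriv_riemannZeta_div hs]
  have hps : ∀ x : ℝ, Chebyshev.psi x = ∑ k ∈ Finset.Icc 1 ⌊x⌋₊, ArithmeticFunction.vonMangoldt k := by
    intro x; rfl
  rw [LSeries_eq_mul_integral_of_nonneg (fun n => ArithmeticFunction.vonMangoldt n) (r := 1)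
    zero_le_one hs ?_ (fun n => ArithmeticFunction.vonMangoldt_nonneg)]
  · congr 1
    have hcv := integral_image_eq_integral_abs_deriv_smul (s := Set.Ioi (0:ℝ)) (f := Real.exp)
      (f' := Real.exp) measurableSet_Ioi (fun x _ => (Real.hasDerivAt_exp x).hasDerivWithinAt)
      (Real.exp_injective.injOn)
      (fun t : ℝ => (∑ k ∈ Finset.Icc 1 ⌊t⌋₊, ((ArithmeticFunction.vonMangoldt k : ℝ) : ℂ)) *
        (t : ℂ) ^ (-(s + 1)))
    have him : Real.exp '' Set.Ioi 0 = Set.Ioi 1 := by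
      ext x; constructor
      · rintro ⟨y, hy, rfl⟩; exact Real.one_lt_exp_iff.mpr hy
      · intro hx; exact ⟨Real.log x, Real.log_pos hx, Real.exp_log (lt_trans one_pos hx)⟩
    rw [him] at hcv
    rw [hcv]
    refine setIntegral_congr_fun measurableSet_Ioi fun v _ => ?_
    rw [hps, abs_of_pos (exp_pos v), Complex.real_smul, Complex.ofReal_sum]
    have : ((exp v : ℝ) : ℂ) ^ (-(s + 1)) = Complex.exp (-(s + 1) * v) := by
      rw [Complex.cpow_def_of_ne_zero (by exact_mod_cast (exp_pos v).ne'), ← Complex.ofReal_log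
        (exp_pos v).le, Real.log_exp, mul_comm]
    rw [this, Complex.ofReal_exp]
    rw [show Complex.exp (-s * v) = Complex.exp v * Complex.exp (-(s + 1) * v) by
      rw [← Complex.exp_add]; ring_nf]
    ring
  · refine Asymptotics.IsBigO.of_bound psK (Filter.Eventually.of_forall fun n => ?_)
    have h1 := hps n
    rw [Nat.floor_natCast] at h1
    rw [← h1, Real.rpow_one, Real.norm_eq_abs, abs_of_nonneg (Chebyshev.psi_nonneg _)]
    simpa [psK] using Chebyshev.psi_le_const_mul_self (x := n) (by positivity)

lemma cexp_intOn {s : ℂ} (hs : 0 < s.re) :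
    IntegrableOn (fun v : ℝ => Complex.exp (-s * v)) (Set.Ioi 0) :=
  integrableOn_exp_mul_complex_Ioi (by simpa using hs) 0

lemma e0_laplace {s : ℂ} (hs : 1 < s.re) :
    ∫ v in Set.Ioi (0:ℝ), (e0 v : ℂ) * Complex.exp (-s * v) =
      -(deriv riemannZeta₁ s / riemannZeta₁ s) / s := by
  have hs1 : s ≠ 1 := by rintro rfl; simp at hs
  have hs0 : s ≠ 0 := ne_zero_of_re_pos (by linarith)
  have hs1' : s - 1 ≠ 0 := sub_ne_zero.mpr hs1
  have i1 := cexp_intOn (s := s - 1) (by simpa using hs)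
  have i2 := cexp_intOn (s := s) (by linarith)
  have i3 : IntegrableOn (fun v : ℝ => (Chebyshev.psi (exp v) : ℂ) * Complex.exp (-s * v)) (Set.Ioi 0) := by
    refine Integrable.mono' (g := fun v => psK * exp (-(s.re - 1) * v)) 
      ((exp_neg_integrableOn_Ioi 0 (by linarith)).const_mul psK) ?_ ?_
    · exact ((Complex.measurable_ofReal.comp psi_exp_meas).mul (by fun_prop)).aestronglyMeasurable
    · refine Filter.Eventually.of_forall fun v => ?_
      rw [norm_mul, Complex.norm_exp, Complex.norm_real, Real.norm_eq_abs,
        abs_of_nonneg (Chebyshev.psi_nonneg _)]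
      have h2 : Chebyshev.psi (exp v) ≤ psK * exp v := Chebyshev.psi_le_const_mul_self (by positivity)
      refine (mul_le_mul_of_nonneg_right h2 (exp_pos _).le).trans (le_of_eq ?_)
      rw [mul_assoc, ← Real.exp_add]; congr 2; simp; ring
  have e : ∫ v in Set.Ioi (0:ℝ), (e0 v : ℂ) * Complex.exp (-s * v) =
      ∫ v in Set.Ioi (0:ℝ), ((Chebyshev.psi (exp v) : ℂ) * Complex.exp (-s * v) -
        Complex.exp (-(s - 1) * v) + Complex.exp (-s * v)) := by
    refine setIntegral_congr_fun measurableSet_Ioi fun v hv => ?_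
    simp only [e0]
    rw [Set.indicator_of_mem hv]
    push_cast
    rw [show Complex.exp (-(s - 1) * v) = Complex.exp v * Complex.exp (-s * v) by
      rw [← Complex.exp_add]; ring_nf]
    ring
  have e2 := integral_add (i3.sub i1) i2
  simp only [Pi.sub_apply] at e2
  rw [e, e2, integral_sub i3 i1]
  rw [integral_exp_mul_complex_Ioi (by simpa using hs), integral_exp_mul_complex_Ioi (by simp; linarith)]
  have hp := psi_laplace hs
  rw [mul_comm, ← eq_div_iff hs0] at hp
  rw [hp, deriv_riemannZeta_eq_neg_inv_sub_sq_mul_add hs1, riemannZeta_eq_inv_sub_mul hs1]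
  have hz := riemannZeta₁_ne_zero (s := s) hs.le
  simp only [Complex.ofReal_zero, mul_zero, Complex.exp_zero]
  have hns : -s ≠ 0 := neg_ne_zero.mpr hs0
  have hns1 : -(s - 1) ≠ 0 := neg_ne_zero.mpr hs1'
  rw [div_neg, div_neg]
  field_simp
  ring

lemma fourier_af {σ : ℝ} (hσ : 1 < σ) (ξ : ℝ) :
    𝓕 (af σ) ξ = -(deriv riemannZeta₁ (σ + 2 * π * ξ * Complex.I) /
      riemannZeta₁ (σ + 2 * π * ξ * Complex.I)) / (σ + 2 * π * ξ * Complex.I) := by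
  rw [← e0_laplace (by simpa using hσ), Real.fourier_real_eq_integral_exp_smul]
  rw [← integral_indicator measurableSet_Ioi]
  refine integral_congr_ae (Filter.Eventually.of_forall fun v => ?_)
  simp only [af]
  by_cases hv : v ∈ Set.Ioi (0:ℝ)
  · rw [Set.indicator_of_mem hv, smul_eq_mul, Complex.ofReal_mul (e0 v), Complex.ofReal_exp]
    rw [show Complex.exp (-(σ + 2 * π * ξ * Complex.I) * v) =
      Complex.exp (↑(-2 * π * v * ξ) * Complex.I) * Complex.exp (↑(-σ * v)) by
        rw [← Complex.exp_add]; congr 1; push_cast; ring]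
    ring
  · rw [Set.indicator_of_notMem hv, e0_nonpos (by simpa using hv)]; simp

lemma fourier_bf {σ : ℝ} (hσ : 1 < σ) (ξ : ℝ) :
    𝓕 (bf σ) ξ = 1 / (σ + 2 * π * ξ * Complex.I) := by
  have h := integral_exp_mul_complex_Ioi (a := -(σ + 2 * π * ξ * Complex.I)) (by simp; linarith) 0
  rw [Complex.ofReal_zero, mul_zero, Complex.exp_zero, neg_div_neg_eq] at h
  rw [← h, Real.fourier_real_eq_integral_exp_smul]
  rw [← integral_indicator measurableSet_Ioi]
  refine integral_congr_ae (Filter.Eventually.of_forall fun v => ?_)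
  simp only [bf]
  by_cases hv : v ∈ Set.Ioi (0:ℝ)
  · rw [Set.indicator_of_mem hv, Set.indicator_of_mem hv, smul_eq_mul, Complex.ofReal_exp,
      ← Complex.exp_add]
    congr 1; push_cast; ring
  · rw [Set.indicator_of_notMem hv, Set.indicator_of_notMem hv]; simp

lemma fourier_gf {σ : ℝ} (hσ : 1 < σ) : 𝓕 (gf σ) = fun ξ : ℝ => W (σ + 2 * π * ξ * Complex.I) := by
  funext ξ
  rw [gf_eq_conv, Real.fourier_mul_convolution_eq (af_int hσ) (bf_int (by linarith)),
    fourier_af hσ, fourier_bf hσ, W]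
  rw [div_mul_div_comm, mul_one, sq]

end CipZ

namespace CipZ
open MeasureTheory FourierTransform

lemma W_analytic {s : ℂ} (hs : 1 < s.re) : AnalyticAt ℂ W s := by
  have ho : IsOpen {w : ℂ | 1 < w.re} := isOpen_lt continuous_const Complex.continuous_re
  have : DifferentiableOn ℂ W {w : ℂ | 1 < w.re} := fun w hw => by
    have hw' : 1 < w.re := hw
    exact (W_diff (ne_zero_of_re_pos (by linarith)) (Zt_ne_zero hw'.le)).differentiableWithinAt
  exact this.analyticAt (ho.mem_nhds hs)

noncomputable def ln (σ ξ : ℝ) : ℂ := σ + 2 * π * ξ * Complex.I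

lemma ln_re (σ ξ : ℝ) : (ln σ ξ).re = σ := by simp [ln]
lemma ln_im (σ ξ : ℝ) : (ln σ ξ).im = 2 * π * ξ := by simp [ln]

lemma hasDerivAt_wn {σ : ℝ} (hσ : 1 < σ) (n : ℕ) (ξ : ℝ) :
    HasDerivAt (fun ξ : ℝ => (2 * π * Complex.I) ^ n * iteratedDeriv n W (ln σ ξ))
      ((2 * π * Complex.I) ^ (n + 1) * iteratedDeriv (n + 1) W (ln σ ξ)) ξ := by
  have ha : AnalyticAt ℂ (iteratedDeriv n W) (ln σ ξ) := by
    rw [iteratedDeriv_eq_iterate]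
    exact (W_analytic (by rw [ln_re]; exact hσ)).iterated_deriv n
  have h1 := ha.differentiableAt.hasDerivAt
  rw [← iteratedDeriv_succ] at h1
  have h2 : HasDerivAt (fun ξ : ℝ => ln σ ξ) (2 * π * Complex.I) ξ := by
    have := (((hasDerivAt_id ξ).ofReal_comp).const_mul (2 * π * Complex.I)).const_add (σ : ℂ)
    simp only [id, Complex.ofReal_one, mul_one] at this
    refine this.congr_of_eventuallyEq (Filter.Eventually.of_forall fun x => ?_)
    simp only [ln]; ring
  have h3 := (h1.comp ξ h2).const_mul ((2 * π * Complex.I) ^ n)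
  refine h3.congr_deriv ?_
  ring

lemma iteratedDeriv_w {σ : ℝ} (hσ : 1 < σ) (n : ℕ) :
    iteratedDeriv n (fun ξ : ℝ => W (ln σ ξ)) =
      fun ξ : ℝ => (2 * π * Complex.I) ^ n * iteratedDeriv n W (ln σ ξ) := by
  induction n with
  | zero => simp
  | succ n ih =>
    rw [iteratedDeriv_succ, ih]
    funext ξ
    exact (hasDerivAt_wn hσ n ξ).deriv

lemma contDiff_w {σ : ℝ} (hσ : 1 < σ) (k : ℕ) : ContDiff ℝ (k : ℕ∞) (fun ξ : ℝ => W (ln σ ξ)) := by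
  refine contDiff_of_differentiable_iteratedDeriv fun m _ => ?_
  rw [iteratedDeriv_w hσ]
  exact fun ξ => (hasDerivAt_wn hσ m ξ).differentiableAt

lemma one_add_int : Integrable (fun x : ℝ => (1 + ‖x‖) ^ (-(3/2) : ℝ)) :=
  integrable_one_add_norm (by simp; norm_num)

lemma norm_iteratedDeriv_w (k : ℕ) : ∃ C : ℝ, 0 < C ∧ ∀ σ : ℝ, 1 < σ → σ ≤ 2 → ∀ j ≤ k, ∀ ξ : ℝ,
    ‖iteratedDeriv j (fun ξ : ℝ => W (ln σ ξ)) ξ‖ ≤ C * (1 + ‖ξ‖) ^ (-(3/2) : ℝ) := by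
  obtain ⟨C, hC, hb⟩ := W_deriv_bound k
  refine ⟨(2 * π) ^ k * C, by positivity, fun σ hσ hσ2 j hj ξ => ?_⟩
  rw [iteratedDeriv_w hσ, norm_mul, norm_pow]
  have h1 := hb (ln σ ξ) (by rw [ln_re]; exact hσ) (by rw [ln_re]; exact hσ2) j hj
  have hpi : (1:ℝ) ≤ 2 * π := by linarith [Real.pi_gt_three]
  have h2 : tau (ln σ ξ) ^ (-(3/2) : ℝ) ≤ (1 + ‖ξ‖) ^ (-(3/2) : ℝ) := by
    refine Real.rpow_le_rpow_of_nonpos (by positivity) ?_ (by norm_num)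
    rw [tau, ln_im, Real.norm_eq_abs, abs_mul, abs_of_pos (by positivity : 0 < 2 * π)]
    nlinarith [abs_nonneg ξ]
  have h3 : ‖(2 * π * Complex.I : ℂ)‖ = 2 * π := by
    simp [abs_of_pos Real.pi_pos]
  rw [h3, mul_assoc]
  have h4 : (2 * π) ^ j ≤ (2 * π) ^ k := pow_le_pow_right₀ hpi hj
  have h5 : ‖iteratedDeriv j W (ln σ ξ)‖ ≤ C * (1 + ‖ξ‖) ^ (-(3/2) : ℝ) :=
    h1.trans (by gcongr)
  gcongr

/-- Bound for the smoothed error term. -/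
lemma Q_bound (k : ℕ) : ∃ C : ℝ, 0 < C ∧ ∀ u : ℝ, 0 < u → |Q u| ≤ C * exp u / u ^ k := by
  obtain ⟨C, hC, hb⟩ := norm_iteratedDeriv_w k
  set I := ∫ x : ℝ, (1 + ‖x‖) ^ (-(3/2) : ℝ) with hI
  have hI0 : 0 ≤ I := integral_nonneg fun x => by positivity
  refine ⟨C * I + 1, by positivity, fun u hu => ?_⟩
  have main : ∀ σ : ℝ, 1 < σ → σ ≤ 2 → |Q u| * u ^ k ≤ C * I * exp (σ * u) := by
    intro σ hσ hσ2
    have hIntg : ∀ n : ℕ, (n : ℕ∞) ≤ (k : ℕ∞) →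
        Integrable (iteratedDeriv n (fun ξ : ℝ => W (ln σ ξ))) := by
      intro n hn
      have hn' : n ≤ k := by exact_mod_cast hn
      refine (one_add_int.const_mul C).mono' ?_ (Filter.Eventually.of_forall fun ξ => hb σ hσ hσ2 n hn' ξ)
      exact ((contDiff_w hσ k).continuous_iteratedDeriv n (by exact_mod_cast hn)).aestronglyMeasurable
    have hF : 𝓕 (gf σ) = fun ξ : ℝ => W (ln σ ξ) := fourier_gf hσ
    have hinv := (gf_int hσ).fourierInv_fourier_eq (by
      rw [hF]; simpa using hIntg 0 (by simp)) (gf_cont σ).continuousAt (v := u)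
    rw [hF, Real.fourierInv_eq_fourier_neg] at hinv
    have hd := congrFun (Real.fourier_iteratedDeriv (contDiff_w hσ k) hIntg (le_refl (k : ℕ∞))) (-u)
    rw [hinv] at hd
    have hn : ‖𝓕 (iteratedDeriv k (fun ξ : ℝ => W (ln σ ξ))) (-u)‖ ≤ C * I := by
      refine (VectorFourier.norm_fourierIntegral_le_integral_norm _ _ _ _ _).trans ?_
      rw [hI, ← integral_const_mul]
      exact integral_mono (hIntg k le_rfl).norm (one_add_int.const_mul C)
        (fun ξ => hb σ hσ hσ2 k le_rfl ξ)
    rw [hd, norm_smul, norm_pow] at hn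
    have h3 : ‖(2 * π * Complex.I * ((-u : ℝ) : ℂ) : ℂ)‖ = 2 * π * u := by
      simp [abs_of_pos Real.pi_pos, abs_of_pos hu]
    rw [h3, gf, Complex.norm_real, Real.norm_eq_abs, abs_mul, abs_of_pos (exp_pos _)] at hn
    have hpi : (1:ℝ) ≤ 2 * π := by linarith [Real.pi_gt_three]
    have h4 : u ^ k ≤ (2 * π * u) ^ k := by gcongr; nlinarith
    have h5 : u ^ k * (|Q u| * exp (-σ * u)) ≤ C * I := le_trans (by gcongr) hn
    have h6 : exp (-σ * u) * exp (σ * u) = 1 := by rw [← Real.exp_add]; simp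
    calc |Q u| * u ^ k = u ^ k * (|Q u| * exp (-σ * u)) * exp (σ * u) := by
          rw [mul_assoc, mul_assoc |Q u|, h6]; ring
      _ ≤ _ := by gcongr
  have hlim : |Q u| * u ^ k ≤ C * I * exp (1 * u) := by
    have ht : Filter.Tendsto (fun σ : ℝ => C * I * exp (σ * u)) (nhdsWithin 1 (Set.Ioi 1))
        (nhds (C * I * exp (1 * u))) := by
      have : Continuous (fun σ : ℝ => C * I * exp (σ * u)) := by fun_prop
      exact (this.tendsto 1).mono_left nhdsWithin_le_nhds
    refine ge_of_tendsto ht ?_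
    filter_upwards [Ioo_mem_nhdsGT (by norm_num : (1:ℝ) < 2)] with σ hσ using main σ hσ.1 hσ.2.le
  rw [one_mul] at hlim
  rw [le_div_iff₀ (by positivity)]
  nlinarith [exp_pos u]

lemma Q_sub {a b : ℝ} (ha : 0 ≤ a) (hab : a ≤ b) :
    IntervalIntegrable (fun v => Chebyshev.psi (exp v)) volume a b ∧
    ∫ v in a..b, Chebyshev.psi (exp v) = Q b - Q a + (exp b - exp a) - (b - a) := by
  have hii : IntervalIntegrable (fun v => Chebyshev.psi (exp v)) volume a b :=
    (Chebyshev.psi_mono.comp Real.exp_monotone).intervalIntegrable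
  refine ⟨hii, ?_⟩
  have h1 : Q b - Q a = ∫ v in a..b, e0 v :=
    intervalIntegral.integral_interval_sub_left (e0_ii _ _) (e0_ii _ _)
  have h2 : ∫ v in a..b, e0 v = ∫ v in a..b, (Chebyshev.psi (exp v) - exp v + 1) := by
    rw [intervalIntegral.integral_of_le hab, intervalIntegral.integral_of_le hab]
    refine setIntegral_congr_fun measurableSet_Ioc fun v hv => ?_
    simp only [e0]
    rw [Set.indicator_of_mem]
    exact lt_of_le_of_lt ha hv.1
  have hie : IntervalIntegrable Real.exp volume a b := Real.continuous_exp.intervalIntegrable _ _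
  rw [h1, h2, intervalIntegral.integral_add (hii.sub hie) (by simp),
    intervalIntegral.integral_sub hii hie, integral_exp]
  simp
  ring

lemma psi_exp_bound (j : ℕ) : ∃ C : ℝ, 0 < C ∧ ∀ u : ℝ, 2 ≤ u →
    |Chebyshev.psi (exp u) - exp u| ≤ C * exp u / u ^ j := by
  obtain ⟨C, hC, hQ⟩ := Q_bound (2 * j)
  set D := C * exp 1 + C * 2 ^ (2 * j) with hD
  have hD0 : 0 < D := by positivity
  refine ⟨1 + 2 * D + j.factorial, by positivity, fun u hu => ?_⟩
  set η := 1 / u ^ j with hη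
  have huj : 1 ≤ u ^ j := one_le_pow₀ (by linarith)
  have huj0 : 0 < u ^ j := by linarith
  have hη0 : 0 < η := by positivity
  have hη1 : η ≤ 1 := by rw [hη, div_le_one huj0]; exact huj
  have hmono : Monotone (fun v : ℝ => Chebyshev.psi (exp v)) :=
    Chebyshev.psi_mono.comp Real.exp_monotone
  have hE := exp_pos u
  have hη2 : 1 / u ^ (2 * j) = η * η := by rw [hη, two_mul, pow_add]; field_simp
  -- bounds of Q near u
  have q0 : |Q u| ≤ D * exp u * (η * η) := by
    refine (hQ u (by linarith)).trans ?_
    rw [← hη2, div_eq_mul_one_div]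
    gcongr
    have : C * 1 ≤ C * exp 1 := by gcongr; exact Real.one_le_exp zero_le_one
    have : 0 < C * 2 ^ (2 * j) := by positivity
    linarith
  have q1 : |Q (u + η)| ≤ D * exp u * (η * η) := by
    refine (hQ (u + η) (by linarith)).trans ?_
    rw [← hη2, div_eq_mul_one_div]
    have h1 : C * exp (u + η) ≤ D * exp u := by
      calc C * exp (u + η) ≤ C * exp (u + 1) := by gcongr
        _ = C * exp 1 * exp u := by rw [Real.exp_add]; ring
        _ ≤ D * exp u := by
          gcongr
          have : 0 < C * 2 ^ (2 * j) := by positivity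
          linarith
    have h2 : 1 / (u + η) ^ (2 * j) ≤ 1 / u ^ (2 * j) := by gcongr; linarith
    gcongr
  have q2 : |Q (u - η)| ≤ D * exp u * (η * η) := by
    refine (hQ (u - η) (by linarith)).trans ?_
    rw [← hη2]
    have h2 : (u / 2) ^ (2 * j) ≤ (u - η) ^ (2 * j) := by gcongr; linarith
    calc C * exp (u - η) / (u - η) ^ (2 * j) ≤ C * exp u / (u / 2) ^ (2 * j) := by
          gcongr; linarith
      _ = C * 2 ^ (2 * j) * exp u * (1 / u ^ (2 * j)) := by rw [div_pow]; field_simp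
      _ ≤ _ := by
        gcongr
        have : 0 < C * exp 1 := by positivity
        linarith
  have up : Chebyshev.psi (exp u) * η ≤ exp u * η + (1 + 2 * D) * exp u * (η * η) := by
    obtain ⟨hii, he⟩ := Q_sub (a := u) (b := u + η) (by linarith) (by linarith)
    have h1 : ∫ v in u..(u + η), Chebyshev.psi (exp u) ≤ ∫ v in u..(u + η), Chebyshev.psi (exp v) :=
      intervalIntegral.integral_mono_on (by linarith) (by simp) hii (fun v hv => hmono hv.1)
    rw [intervalIntegral.integral_const, he, smul_eq_mul] at h1
    have h2 : exp η ≤ 1 + η + η ^ 2 := by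
      have := Real.abs_exp_sub_one_sub_id_le (x := η) (by rw [abs_of_pos hη0]; exact hη1)
      linarith [(abs_le.mp this).2]
    have h3 : exp (u + η) ≤ exp u * (1 + η + η ^ 2) := by
      rw [Real.exp_add]; gcongr
    have := (abs_le.mp q0).1
    have := (abs_le.mp q1).2
    nlinarith
  have lo : exp u * η - (1 + 2 * D) * exp u * (η * η) - η ≤ Chebyshev.psi (exp u) * η := by
    obtain ⟨hii, he⟩ := Q_sub (a := u - η) (b := u) (by linarith) (by linarith)
    have h1 : ∫ v in (u - η)..u, Chebyshev.psi (exp v) ≤ ∫ v in (u - η)..u, Chebyshev.psi (exp u) :=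
      intervalIntegral.integral_mono_on (by linarith) hii (by simp) (fun v hv => hmono hv.2)
    rw [intervalIntegral.integral_const, he, smul_eq_mul] at h1
    have h2 : exp (-η) ≤ 1 - η + η ^ 2 := by
      have := Real.abs_exp_sub_one_sub_id_le (x := -η) (by rw [abs_neg, abs_of_pos hη0]; exact hη1)
      linarith [(abs_le.mp this).2]
    have h3 : exp (u - η) ≤ exp u * (1 - η + η ^ 2) := by
      rw [sub_eq_add_neg, Real.exp_add]; gcongr
    have := (abs_le.mp q0).1
    have := (abs_le.mp q2).2
    nlinarith
  have hfac : 1 ≤ j.factorial * exp u * η := by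
    have := Real.pow_div_factorial_le_exp u (by linarith) j
    rw [div_le_iff₀ (by positivity)] at this
    rw [hη, mul_one_div, le_div_iff₀ huj0]; linarith
  rw [div_eq_mul_one_div, ← hη]
  have hf : (0:ℝ) ≤ j.factorial * exp u * η := by positivity
  rw [abs_le]
  constructor
  · have : (exp u * η - (1 + 2 * D) * exp u * (η * η) - η) / η ≤ Chebyshev.psi (exp u) := by
      rw [div_le_iff₀ hη0]; exact lo
    have e : (exp u * η - (1 + 2 * D) * exp u * (η * η) - η) / η =
      exp u - (1 + 2 * D) * exp u * η - 1 := by field_simp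
    rw [e] at this
    nlinarith
  · have : Chebyshev.psi (exp u) ≤ (exp u * η + (1 + 2 * D) * exp u * (η * η)) / η := by
      rw [le_div_iff₀ hη0]; exact up
    have e : (exp u * η + (1 + 2 * D) * exp u * (η * η)) / η =
      exp u + (1 + 2 * D) * exp u * η := by field_simp
    rw [e] at this
    nlinarith

end CipZ

namespace CipZ
open MeasureTheory

lemma log_pow_le_sqrt (k : ℕ) {x : ℝ} (hx : 1 ≤ x) :
    Real.log x ^ k ≤ 2 ^ k * k.factorial * √x := by
  have hl := Real.log_nonneg hx
  have := Real.pow_div_factorial_le_exp (Real.log x / 2) (by linarith) k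
  rw [div_le_iff₀ (by positivity), ← Real.log_sqrt (by linarith), Real.exp_log (by positivity),
    Real.log_sqrt (by linarith), div_pow, div_le_iff₀ (by positivity)] at this
  linarith

lemma log_two_pos : 0 < Real.log 2 := Real.log_pos (by norm_num)

lemma theta_bound (j : ℕ) : ∃ C : ℝ, 0 < C ∧ ∀ x : ℝ, 2 ≤ x →
    |Chebyshev.theta x - x| ≤ C * x / Real.log x ^ j := by
  obtain ⟨C, hC, hb⟩ := psi_exp_bound j
  refine ⟨C + 2 * (2 ^ (j + 1) * (j + 1).factorial) + (Real.log 4 + 1) * 2 ^ j, ?_, fun x hx => ?_⟩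
  · have := Real.log_nonneg (by norm_num : (1:ℝ) ≤ 4)
    positivity
  have hl4 := Real.log_nonneg (by norm_num : (1:ℝ) ≤ 4)
  have hl : 0 < Real.log x := Real.log_pos (by linarith)
  have hx0 : 0 < x := by linarith
  have hlj : 0 < Real.log x ^ j := by positivity
  have hA : 0 ≤ 2 * (2 ^ (j + 1) * ((j + 1).factorial : ℝ)) := by positivity
  have hB : 0 ≤ (Real.log 4 + 1) * 2 ^ j := by positivity
  rcases le_total 2 (Real.log x) with h | h
  · have h1 := hb (Real.log x) h
    rw [Real.exp_log hx0] at h1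
    have h2 := Chebyshev.abs_psi_sub_theta_le_sqrt_mul_log (x := x) (by linarith)
    have h3 := log_pow_le_sqrt (j + 1) (x := x) (by linarith)
    have h4 : 2 * √x * Real.log x ≤ 2 * (2 ^ (j + 1) * ((j + 1).factorial : ℝ)) * x / Real.log x ^ j := by
      rw [le_div_iff₀ hlj]
      have h5 : √x * √x = x := Real.mul_self_sqrt hx0.le
      calc 2 * √x * Real.log x * Real.log x ^ j = 2 * √x * Real.log x ^ (j + 1) := by ring
        _ ≤ 2 * √x * (2 ^ (j + 1) * ((j + 1).factorial : ℝ) * √x) := by gcongr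
        _ = 2 * (2 ^ (j + 1) * ((j + 1).factorial : ℝ)) * (√x * √x) := by ring
        _ = _ := by rw [h5]
    have h6 : 0 ≤ (Real.log 4 + 1) * 2 ^ j * x / Real.log x ^ j := by positivity
    have h7 := abs_sub_le (Chebyshev.theta x) (Chebyshev.psi x) x
    rw [abs_sub_comm (Chebyshev.theta x) (Chebyshev.psi x)] at h7
    rw [add_mul, add_mul, add_div, add_div]
    linarith
  · have h1 := Chebyshev.theta_le_log4_mul_x hx0.le
    have h2 := Chebyshev.theta_nonneg x
    have h3 : |Chebyshev.theta x - x| ≤ (Real.log 4 + 1) * x := by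
      rw [abs_le]; constructor <;> nlinarith
    refine h3.trans ?_
    rw [le_div_iff₀ hlj]
    have h4 : Real.log x ^ j ≤ 2 ^ j := by gcongr
    calc (Real.log 4 + 1) * x * Real.log x ^ j ≤ (Real.log 4 + 1) * x * 2 ^ j := by gcongr
      _ = (Real.log 4 + 1) * 2 ^ j * x := by ring
      _ ≤ _ := by gcongr; linarith

noncomputable def Ik (k : ℕ) (x : ℝ) : ℝ := ∫ t in (2:ℝ)..x, 1 / Real.log t ^ k

lemma cont_one_div_log (k : ℕ) : ContinuousOn (fun t : ℝ => 1 / Real.log t ^ k) (Set.Ioi 1) := by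
  intro t ht
  have ht' : (1:ℝ) < t := ht
  have : Real.log t ≠ 0 := (Real.log_pos ht').ne'
  have h0 : t ≠ 0 := by linarith
  refine ContinuousAt.continuousWithinAt ?_
  exact ContinuousAt.div continuousAt_const ((Real.continuousAt_log h0).pow k) (pow_ne_zero _ this)

lemma ii_one_div_log (k : ℕ) {a b : ℝ} (ha : 2 ≤ a) (hb : 2 ≤ b) :
    IntervalIntegrable (fun t : ℝ => 1 / Real.log t ^ k) volume a b := by
  refine ((cont_one_div_log k).mono ?_).intervalIntegrable
  intro t ht
  have := (Set.mem_uIcc.mp ht)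
  show 1 < t
  rcases this with h | h <;> linarith [h.1]

lemma Ik_bound (k : ℕ) : ∃ C : ℝ, 0 < C ∧ ∀ x : ℝ, 4 ≤ x → |Ik k x| ≤ C * x / Real.log x ^ k := by
  have hl2 := log_two_pos
  refine ⟨(2 ^ k * k.factorial) / Real.log 2 ^ k + 2 ^ k, by positivity, fun x hx => ?_⟩
  have hx0 : 0 < x := by linarith
  have hs2 : 2 ≤ √x := by
    rw [show (2:ℝ) = √4 by rw [show (4:ℝ) = 2 ^ 2 by norm_num]; simp]
    exact Real.sqrt_le_sqrt hx
  have hsx : √x ≤ x := by nlinarith [Real.mul_self_sqrt hx0.le]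
  have hl : 0 < Real.log x := Real.log_pos (by linarith)
  have hlk : 0 < Real.log x ^ k := by positivity
  have hsplit : Ik k x = (∫ t in (2:ℝ)..√x, 1 / Real.log t ^ k) + ∫ t in √x..x, 1 / Real.log t ^ k :=
    (intervalIntegral.integral_add_adjacent_intervals (ii_one_div_log k le_rfl hs2)
      (ii_one_div_log k hs2 (by linarith))).symm
  have b1 : ‖∫ t in (2:ℝ)..√x, 1 / Real.log t ^ k‖ ≤ (1 / Real.log 2 ^ k) * |√x - 2| := by
    refine intervalIntegral.norm_integral_le_of_norm_le_const fun t ht => ?_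
    rw [Set.uIoc_of_le hs2] at ht
    have h1 : Real.log 2 ≤ Real.log t := Real.log_le_log (by norm_num) ht.1.le
    have h3 : 0 < Real.log t := by linarith
    rw [Real.norm_eq_abs, abs_of_nonneg (by positivity)]
    gcongr
  have b2 : ‖∫ t in √x..x, 1 / Real.log t ^ k‖ ≤ (2 ^ k / Real.log x ^ k) * |x - √x| := by
    refine intervalIntegral.norm_integral_le_of_norm_le_const fun t ht => ?_
    rw [Set.uIoc_of_le hsx] at ht
    have h1 : Real.log √x ≤ Real.log t := Real.log_le_log (by linarith) ht.1.le
    rw [Real.log_sqrt hx0.le] at h1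
    have h3 : 0 < Real.log t := by linarith
    rw [Real.norm_eq_abs, abs_of_nonneg (by positivity), show 2 ^ k / Real.log x ^ k =
      1 / (Real.log x / 2) ^ k by rw [div_pow]; field_simp]
    gcongr
  rw [Real.norm_eq_abs] at b1 b2
  rw [abs_of_nonneg (by linarith : 0 ≤ √x - 2)] at b1
  rw [abs_of_nonneg (by linarith : 0 ≤ x - √x)] at b2
  have c1 : (1 / Real.log 2 ^ k) * (√x - 2) ≤ (2 ^ k * k.factorial) / Real.log 2 ^ k * x / Real.log x ^ k := by
    have h3 := log_pow_le_sqrt k (x := x) (by linarith)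
    rw [le_div_iff₀ hlk]
    have h5 : √x * √x = x := Real.mul_self_sqrt hx0.le
    calc 1 / Real.log 2 ^ k * (√x - 2) * Real.log x ^ k ≤ 1 / Real.log 2 ^ k * √x * (2 ^ k * k.factorial * √x) := by
          gcongr; linarith
      _ = (2 ^ k * k.factorial) / Real.log 2 ^ k * (√x * √x) := by ring
      _ = _ := by rw [h5]
  have c2 : (2 ^ k / Real.log x ^ k) * (x - √x) ≤ 2 ^ k * x / Real.log x ^ k := by
    rw [div_mul_eq_mul_div]
    gcongr; linarith
  rw [hsplit, add_mul, add_div]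
  exact (abs_add_le _ _).trans (by linarith)

lemma Ik_rec (k : ℕ) {x : ℝ} (hx : 2 ≤ x) :
    Ik k x = x / Real.log x ^ k - 2 / Real.log 2 ^ k + k * Ik (k + 1) x := by
  have h := intervalIntegral.integral_eq_sub_of_hasDerivAt (a := 2) (b := x)
    (f := fun t => t / Real.log t ^ k)
    (f' := fun t => 1 / Real.log t ^ k - k * (1 / Real.log t ^ (k + 1))) ?_ ?_
  · rw [intervalIntegral.integral_sub (ii_one_div_log k le_rfl hx)
      ((ii_one_div_log (k + 1) le_rfl hx).const_mul _), intervalIntegral.integral_const_mul] at h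
    unfold Ik
    linarith
  · intro t ht
    rw [Set.uIcc_of_le hx] at ht
    have ht0 : t ≠ 0 := by linarith [ht.1]
    have hl : Real.log t ≠ 0 := (Real.log_pos (by linarith [ht.1])).ne'
    have := (hasDerivAt_id t).div ((Real.hasDerivAt_log ht0).pow k) (pow_ne_zero k hl)
    refine this.congr_deriv ?_
    rcases k with _ | k
    · simp
    · simp only [id, Nat.add_sub_cancel, Pi.pow_apply]
      field_simp
      ring
  · exact (ii_one_div_log k le_rfl hx).sub ((ii_one_div_log (k + 1) le_rfl hx).const_mul _)

lemma I2_expand (n : ℕ) : ∃ c : ℝ, ∀ x : ℝ, 2 ≤ x →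
    Ik 2 x = ∑ i ∈ Finset.range n, (i + 1).factorial * (x / Real.log x ^ (i + 2)) +
      (n + 1).factorial * Ik (n + 2) x + c := by
  induction n with
  | zero => exact ⟨0, fun x _ => by simp⟩
  | succ n ih =>
    obtain ⟨c, hc⟩ := ih
    refine ⟨c - (n + 1).factorial * (2 / Real.log 2 ^ (n + 2)), fun x hx => ?_⟩
    rw [hc x hx, Ik_rec (n + 2) hx, Finset.sum_range_succ, Nat.factorial_succ (n + 1)]
    push_cast
    ring

/-- The prime number theorem with an asymptotic expansion. -/
lemma pi_expansion (n : ℕ) : ∃ C : ℝ, 0 < C ∧ ∀ x : ℝ, 4 ≤ x →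
    |(Nat.primeCounting ⌊x⌋₊ : ℝ) - ∑ i ∈ Finset.range (n + 1), i.factorial * (x / Real.log x ^ (i + 1))|
      ≤ C * x / Real.log x ^ (n + 2) := by
  obtain ⟨C1, hC1, h1⟩ := theta_bound (n + 1)
  obtain ⟨C2, hC2, h2⟩ := Ik_bound (n + 2)
  obtain ⟨C3, hC3, h3⟩ := Ik_bound (n + 3)
  obtain ⟨c, hc⟩ := I2_expand n
  refine ⟨C1 + C1 * (C3 / Real.log 2 + C2) + (n + 1).factorial * C2 + |c| * (2 ^ (n + 2) * (n + 2).factorial),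
    by have := log_two_pos; positivity, fun x hx => ?_⟩
  have hx2 : 2 ≤ x := by linarith
  have hx0 : 0 < x := by linarith
  have hl : 0 < Real.log x := Real.log_pos (by linarith)
  have hlk : 0 < Real.log x ^ (n + 2) := by positivity
  rw [Chebyshev.primeCounting_eq_theta_div_log_add_integral hx2]
  have hii : IntervalIntegrable (fun t => Chebyshev.theta t / (t * Real.log t ^ 2)) volume 2 x := by
    rw [intervalIntegrable_iff_integrableOn_Icc_of_le hx2]
    exact Chebyshev.integrableOn_theta_div_id_mul_log_sq x
  have hi2 := ii_one_div_log 2 le_rfl hx2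
  -- error integral
  have eI : |(∫ t in (2:ℝ)..x, Chebyshev.theta t / (t * Real.log t ^ 2)) - Ik 2 x| ≤ C1 * Ik (n + 3) x := by
    rw [Ik, Ik, ← intervalIntegral.integral_sub hii hi2, ← intervalIntegral.integral_const_mul,
      ← Real.norm_eq_abs]
    refine intervalIntegral.norm_integral_le_of_norm_le hx2 (Filter.Eventually.of_forall fun t ht => ?_)
      ((ii_one_div_log (n + 3) le_rfl hx2).const_mul _)
    have ht0 : 0 < t := by linarith [ht.1]
    have hlt : 0 < Real.log t := Real.log_pos (by linarith [ht.1])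
    have := h1 t ht.1.le
    have e : Chebyshev.theta t / (t * Real.log t ^ 2) - 1 / Real.log t ^ 2 =
      (Chebyshev.theta t - t) / (t * Real.log t ^ 2) := by field_simp
    rw [e, norm_div, Real.norm_eq_abs, Real.norm_eq_abs, abs_of_pos (by positivity : 0 < t * Real.log t ^ 2)]
    calc _ ≤ (C1 * t / Real.log t ^ (n + 1)) / (t * Real.log t ^ 2) := by gcongr
      _ = _ := by field_simp; ring
  have eI3 : C1 * Ik (n + 3) x ≤ C1 * (C3 / Real.log 2 + C2) * x / Real.log x ^ (n + 2) := by
    have h4 := (le_abs_self _).trans (h3 x hx)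
    have h5 : C3 * x / Real.log x ^ (n + 3) ≤ (C3 / Real.log 2 + C2) * x / Real.log x ^ (n + 2) := by
      have hl2 := log_two_pos
      have h6 : Real.log 2 ≤ Real.log x := Real.log_le_log (by norm_num) hx2
      calc C3 * x / Real.log x ^ (n + 3) = C3 / Real.log x * x / Real.log x ^ (n + 2) := by
            rw [pow_succ _ (n + 2)]; field_simp
        _ ≤ (C3 / Real.log 2 + C2) * x / Real.log x ^ (n + 2) := by
            have : C3 / Real.log x ≤ C3 / Real.log 2 := by gcongr
            gcongr
            linarith
    calc C1 * Ik (n + 3) x ≤ C1 * ((C3 / Real.log 2 + C2) * x / Real.log x ^ (n + 2)) := by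
          gcongr; exact h4.trans h5
      _ = _ := by ring
  have eT : |Chebyshev.theta x / Real.log x - x / Real.log x| ≤ C1 * x / Real.log x ^ (n + 2) := by
    rw [← sub_div, abs_div, abs_of_pos hl]
    calc _ ≤ (C1 * x / Real.log x ^ (n + 1)) / Real.log x := by gcongr; exact h1 x hx2
      _ = _ := by rw [pow_succ _ (n + 1)]; field_simp
  have eI2 : |((n + 1).factorial : ℝ) * Ik (n + 2) x| ≤ (n + 1).factorial * C2 * x / Real.log x ^ (n + 2) := by
    rw [abs_mul, abs_of_nonneg (by positivity)]
    calc _ ≤ ((n + 1).factorial : ℝ) * (C2 * x / Real.log x ^ (n + 2)) := by gcongr; exact h2 x hx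
      _ = _ := by ring
  have ec : |c| ≤ |c| * (2 ^ (n + 2) * (n + 2).factorial) * x / Real.log x ^ (n + 2) := by
    rw [le_div_iff₀ hlk, mul_assoc |c|]
    have h3 := log_pow_le_sqrt (n + 2) (x := x) (by linarith)
    have hsx : √x ≤ x := by
      rw [Real.sqrt_le_left (by linarith)]; nlinarith
    have : Real.log x ^ (n + 2) ≤ 2 ^ (n + 2) * (n + 2).factorial * x := h3.trans (by gcongr)
    gcongr
  have hsum : ∑ i ∈ Finset.range (n + 1), (i.factorial : ℝ) * (x / Real.log x ^ (i + 1)) =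
      x / Real.log x + (Ik 2 x - (n + 1).factorial * Ik (n + 2) x - c) := by
    rw [hc x hx2, Finset.sum_range_succ']
    simp only [Nat.factorial_zero, Nat.cast_one, zero_add, pow_one, one_mul]
    ring
  rw [hsum, add_mul, add_mul, add_mul, add_div, add_div, add_div]
  have habs : ∀ a b d e f : ℝ, |a + b + d + e| ≤ |a| + |b| + |d| + |e| := by
    intro a b d e _
    exact (abs_add_le _ _).trans (by gcongr; exact (abs_add_le _ _).trans (by gcongr; exact abs_add_le _ _))
  have := habs (Chebyshev.theta x / Real.log x - x / Real.log x)
    ((∫ t in (2:ℝ)..x, Chebyshev.theta t / (t * Real.log t ^ 2)) - Ik 2 x)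
    ((n + 1).factorial * Ik (n + 2) x) c 0
  refine le_trans (le_of_eq ?_) (this.trans (by linarith))
  congr 1; ring

end CipZ

namespace CipY
open Filter Topology Asymptotics

noncomputable def Lf (n : ℕ) : ℝ := Real.log n
noncomputable def yf (n : ℕ) : ℝ := Real.log (Lf n)
noncomputable def zf (n : ℕ) : ℝ := (Lf n)⁻¹
noncomputable def Tf (n : ℕ) : ℝ := yf n * zf n
noncomputable def ellf (n : ℕ) : ℝ := Real.log (nthPrime n)
noncomputable def vf (n : ℕ) : ℝ := (ellf n)⁻¹
noncomputable def sf (n : ℕ) : ℝ := n * ellf n / nthPrime n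
noncomputable def af (n : ℕ) : ℝ := nthPrime n / n / Lf n
noncomputable def lf (n : ℕ) : ℝ := Real.log (af n)
noncomputable def ef (n : ℕ) : ℝ := 1 + Tf n + zf n * lf n

lemma tend_L : Tendsto Lf atTop atTop := Real.tendsto_log_atTop.comp tendsto_natCast_atTop_atTop
lemma tend_y : Tendsto yf atTop atTop := Real.tendsto_log_atTop.comp tend_L
lemma tend_z : Tendsto zf atTop (𝓝 0) := tendsto_inv_atTop_zero.comp tend_L
lemma tend_log_div : Tendsto (fun x : ℝ => Real.log x * x⁻¹) atTop (𝓝 0) := by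
  have := Real.isLittleO_log_id_atTop.tendsto_div_nhds_zero
  simpa [div_eq_mul_inv] using this
lemma tend_T : Tendsto Tf atTop (𝓝 0) := tend_log_div.comp tend_L
lemma z_pos : ∀ᶠ n in atTop, 0 < zf n := by
  filter_upwards [tend_L.eventually_gt_atTop 0] with n hn
  exact inv_pos.mpr hn
lemma z_O_T : zf =O[atTop] Tf := by
  refine IsBigO.of_bound 1 ?_
  filter_upwards [tend_y.eventually_ge_atTop 1, z_pos] with n h1 h2
  rw [Real.norm_eq_abs, Real.norm_eq_abs, abs_of_pos h2, Tf, abs_of_pos (by positivity)]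
  nlinarith

lemma nthPrime_pc {n : ℕ} (hn : 1 ≤ n) : Nat.primeCounting (nthPrime n) = n := by
  have hp : (nthPrime n).Prime := Nat.prime_nth_prime _
  rw [Nat.primeCounting, Nat.primeCounting', Nat.count_succ, if_pos hp, nthPrime,
    Nat.count_nth_of_infinite Nat.infinite_setOfPred_prime]
  omega

lemma nthPrime_ge (n : ℕ) : n + 1 ≤ nthPrime n := by
  have := Nat.add_two_le_nth_prime (n - 1)
  unfold nthPrime; omega

lemma tend_p : Tendsto (fun n => (nthPrime n : ℝ)) atTop atTop := by
  refine tendsto_atTop_mono (fun n => ?_) tendsto_natCast_atTop_atTop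
  exact_mod_cast (Nat.le_succ n).trans (nthPrime_ge n)

lemma tend_ell : Tendsto ellf atTop atTop := Real.tendsto_log_atTop.comp tend_p
lemma tend_v : Tendsto vf atTop (𝓝 0) := tendsto_inv_atTop_zero.comp tend_ell

noncomputable def SP (M : ℕ) : ℚ[X] := ∑ j ∈ Finset.range M, C (j.factorial : ℚ) * X ^ j

lemma s_expand (M : ℕ) :
    (fun n => sf n - aeval (vf n) (SP (M + 1))) =O[atTop] (fun n => vf n ^ (M + 1)) := by
  obtain ⟨C, hC, h⟩ := CipZ.pi_expansion M
  refine IsBigO.of_bound C ?_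
  filter_upwards [tend_p.eventually_ge_atTop 4, tend_ell.eventually_gt_atTop 0,
    eventually_ge_atTop 1] with n h1 h2 h3
  have h4 := h _ h1
  rw [Nat.floor_natCast, nthPrime_pc h3] at h4
  have hp : (0:ℝ) < nthPrime n := by linarith
  change |(n:ℝ) - ∑ i ∈ Finset.range (M + 1), i.factorial * ((nthPrime n : ℝ) / ellf n ^ (i + 1))|
    ≤ C * (nthPrime n : ℝ) / ellf n ^ (M + 2) at h4
  have e1 : sf n - aeval (vf n) (SP (M + 1)) =
     ((n:ℝ) - ∑ i ∈ Finset.range (M + 1), i.factorial * ((nthPrime n : ℝ) / ellf n ^ (i + 1))) *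
      (ellf n / nthPrime n) := by
    rw [sub_mul, Finset.sum_mul, SP, map_sum]
    congr 1
    · unfold sf; ring
    · refine Finset.sum_congr rfl fun i _ => ?_
      simp only [map_mul, map_natCast, aeval_X, map_pow, vf, inv_pow]
      field_simp
      ring
  rw [e1, norm_mul, Real.norm_eq_abs, Real.norm_eq_abs, Real.norm_eq_abs, abs_of_pos (by positivity : 0 < ellf n / nthPrime n),
    abs_of_pos (by unfold vf; positivity : 0 < vf n ^ (M + 1))]
  calc _ ≤ C * (nthPrime n : ℝ) / ellf n ^ (M + 2) * (ellf n / nthPrime n) := by gcongr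
    _ = _ := by unfold vf; rw [inv_pow]; field_simp; ring

lemma tend_s : Tendsto sf atTop (𝓝 1) := by
  have h := (s_expand 0).trans_tendsto (by simpa using tend_v)
  simpa [SP, sub_eq_add_neg, add_assoc] using h.add_const 1

lemma tend_A : Tendsto (fun n => (nthPrime n : ℝ) / n) atTop atTop := by
  have h : Tendsto (fun n => ellf n * (sf n)⁻¹) atTop atTop := by
    refine tend_ell.atTop_mul_pos (C := 1⁻¹) (by norm_num) (tend_s.inv₀ (by norm_num))
  refine h.congr' ?_
  filter_upwards [tend_p.eventually_ge_atTop 4, tend_ell.eventually_gt_atTop 0,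
    eventually_ge_atTop 1] with n h1 h2 h3
  have : (0:ℝ) < n := by exact_mod_cast h3
  unfold sf
  field_simp

lemma tend_a : Tendsto af atTop (𝓝 1) := by
  have h1 := tend_s.sub (tend_log_div.comp tend_A)
  have h2 := h1.inv₀ (by norm_num)
  rw [sub_zero, inv_one] at h2
  refine h2.congr' ?_
  filter_upwards [tend_p.eventually_ge_atTop 4, tend_L.eventually_gt_atTop 0,
    eventually_ge_atTop 1] with n h1 h2 h3
  have : (0:ℝ) < n := by exact_mod_cast h3
  have hp : (0:ℝ) < nthPrime n := by linarith
  simp only [Function.comp]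
  rw [Real.log_div hp.ne' this.ne']
  unfold sf af ellf
  unfold Lf at h2 ⊢
  rw [inv_eq_iff_eq_inv]
  field_simp
  ring

lemma tend_l : Tendsto lf atTop (𝓝 0) := by
  have := ((Real.continuousAt_log (one_ne_zero)).tendsto).comp tend_a
  rw [Real.log_one] at this
  exact this

lemma tend_e : Tendsto ef atTop (𝓝 1) := by
  have := (tend_T.const_add 1).add (tend_z.mul tend_l)
  simp only [mul_zero, add_zero] at this
  exact this

lemma ell_eq : ∀ᶠ n in atTop, ellf n = Lf n * ef n := by
  filter_upwards [tend_p.eventually_ge_atTop 4, tend_L.eventually_gt_atTop 0,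
    eventually_ge_atTop 1, tend_a.eventually_const_lt (by norm_num : (0:ℝ) < 1)] with n h1 h2 h3 h4
  have hn : (0:ℝ) < n := by exact_mod_cast h3
  have hp : (nthPrime n : ℝ) = n * (Lf n * af n) := by unfold af; field_simp
  rw [ellf, hp, Real.log_mul hn.ne' (by positivity), Real.log_mul h2.ne' h4.ne']
  unfold ef Tf zf
  change Lf n + (yf n + lf n) = _
  field_simp
  ring

lemma v_eq : ∀ᶠ n in atTop, vf n = zf n * (ef n)⁻¹ := by
  filter_upwards [ell_eq] with n h
  rw [vf, h, mul_inv]; rfl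

lemma v_O_z : vf =O[atTop] zf := by
  have h1 : (fun n => zf n * (ef n)⁻¹) =O[atTop] (fun n => zf n * (1:ℝ)) :=
    (isBigO_refl zf atTop).mul ((tend_e.inv₀ (by norm_num)).isBigO_one ℝ)
  refine (h1.congr' ?_ ?_)
  · filter_upwards [v_eq] with n h using h.symm
  · simp

lemma aeval_O_one (f : ℕ → ℝ) (c : ℝ) (h : Tendsto f atTop (𝓝 c)) (P : ℚ[X]) :
    (fun n => aeval (f n) P) =O[atTop] (fun _ => (1:ℝ)) := by
  have : Tendsto (fun n => aeval (f n) P) atTop (𝓝 (aeval c P)) :=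
    (P.continuous_aeval.tendsto c).comp h
  exact this.isBigO_one ℝ

/-- key relation -/
lemma a_expand (M : ℕ) (V : ℚ[X]) (hV : X ^ (M + 1) ∣ SP (M + 1) * (1 - X * V) - 1) :
    (fun n => af n - (ef n - zf n * aeval (vf n) V)) =O[atTop] (fun n => zf n ^ (M + 1)) := by
  obtain ⟨D, hD⟩ := hV
  set U : ℚ[X] := 1 - X * V with hU
  -- s * U(v) - 1 = O(v^(M+1))
  have h1 : (fun n => sf n * aeval (vf n) U - 1) =O[atTop] (fun n => vf n ^ (M + 1)) := by
    have e1 : (fun n => sf n * aeval (vf n) U - 1) = fun n =>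
        (sf n - aeval (vf n) (SP (M + 1))) * aeval (vf n) U + vf n ^ (M + 1) * aeval (vf n) D := by
      funext n
      have := congrArg (aeval (vf n)) hD
      simp only [map_mul, map_sub, map_one, map_pow, aeval_X] at this
      rw [← this]; ring
    rw [e1]
    refine IsBigO.add ?_ ?_
    · simpa using (s_expand M).mul (aeval_O_one _ _ tend_v U)
    · simpa using (isBigO_refl (fun n => vf n ^ (M + 1)) atTop).mul (aeval_O_one _ _ tend_v D)
  have h2 : (fun n => -(ef n * (sf n)⁻¹) * (sf n * aeval (vf n) U - 1)) =O[atTop] (fun n => 1 * zf n ^ (M + 1)) := by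
    refine IsBigO.mul ?_ (h1.trans (v_O_z.pow _))
    exact ((tend_e.mul (tend_s.inv₀ (by norm_num))).neg).isBigO_one ℝ
  refine h2.congr' ?_ (by simp)
  filter_upwards [v_eq, ell_eq, tend_s.eventually_const_lt (by norm_num : (0:ℝ) < 1),
    tend_e.eventually_const_lt (by norm_num : (0:ℝ) < 1), tend_p.eventually_ge_atTop 4,
    tend_L.eventually_gt_atTop 0, eventually_ge_atTop 1] with n hv hl hs he hp hL hn
  have hn : (0:ℝ) < n := by exact_mod_cast hn
  have e2 : af n = ef n * (sf n)⁻¹ := by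
    unfold sf af; rw [hl]; field_simp
  have e3 : aeval (vf n) U = 1 - vf n * aeval (vf n) V := by simp [hU]
  have e4 : zf n = vf n * ef n := by rw [hv]; field_simp
  rw [e2, e3, e4]
  field_simp
  ring

lemma exists_V (M : ℕ) : ∃ V : ℚ[X], X ^ (M + 2) ∣ SP (M + 2) * (1 - X * (1 + X * V)) - 1 := by
  have hS : ∃ S2, SP (M + 2) = 1 + X + X ^ 2 * S2 := by
    refine ⟨∑ j ∈ Finset.range M, C ((j + 2).factorial : ℚ) * X ^ j, ?_⟩
    rw [SP, Finset.sum_range_succ', Finset.sum_range_succ', Finset.mul_sum]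
    simp only [Nat.factorial, pow_add]
    have : ∀ j ∈ Finset.range M, C (((j + 1 + 1) * ((j + 1) * j.factorial) : ℕ) : ℚ) * ((X : ℚ[X]) ^ j * X ^ 1 * X ^ 1)
      = X ^ 2 * (C (((j + 1 + 1) * ((j + 1) * j.factorial) : ℕ) : ℚ) * X ^ j) := fun j _ => by ring
    rw [Finset.sum_congr rfl this]
    simp
    ring
  obtain ⟨S2, hS2⟩ := hS
  set S := SP (M + 2)
  set U := ∑ i ∈ Finset.range (M + 2), (1 - S) ^ i with hU
  have h1 : S * U - 1 = -(1 - S) ^ (M + 2) := by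
    have := geom_sum_mul (1 - S) (M + 2)
    rw [← hU] at this
    linear_combination -this
  have h2 : X ∣ (1 - S) := ⟨-(1 + X * S2), by rw [hS2]; ring⟩
  have h3 : X ^ (M + 2) ∣ S * U - 1 := by
    rw [h1]; exact (pow_dvd_pow_of_dvd h2 _).neg_right
  obtain ⟨D, hD⟩ := h3
  have h4 : ∃ W, U = 1 - X + X ^ 2 * W := by
    refine ⟨U - (1 - X) * S2 * U + (1 - X) * X ^ M * D, ?_⟩
    rw [hS2] at hD
    linear_combination (1 - X) * hD
  obtain ⟨W, hW⟩ := h4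
  refine ⟨-W, D, ?_⟩
  rw [← hD, hW]; ring

end CipY

namespace CipY
open Filter Topology Asymptotics

/-- polynomials in `z` with coefficients in `ℚ[y]`, coefficient of `z^k` of degree at most `k` -/
noncomputable def W : Subalgebra ℚ (ℚ[X][X]) where
  carrier := {p | ∀ k, (p.coeff k).natDegree ≤ k}
  mul_mem' := by
    intro p q hp hq k
    rw [coeff_mul]
    refine natDegree_sum_le_of_forall_le _ _ fun x hx => ?_
    have h := Finset.HasAntidiagonal.mem_antidiagonal.mp hx
    exact natDegree_mul_le.trans (by have := hp x.1; have := hq x.2; omega)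
  add_mem' := by
    intro p q hp hq k
    rw [coeff_add]
    exact (natDegree_add_le _ _).trans (max_le (hp k) (hq k))
  algebraMap_mem' := by
    intro r k
    rw [Polynomial.algebraMap_apply, Polynomial.algebraMap_apply, coeff_C]
    split_ifs <;> simp

lemma W_deg (p : W) (k : ℕ) : ((p : ℚ[X][X]).coeff k).natDegree ≤ k := p.2 k

noncomputable def zeta : W := ⟨X, by
  intro k; rw [coeff_X]; split_ifs <;> simp⟩
noncomputable def tau : W := ⟨C X * X, by
  intro k; rw [coeff_C_mul, coeff_X]
  split_ifs with h
  · subst h; simp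
  · simp⟩

noncomputable def ev (n : ℕ) : W →ₐ[ℚ] ℝ :=
  (RingHom.toRatAlgHom
    (eval₂RingHom ((aeval (yf n) : ℚ[X] →ₐ[ℚ] ℝ) : ℚ[X] →+* ℝ) (zf n))).comp W.val

lemma ev_apply (n : ℕ) (p : W) : ev n p =
    (p : ℚ[X][X]).eval₂ ((aeval (yf n) : ℚ[X] →ₐ[ℚ] ℝ) : ℚ[X] →+* ℝ) (zf n) := rfl

lemma ev_zeta (n : ℕ) : ev n zeta = zf n := by
  rw [ev_apply]; simp [zeta]
lemma ev_tau (n : ℕ) : ev n tau = Tf n := by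
  rw [ev_apply]; simp [tau, Tf]

lemma T_pow_mono {i j : ℕ} (h : i ≤ j) : (fun n => Tf n ^ j) =O[atTop] (fun n => Tf n ^ i) := by
  obtain ⟨d, rfl⟩ := Nat.exists_eq_add_of_le h
  have h1 : (fun n => Tf n ^ i * Tf n ^ d) =O[atTop] (fun n => Tf n ^ i * 1) :=
    (isBigO_refl _ _).mul ((tend_T.pow d).isBigO_one ℝ)
  simpa [pow_add] using h1

lemma coeff_O {c : ℚ[X]} {k : ℕ} (h : c.natDegree ≤ k) :
    (fun n => aeval (yf n) c * zf n ^ k) =O[atTop] (fun n => Tf n ^ k) := by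
  have h1 : (fun x : ℝ => eval x (c.map (algebraMap ℚ ℝ))) =O[atTop] (fun x => eval x ((X : ℝ[X]) ^ k)) := by
    refine Polynomial.isBigO_atTop_of_degree_le _ _ ?_
    rw [degree_X_pow, degree_map]
    exact natDegree_le_iff_degree_le.mp h
  have h2 := (h1.comp_tendsto tend_y).mul (isBigO_refl (fun n => zf n ^ k) atTop)
  refine h2.congr (fun n => ?_) (fun n => ?_)
  · simp only [Function.comp, eval_map_algebraMap]
  · simp [Function.comp, Tf, mul_pow]

def Eqv (K : ℕ) (f g : ℕ → ℝ) : Prop := (fun n => f n - g n) =O[atTop] (fun n => Tf n ^ K)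
def Bd (f : ℕ → ℝ) : Prop := f =O[atTop] (fun _ => (1:ℝ))

namespace Eqv
variable {K J : ℕ} {f g h f' g' : ℕ → ℝ}
lemma refl (K : ℕ) (f : ℕ → ℝ) : Eqv K f f := by
  unfold Eqv; simp only [sub_self]; exact isBigO_zero _ _
lemma symm (h : Eqv K f g) : Eqv K g f := by
  have := h.neg_left
  unfold Eqv; simpa using this
lemma trans (h1 : Eqv K f g) (h2 : Eqv K g h) : Eqv K f h := by
  have := IsBigO.add h1 h2
  unfold Eqv; simpa using this
lemma add (h1 : Eqv K f g) (h2 : Eqv K f' g') : Eqv K (fun n => f n + f' n) (fun n => g n + g' n) :=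
  (IsBigO.add h1 h2).congr_left fun n => by ring
lemma sub (h1 : Eqv K f g) (h2 : Eqv K f' g') : Eqv K (fun n => f n - f' n) (fun n => g n - g' n) :=
  (IsBigO.sub h1 h2).congr_left fun n => by ring
lemma mono (hKJ : J ≤ K) (h1 : Eqv K f g) : Eqv J f g := IsBigO.trans h1 (T_pow_mono hKJ)
lemma of_eq (h : ∀ᶠ n in atTop, f n = g n) : Eqv K f g := by
  refine (isBigO_zero (E' := ℝ) (fun n => Tf n ^ K) atTop).congr' ?_ (EventuallyEq.refl _ _)
  filter_upwards [h] with n hn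
  rw [hn, sub_self]
lemma bd (h1 : Eqv K f g) (hg : Bd g) : Bd f := by
  have h2 : (fun n => Tf n ^ K) =O[atTop] (fun _ => (1:ℝ)) := (tend_T.pow K).isBigO_one ℝ
  have := (IsBigO.trans h1 h2).add hg
  unfold Bd; simpa using this
lemma mul (h1 : Eqv K f g) (h2 : Eqv K f' g') (hg : Bd g) (hg' : Bd g') :
    Eqv K (fun n => f n * f' n) (fun n => g n * g' n) := by
  have hf' : Bd f' := h2.bd hg'
  have a1 : (fun n => (f n - g n) * f' n) =O[atTop] (fun n => Tf n ^ K * 1) := IsBigO.mul h1 hf'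
  have a2 : (fun n => g n * (f' n - g' n)) =O[atTop] (fun n => 1 * Tf n ^ K) := IsBigO.mul hg h2
  have := (by simpa using a1 : (fun n => (f n - g n) * f' n) =O[atTop] (fun n => Tf n ^ K)).add
    (by simpa using a2 : (fun n => g n * (f' n - g' n)) =O[atTop] (fun n => Tf n ^ K))
  exact this.congr_left fun n => by ring
lemma z_mul (h1 : Eqv K f g) : Eqv (K + 1) (fun n => zf n * f n) (fun n => zf n * g n) := by
  have := z_O_T.mul h1
  exact this.congr (fun n => by ring) (fun n => by ring)
end Eqv

lemma Bd.of_tendsto {f : ℕ → ℝ} {c : ℝ} (h : Tendsto f atTop (𝓝 c)) : Bd f := h.isBigO_one ℝ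
lemma Bd.add {f g : ℕ → ℝ} (hf : Bd f) (hg : Bd g) : Bd (fun n => f n + g n) := IsBigO.add hf hg
lemma Bd.mul {f g : ℕ → ℝ} (hf : Bd f) (hg : Bd g) : Bd (fun n => f n * g n) := by
  have := IsBigO.mul hf hg
  unfold Bd; simpa using this
lemma Bd.const (c : ℝ) : Bd (fun _ => c) := Bd.of_tendsto tendsto_const_nhds
lemma Bd.aeval {f : ℕ → ℝ} (hf : Bd f) (F : ℚ[X]) : Bd (fun n => aeval (f n) F) := by
  induction F using Polynomial.induction_on' with
  | add p q hp hq => simpa using hp.add hq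
  | monomial i c =>
    simp only [aeval_monomial]
    refine (Bd.const _).mul ?_
    have := IsBigO.pow hf i
    unfold Bd; simpa using this

lemma Eqv.aeval {K : ℕ} {f g : ℕ → ℝ} (h : Eqv K f g) (hg : Bd g) (F : ℚ[X]) :
    Eqv K (fun n => aeval (f n) F) (fun n => aeval (g n) F) := by
  have key : ∀ i : ℕ, Eqv K (fun n => f n ^ i) (fun n => g n ^ i) ∧ Bd (fun n => g n ^ i) := by
    intro i
    induction i with
    | zero => simpa using ⟨Eqv.refl K _, Bd.const 1⟩
    | succ i ih =>
      simp only [pow_succ]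
      exact ⟨ih.1.mul h ih.2 hg, ih.2.mul hg⟩
  induction F using Polynomial.induction_on' with
  | add p q hp hq => simpa using hp.add hq
  | monomial i c =>
    simp only [aeval_monomial]
    exact (Eqv.refl K _).mul (key i).1 (Bd.const _) (key i).2

lemma ev_trunc (m : ℕ) (p : W) : Eqv m (fun n => ev n p)
    (fun n => ∑ k ∈ Finset.range m, aeval (yf n) ((p : ℚ[X][X]).coeff k) * zf n ^ k) := by
  have h1 : ∀ n, ev n p = ∑ k ∈ Finset.range (m + ((p : ℚ[X][X]).natDegree + 1)),
      aeval (yf n) ((p : ℚ[X][X]).coeff k) * zf n ^ k := by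
    intro n
    rw [ev_apply, eval₂_eq_sum_range' _ (by omega : (p : ℚ[X][X]).natDegree < m + ((p : ℚ[X][X]).natDegree + 1))]
    rfl
  unfold Eqv
  generalize (p : ℚ[X][X]).natDegree + 1 = D at h1
  simp only [h1, Finset.sum_range_add, add_sub_cancel_left]
  apply IsBigO.fun_sum
  intro i _
  exact (coeff_O (W_deg p (m + i))).trans (T_pow_mono (by omega))

lemma ev_bd (p : W) : Bd (fun n => ev n p) := by
  have h := ev_trunc 0 p
  unfold Eqv at h
  unfold Bd; simpa using h

lemma ev_aeval (n : ℕ) (p : W) (F : ℚ[X]) : ev n (aeval p F) = aeval (ev n p) F :=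
  (aeval_algHom_apply (ev n) p F).symm

noncomputable def PL (K : ℕ) : ℚ[X] := ∑ i ∈ Finset.range K, C ((-1) ^ i / (i + 1 : ℚ)) * X ^ (i + 1)
noncomputable def PG (K : ℕ) : ℚ[X] := ∑ i ∈ Finset.range K, (-X) ^ i

lemma Eqv.tendsto_zero {w : ℕ → ℝ} (hw : w =O[atTop] Tf) : Tendsto w atTop (𝓝 0) :=
  hw.trans_tendsto tend_T

lemma log_eqv (K : ℕ) {w : ℕ → ℝ} (hw : w =O[atTop] Tf) :
    Eqv K (fun n => Real.log (1 + w n)) (fun n => aeval (w n) (PL K)) := by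
  have h0 := Eqv.tendsto_zero hw
  refine IsBigO.trans (g := fun n => w n ^ (K + 1)) ?_ ((hw.pow (K + 1)).trans (T_pow_mono (by omega)))
  refine IsBigO.of_bound 2 ?_
  have h1 : ∀ᶠ n in atTop, |w n| < 1 / 2 := by
    have := h0.abs
    rw [abs_zero] at this
    exact this.eventually_lt_const (by norm_num)
  filter_upwards [h1] with n hn
  have h2 := Real.abs_log_sub_add_sum_range_le (x := -w n) (by rw [abs_neg]; linarith) K
  have e : aeval (w n) (PL K) = -∑ i ∈ Finset.range K, (-w n) ^ (i + 1) / (i + 1) := by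
    rw [PL, map_sum, ← Finset.sum_neg_distrib]
    refine Finset.sum_congr rfl fun i _ => ?_
    simp
    rw [neg_pow (w n), pow_succ (-1 : ℝ)]; ring
  rw [e, Real.norm_eq_abs, Real.norm_eq_abs, abs_pow, sub_neg_eq_add, add_comm]
  rw [sub_neg_eq_add, abs_neg] at h2
  refine h2.trans ?_
  rw [div_le_iff₀ (by linarith)]
  have : 0 ≤ |w n| ^ (K + 1) := by positivity
  nlinarith

lemma inv_eqv (K : ℕ) {w : ℕ → ℝ} (hw : w =O[atTop] Tf) :
    Eqv K (fun n => (1 + w n)⁻¹) (fun n => aeval (w n) (PG K)) := by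
  have h0 := Eqv.tendsto_zero hw
  have h1 : Tendsto (fun n => (1 + w n)⁻¹) atTop (𝓝 1) := by
    have := (h0.const_add 1).inv₀ (by norm_num)
    simpa using this
  have h2 : (fun n => (-w n) ^ K * (1 + w n)⁻¹) =O[atTop] (fun n => Tf n ^ K * 1) :=
    (hw.neg_left.pow K).mul (h1.isBigO_one ℝ)
  refine h2.congr' ?_ (by simp)
  filter_upwards [(h0.const_add 1).eventually_ne (by norm_num : (1:ℝ) + 0 ≠ 0)] with n hn
  have := geom_sum_mul (-w n) K
  simp only [PG, map_sum, map_pow, map_neg, aeval_X]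
  field_simp
  linear_combination -this

end CipY

namespace CipY
open Filter Topology Asymptotics

noncomputable def hf (n : ℕ) : ℝ := Lf n * (af n - 1 - Tf n)

lemma ev_sub (n : ℕ) (p q : W) : ev n (p - q) = ev n p - ev n q := map_sub (ev n) p q
lemma W_sub (p q : W) : p + q - p = q := add_sub_cancel_left p q

lemma h_eqv (M : ℕ) (V : ℚ[X]) (hV : X ^ (M + 1) ∣ SP (M + 1) * (1 - X * V) - 1) :
    Eqv M hf (fun n => lf n - aeval (vf n) V) := by
  have h1 := (isBigO_refl Lf atTop).mul (a_expand M V hV)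
  refine IsBigO.trans (h1.congr' ?_ ?_) (z_O_T.pow M)
  · filter_upwards [tend_L.eventually_gt_atTop 0] with n hn
    unfold hf ef zf
    field_simp
    ring
  · filter_upwards [tend_L.eventually_gt_atTop 0] with n hn
    simp only [zf, inv_pow]
    field_simp
    ring

lemma a_eq : ∀ᶠ n in atTop, af n = 1 + (Tf n + zf n * hf n) := by
  filter_upwards [tend_L.eventually_gt_atTop 0] with n hn
  unfold hf zf
  field_simp
  ring

lemma l_bd : Bd lf := Bd.of_tendsto tend_l

lemma h_bd : Bd hf := by
  have := h_eqv 0 0 (by simp [SP])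
  refine this.bd ?_
  simpa using l_bd

lemma T_add_O {f : ℕ → ℝ} (hf : Bd f) : (fun n => Tf n + zf n * f n) =O[atTop] Tf := by
  refine (isBigO_refl _ _).add ?_
  have := z_O_T.mul hf
  simpa using this

lemma wp_eqv {K : ℕ} {f : ℕ → ℝ} {p : W} (h : Eqv K f (fun n => ev n p)) :
    Eqv (K + 1) (fun n => Tf n + zf n * f n) (fun n => ev n (tau + zeta * p)) := by
  have := (Eqv.refl (K + 1) Tf).add h.z_mul
  simpa [ev_tau, ev_zeta] using this

lemma l_eq : ∀ᶠ n in atTop, lf n = Real.log (1 + (Tf n + zf n * hf n)) := by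
  filter_upwards [a_eq] with n hn
  rw [lf, hn]

lemma l_of_h {K : ℕ} {p : W} (h : Eqv K hf (fun n => ev n p)) :
    Eqv (K + 1) lf (fun n => ev n (aeval (tau + zeta * p) (PL (K + 1)))) := by
  refine (Eqv.of_eq l_eq).trans ((log_eqv (K + 1) (T_add_O h_bd)).trans ?_)
  simp only [ev_aeval]
  exact (wp_eqv h).aeval (ev_bd _) _

lemma einv_eqv {K : ℕ} {p : W} (h : Eqv K lf (fun n => ev n p)) :
    Eqv (K + 1) (fun n => (ef n)⁻¹) (fun n => ev n (aeval (tau + zeta * p) (PG (K + 1)))) := by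
  have h1 := inv_eqv (K + 1) (T_add_O l_bd)
  refine Eqv.trans ?_ (h1.trans ?_)
  · simp only [ef, ← add_assoc]; exact Eqv.refl _ _
  simp only [ev_aeval]
  exact (wp_eqv h).aeval (ev_bd _) _

lemma v_eqv {K : ℕ} {p : W} (h : Eqv K lf (fun n => ev n p)) :
    Eqv (K + 1) vf (fun n => ev n (zeta * aeval (tau + zeta * p) (PG (K + 1)))) := by
  refine (Eqv.of_eq v_eq).trans ?_
  have := (einv_eqv h).z_mul.mono (Nat.le_succ _)
  simpa [ev_zeta] using this

lemma V_eqv {K : ℕ} {p : W} (h : Eqv K lf (fun n => ev n p)) (F : ℚ[X]) :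
    ∃ q : W, Eqv (K + 1) (fun n => aeval (vf n) F) (fun n => ev n q) := by
  refine ⟨aeval (zeta * aeval (tau + zeta * p) (PG (K + 1))) F, ?_⟩
  have := (v_eqv h).aeval (ev_bd _) F
  simpa only [ev_aeval] using this

lemma h_of_l {K : ℕ} {p : W} (h : Eqv K lf (fun n => ev n p)) :
    ∃ q : W, Eqv K hf (fun n => ev n q) := by
  obtain ⟨V, hV⟩ := exists_V K
  have h1 := h_eqv (K + 1) _ hV
  obtain ⟨q, hq⟩ := V_eqv h (1 + X * V)
  refine ⟨p - q, (h1.mono (Nat.le_succ _)).trans ?_⟩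
  have := h.sub (hq.mono (Nat.le_succ _))
  simpa only [ev_sub] using this

lemma l_exp (K : ℕ) : ∃ p : W, Eqv K lf (fun n => ev n p) := by
  induction K with
  | zero =>
    refine ⟨0, ?_⟩
    have := l_bd
    unfold Bd at this
    unfold Eqv
    simpa only [map_zero, sub_zero, pow_zero] using this
  | succ K ih =>
    obtain ⟨p, hp⟩ := ih
    obtain ⟨q, hq⟩ := h_of_l hp
    exact ⟨_, l_of_h hq⟩

lemma B_exp (m : ℕ) : ∃ q : W, Eqv (m + 1) (fun n => hf n + 1)
    (fun n => ev n (aeval tau (PL (m + 1)) + zeta * q)) := by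
  obtain ⟨p, hp⟩ := l_exp m
  obtain ⟨r, hr⟩ := h_of_l hp
  have hl := l_of_h hr
  obtain ⟨V, hV⟩ := exists_V m
  have h1 := h_eqv (m + 1) _ hV
  obtain ⟨q1, hq1⟩ := V_eqv hp V
  have hd := sub_dvd_eval_sub (tau + zeta * r) tau ((PL (m + 1)).map (algebraMap ℚ W))
  rw [eval_map_algebraMap, eval_map_algebraMap, W_sub] at hd
  obtain ⟨d, hd⟩ := hd
  have he := einv_eqv hp
  set E := aeval (tau + zeta * p) (PG (m + 1)) with hE
  refine ⟨r * d - E * q1, ?_⟩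
  -- `v V(v)`
  have h2 : Eqv (m + 1) (fun n => zf n * ((ef n)⁻¹ * aeval (vf n) V)) (fun n => ev n (zeta * (E * q1))) := by
    have := (he.mul hq1 (ev_bd _) (ev_bd _)).z_mul.mono (Nat.le_succ _)
    simpa [ev_zeta] using this
  have h3 := (h1.trans (hl.sub ((Eqv.refl (m + 1) (fun n => aeval (vf n) (1 + X * V)))))).add
    (Eqv.refl (m + 1) (fun _ => (1:ℝ)))
  refine h3.trans ?_
  have h4 := (Eqv.refl (m + 1) (fun n => ev n (aeval (tau + zeta * r) (PL (m + 1))))).sub h2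
  refine Eqv.trans (Eqv.of_eq ?_) (h4.trans (Eqv.of_eq ?_))
  · filter_upwards [v_eq] with n hn
    rw [map_add, map_mul, map_one, aeval_X, hn]
    ring
  · filter_upwards with n
    rw [sub_eq_iff_eq_add] at hd
    rw [hd]
    simp only [map_add, ev_sub, map_mul]
    ring

lemma tau_pow_coeff (i k : ℕ) : ((tau ^ i : W) : ℚ[X][X]).coeff k = if k = i then X ^ i else 0 := by
  have : ((tau ^ i : W) : ℚ[X][X]) = C (X ^ i) * X ^ i := by
    rw [SubmonoidClass.coe_pow]; simp [tau, mul_pow]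
  rw [this, coeff_C_mul, coeff_X_pow]
  simp

lemma PL_coeff (m k : ℕ) (hk : k < m) :
    ((aeval tau (PL m) : W) : ℚ[X][X]).coeff (k + 1) = C ((-1) ^ k / (k + 1 : ℚ)) * X ^ (k + 1) := by
  have : ((aeval tau (PL m) : W) : ℚ[X][X]) =
      ∑ i ∈ Finset.range m, C (C ((-1) ^ i / (i + 1 : ℚ))) * ((tau ^ (i + 1) : W) : ℚ[X][X]) := by
    rw [PL, map_sum, AddSubmonoidClass.coe_finsetSum]
    refine Finset.sum_congr rfl fun i _ => ?_
    rw [map_mul, map_pow, aeval_X, aeval_C]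
    rfl
  rw [this, finsetSum_coeff]
  simp only [coeff_C_mul, tau_pow_coeff]
  rw [Finset.sum_eq_single k]
  · simp
  · intro b _ hb
    rw [if_neg (by omega), mul_zero]
  · intro h; exact absurd (Finset.mem_range.mpr hk) h

lemma PL_coeff_zero (m : ℕ) : ((aeval tau (PL m) : W) : ℚ[X][X]).coeff 0 = 0 := by
  have : (aeval tau (PL m) : W) = tau * aeval tau (∑ i ∈ Finset.range m, C ((-1) ^ i / (i + 1 : ℚ)) * X ^ i) := by
    rw [PL, map_sum, map_sum, Finset.mul_sum]
    refine Finset.sum_congr rfl fun i _ => ?_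
    simp only [map_mul, map_pow, aeval_X]; ring
  rw [this]
  show (((tau : W) : ℚ[X][X]) * _).coeff 0 = 0
  rw [mul_coeff_zero]
  simp [tau]

/-- reformulation of the Cipolla condition -/
lemma family_iff (m : ℕ) (R : ℕ → ℚ[X]) : IsCipollaFamily m R ↔
    (∀ k ∈ Finset.Icc 1 m, (R k).Monic ∧ (R k).natDegree = k) ∧
    Eqv (m + 1) (fun n => hf n + 1)
      (fun n => ∑ k ∈ Finset.Icc 1 m, (-1 : ℝ) ^ (k + 1) / k * aeval (yf n) (R k) * zf n ^ k) := by
  unfold IsCipollaFamily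
  refine and_congr_right fun _ => ?_
  have key : ∀ n : ℕ, 1 ≤ n → 0 < Lf n → (nthPrime n : ℝ) -
        (n : ℝ) * (Real.log n + Real.log (Real.log n) - 1 +
          ∑ k ∈ Finset.Icc 1 m, (-1 : ℝ) ^ (k + 1) *
            (Polynomial.aeval (Real.log (Real.log n)) (R k)) /
              ((k : ℝ) * Real.log n ^ k)) = n * ((hf n + 1) - ∑ k ∈ Finset.Icc 1 m, (-1 : ℝ) ^ (k + 1) / k * aeval (yf n) (R k) * zf n ^ k) := by
    intro n hn hL
    have hn' : (0:ℝ) < n := by exact_mod_cast hn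
    have e1 : ∑ k ∈ Finset.Icc 1 m, (-1 : ℝ) ^ (k + 1) *
            (Polynomial.aeval (Real.log (Real.log n)) (R k)) /
              ((k : ℝ) * Real.log n ^ k) = ∑ k ∈ Finset.Icc 1 m, (-1 : ℝ) ^ (k + 1) / k * aeval (yf n) (R k) * zf n ^ k := by
      refine Finset.sum_congr rfl fun k hk => ?_
      rw [zf, inv_pow, div_mul_eq_mul_div, ← div_eq_mul_inv, div_div]
      rfl
    rw [e1]
    change _ - (n:ℝ) * (Lf n + yf n - 1 + _) = _
    have e2 : (nthPrime n : ℝ) = n * (Lf n * af n) := by unfold af; field_simp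
    have e3 : yf n = Lf n * Tf n := by unfold Tf zf; field_simp
    rw [e2, e3]; unfold hf; ring
  have keyT : ∀ n : ℕ, Real.log (Real.log n) ^ (m + 1) / Real.log n ^ (m + 1) = Tf n ^ (m + 1) := by
    intro n; rw [Tf, mul_pow, zf, inv_pow, ← div_eq_mul_inv]; rfl
  have hTpos : ∀ᶠ n in atTop, 0 < Tf n := by
    filter_upwards [z_pos, tend_y.eventually_gt_atTop 0] with n h1 h2
    unfold Tf; positivity
  constructor
  · rintro ⟨C, hC, N, h⟩
    refine IsBigO.of_bound C ?_
    filter_upwards [eventually_ge_atTop N, eventually_ge_atTop 1, tend_L.eventually_gt_atTop 0,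
      hTpos] with n h1 h2 h3 h4
    have h5 := h n h1
    have hn' : (0:ℝ) < n := by exact_mod_cast h2
    rw [key n h2 h3, abs_mul, abs_of_pos hn', mul_div_assoc, keyT, mul_comm C, mul_assoc] at h5
    rw [Real.norm_eq_abs, Real.norm_eq_abs, abs_of_pos (by positivity : 0 < Tf n ^ (m + 1))]
    exact le_of_mul_le_mul_left h5 hn'
  · intro h
    obtain ⟨C, hC, h⟩ := IsBigO.exists_pos h
    rw [isBigOWith_iff] at h
    obtain ⟨N, hN⟩ := eventually_atTop.mp (h.and ((eventually_ge_atTop 1).and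
      ((tend_L.eventually_gt_atTop 0).and hTpos)))
    refine ⟨C, hC, N, fun n hn => ?_⟩
    obtain ⟨h1, h2, h3, h4⟩ := hN n hn
    have hn' : (0:ℝ) < n := by exact_mod_cast h2
    rw [key n h2 h3, abs_mul, abs_of_pos hn', mul_div_assoc, keyT, mul_comm C, mul_assoc]
    rw [Real.norm_eq_abs, Real.norm_eq_abs, abs_of_pos (by positivity : 0 < Tf n ^ (m + 1))] at h1
    gcongr

lemma exists_family (m : ℕ) : ∃ R, IsCipollaFamily m R := by
  obtain ⟨q, hq⟩ := B_exp m
  set b : W := aeval tau (PL (m + 1)) + zeta * q with hb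
  have hb0 : (b : ℚ[X][X]).coeff 0 = 0 := by
    show ((_ : ℚ[X][X]) + (zeta : ℚ[X][X]) * (q : ℚ[X][X])).coeff 0 = 0
    rw [coeff_add, PL_coeff_zero, mul_coeff_zero]
    simp [zeta]
  have hbk : ∀ k < m, (b : ℚ[X][X]).coeff (k + 1) =
      C ((-1) ^ k / (k + 1 : ℚ)) * X ^ (k + 1) + (q : ℚ[X][X]).coeff k := by
    intro k hk
    show ((_ : ℚ[X][X]) + (zeta : ℚ[X][X]) * (q : ℚ[X][X])).coeff (k + 1) = _
    rw [coeff_add, PL_coeff _ _ (by omega)]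
    congr 1
    show ((X : ℚ[X][X]) * _).coeff (k + 1) = _
    rw [coeff_X_mul]
  refine ⟨fun k => C ((-1) ^ (k + 1) * (k : ℚ)) * (b : ℚ[X][X]).coeff k, (family_iff _ _).mpr ⟨?_, ?_⟩⟩
  · intro k hk
    rw [Finset.mem_Icc] at hk
    obtain ⟨j, rfl⟩ : ∃ j, k = j + 1 := ⟨k - 1, by omega⟩
    have e : C ((-1) ^ (j + 1 + 1) * ((j + 1 : ℕ) : ℚ)) * (b : ℚ[X][X]).coeff (j + 1) =
        X ^ (j + 1) + C ((-1) ^ (j + 1 + 1) * ((j + 1 : ℕ) : ℚ)) * (q : ℚ[X][X]).coeff j := by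
      rw [hbk j (by omega), mul_add, ← mul_assoc, ← C_mul]
      have : (-1 : ℚ) ^ (j + 1 + 1) * ((j + 1 : ℕ) : ℚ) * ((-1) ^ j / (j + 1)) = 1 := by
        have h1 : (-1 : ℚ) ^ j * (-1) ^ j = 1 := by rw [← mul_pow]; simp
        push_cast
        field_simp
        rw [pow_succ, pow_succ]; linear_combination h1
      rw [this]; simp
    have hd : (C ((-1) ^ (j + 1 + 1) * ((j + 1 : ℕ) : ℚ)) * (q : ℚ[X][X]).coeff j).degree < ((j + 1 : ℕ) : WithBot ℕ) := by
      rw [degree_C_mul (mul_ne_zero (pow_ne_zero _ (by norm_num)) (by positivity))]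
      refine lt_of_le_of_lt (natDegree_le_iff_degree_le.mp (W_deg q j)) ?_
      exact_mod_cast Nat.lt_succ_self j
    show (C ((-1) ^ (j + 1 + 1) * ((j + 1 : ℕ) : ℚ)) * (b : ℚ[X][X]).coeff (j + 1)).Monic ∧
      (C ((-1) ^ (j + 1 + 1) * ((j + 1 : ℕ) : ℚ)) * (b : ℚ[X][X]).coeff (j + 1)).natDegree = j + 1
    rw [e]
    refine ⟨monic_X_pow_add hd, ?_⟩
    rw [natDegree_add_eq_left_of_degree_lt (by rwa [degree_X_pow]), natDegree_X_pow]
  · refine hq.trans ((ev_trunc (m + 1) b).trans (Eqv.of_eq (Eventually.of_forall fun n => ?_)))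
    rw [Finset.sum_range_succ', hb0]
    simp only [map_zero, zero_mul, add_zero]
    rw [Finset.range_eq_Ico, Finset.sum_Ico_add' (fun k => aeval (yf n) ((b : ℚ[X][X]).coeff k) * zf n ^ k) 0 m 1]
    refine Finset.sum_congr (by ext; simp [Finset.mem_Icc, Finset.mem_Ico]) fun k hk => ?_
    have hk0 : (k : ℝ) ≠ 0 := by
      rw [Finset.mem_Icc] at hk
      have : k ≠ 0 := by omega
      exact_mod_cast this
    simp only [map_mul, aeval_C]
    have h1 : (-1 : ℝ) ^ (k + 1) * (-1) ^ (k + 1) = 1 := by rw [← mul_pow]; simp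
    have : (-1 : ℝ) ^ (k + 1) / k * (algebraMap ℚ ℝ) ((-1) ^ (k + 1)) * (algebraMap ℚ ℝ) k = 1 := by
      simp only [map_pow, map_neg, map_one, map_natCast]
      field_simp
      linear_combination h1
    linear_combination (-(aeval (yf n) ((b : ℚ[X][X]).coeff k) * zf n ^ k)) * this

end CipY

namespace CipY
open Filter Topology Asymptotics

lemma restrict_succ {m : ℕ} {R : ℕ → ℚ[X]} (h : IsCipollaFamily (m + 1) R) : IsCipollaFamily m R := by
  rw [family_iff] at h ⊢
  obtain ⟨h1, h2⟩ := h
  refine ⟨fun k hk => h1 k (Finset.Icc_subset_Icc_right (Nat.le_succ m) hk), ?_⟩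
  refine (h2.mono (Nat.le_succ _)).trans ?_
  unfold Eqv
  simp only [Finset.sum_Icc_succ_top (by omega : 1 ≤ m + 1), add_sub_cancel_left]
  have hd := (h1 (m + 1) (by simp)).2
  have := (coeff_O hd.le).const_mul_left ((-1 : ℝ) ^ (m + 1 + 1) / ((m + 1 : ℕ) : ℝ))
  simpa only [mul_assoc] using this

lemma restrict {m j : ℕ} (hj : j ≤ m) {R : ℕ → ℚ[X]} (h : IsCipollaFamily m R) :
    IsCipollaFamily j R := by
  induction m, hj using Nat.le_induction with
  | base => exact h
  | succ m _ ih => exact ih (restrict_succ h)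

lemma poly_zero (D : ℚ[X]) (h : Tendsto (fun n => aeval (yf n) D) atTop (𝓝 0)) : D = 0 := by
  by_contra hD
  have h1 : (fun x : ℝ => eval x (1 : ℝ[X])) =O[atTop]
      (fun x : ℝ => eval x (D.map (algebraMap ℚ ℝ))) := by
    refine Polynomial.isBigO_atTop_of_degree_le _ _ ?_
    rw [degree_one, degree_map]
    exact zero_le_degree_iff.mpr hD
  have h2 := (h1.comp_tendsto tend_y).trans_tendsto
    (by simpa [Function.comp_def, eval_map_algebraMap] using h)
  have h3 : Tendsto (fun _ : ℕ => (1:ℝ)) atTop (𝓝 0) := by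
    simpa only [Function.comp_def, eval_one] using h2
  exact one_ne_zero (tendsto_nhds_unique tendsto_const_nhds h3)

lemma y_pow_z (k : ℕ) : Tendsto (fun n => yf n ^ k * zf n) atTop (𝓝 0) := by
  have h1 : Tendsto (fun x : ℝ => Real.log x ^ k * x⁻¹) atTop (𝓝 0) := by
    have := (isLittleO_pow_log_id_atTop (n := k)).tendsto_div_nhds_zero
    simpa [div_eq_mul_inv] using this
  exact h1.comp tend_L

lemma unique (m : ℕ) {R R' : ℕ → ℚ[X]} (h : IsCipollaFamily m R) (h' : IsCipollaFamily m R') :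
    ∀ k ∈ Finset.Icc 1 m, R' k = R k := by
  induction m with
  | zero => simp
  | succ m ih =>
    have ih := ih (restrict_succ h) (restrict_succ h')
    suffices hs : R' (m + 1) = R (m + 1) by
      intro k hk
      rw [Finset.mem_Icc] at hk
      rcases Nat.lt_or_ge m k with h1 | h1
      · rw [show k = m + 1 by omega, hs]
      · exact ih k (Finset.mem_Icc.mpr ⟨hk.1, h1⟩)
    rw [family_iff] at h h'
    have e := h'.2.symm.trans h.2
    rw [← sub_eq_zero]
    apply poly_zero
    have e1 : (fun n => aeval (yf n) (R' (m + 1) - R (m + 1))) =O[atTop] (fun n => yf n ^ (m + 2) * zf n) := by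
      have e2 := (e.const_mul_left ((-1 : ℝ) ^ (m + 2) * (m + 1 : ℕ))).mul
        (isBigO_refl (fun n => Lf n ^ (m + 1)) atTop)
      refine e2.congr' ?_ ?_
      · filter_upwards [tend_L.eventually_gt_atTop 0] with n hn
        have e3 : ∑ k ∈ Finset.Icc 1 m, (-1 : ℝ) ^ (k + 1) / k * aeval (yf n) (R' k) * zf n ^ k =
            ∑ k ∈ Finset.Icc 1 m, (-1 : ℝ) ^ (k + 1) / k * aeval (yf n) (R k) * zf n ^ k :=
          Finset.sum_congr rfl fun k hk => by rw [ih k hk]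
        have e4 : zf n ^ (m + 1) * Lf n ^ (m + 1) = 1 := by
          rw [← mul_pow, zf, inv_mul_cancel₀ hn.ne', one_pow]
        have e5 : (-1 : ℝ) ^ (m + 2) * (-1) ^ (m + 2) = 1 := by rw [← mul_pow]; simp
        have e6 : ((m + 1 : ℕ) : ℝ) * ((m + 1 : ℕ) : ℝ)⁻¹ = 1 := mul_inv_cancel₀ (by positivity)
        rw [Finset.sum_Icc_succ_top (by omega : 1 ≤ m + 1), Finset.sum_Icc_succ_top (by omega : 1 ≤ m + 1),
          e3, map_sub]
        rw [add_sub_add_left_eq_sub, div_eq_mul_inv]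
        generalize aeval (yf n) (R' (m + 1)) = α
        generalize aeval (yf n) (R (m + 1)) = β
        generalize ((m + 1 : ℕ) : ℝ) = q at *
        generalize q⁻¹ = qi at *
        generalize zf n ^ (m + 1) = zz at *
        generalize Lf n ^ (m + 1) = LL at *
        rw [show m + 1 + 1 = m + 2 by rfl]
        generalize (-1 : ℝ) ^ (m + 2) = s at *
        linear_combination (α - β) * (s * s * q * qi) * e4 + (α - β) * (s * s) * e6 + (α - β) * e5
      · filter_upwards [tend_L.eventually_gt_atTop 0] with n hn
        simp only [Tf, mul_pow, zf, inv_pow]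
        field_simp
        ring
    exact e1.trans_tendsto (y_pow_z _)

lemma bd_cont (F : ℝ × ℝ → ℝ) (hF : Continuous F) : Bd (fun n => F (Tf n, zf n)) :=
  Bd.of_tendsto ((hF.tendsto (0, 0)).comp (tend_T.prodMk_nhds tend_z))

lemma mono_O (i j K : ℕ) (h : K ≤ i + j) (F : ℝ × ℝ → ℝ) (hF : Continuous F) :
    (fun n => Tf n ^ i * zf n ^ j * F (Tf n, zf n)) =O[atTop] (fun n => Tf n ^ K) := by
  have h1 := (((isBigO_refl (fun n => Tf n ^ i) atTop).mul (z_O_T.pow j))).mul (bd_cont F hF)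
  refine IsBigO.trans (h1.congr_right (g₂ := fun n => Tf n ^ (i + j)) fun n => by ring) (T_pow_mono h)

lemma T_bd : Bd Tf := Bd.of_tendsto tend_T
lemma z_bd : Bd zf := Bd.of_tendsto tend_z

lemma l_eqv_log (K : ℕ) : Eqv K lf (fun n => aeval (Tf n + zf n * hf n) (PL K)) :=
  (Eqv.of_eq l_eq).trans (log_eqv K (T_add_O h_bd))

noncomputable def V4 : ℚ[X] := 1 + X + C 3 * X ^ 2

lemma h_eqv3 : Eqv 3 hf (fun n => lf n - aeval (vf n) V4) := by
  refine h_eqv 3 V4 ⟨-(C 11 + C 12 * X + C 18 * X ^ 2), ?_⟩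
  simp only [SP, V4, Finset.sum_range_succ, Finset.sum_range_zero, Nat.factorial]
  simp only [show (C (3:ℚ) : ℚ[X]) = 3 from rfl, show (C (11:ℚ) : ℚ[X]) = 11 from rfl,
    show (C (12:ℚ) : ℚ[X]) = 12 from rfl, show (C (18:ℚ) : ℚ[X]) = 18 from rfl, C_eq_natCast]
  push_cast
  ring

lemma l_eqv1 : Eqv 1 lf (fun _ => 0) := by
  refine (l_eqv_log 1).trans ?_
  unfold Eqv
  simpa [PL] using T_add_O h_bd

lemma v_eqv1 : Eqv 1 vf (fun _ => 0) := by
  unfold Eqv; simpa using v_O_z.trans z_O_T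

lemma v_eqv3 : Eqv 3 vf (fun n => zf n * (1 - Tf n)) := by
  refine (Eqv.of_eq v_eq).trans (Eqv.z_mul (K := 2) ?_)
  have h1 := inv_eqv 2 (T_add_O l_bd)
  have h2 : Eqv 2 (fun n => 1 - (Tf n + zf n * lf n)) (fun n => 1 - (Tf n + zf n * 0)) :=
    (Eqv.refl 2 _).sub ((Eqv.refl 2 _).add l_eqv1.z_mul)
  refine Eqv.trans (Eqv.of_eq (Eventually.of_forall fun n => ?_))
    (h1.trans (Eqv.trans (Eqv.of_eq (Eventually.of_forall fun n => ?_))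
      (h2.trans (Eqv.of_eq (Eventually.of_forall fun n => ?_)))))
  · simp only [ef, add_assoc]
  · simp [PG, Finset.sum_range_succ]; ring
  · simp

lemma h_eqv1 : Eqv 1 hf (fun _ => -1) := by
  refine (h_eqv3.mono (by norm_num)).trans ?_
  have := l_eqv1.sub (v_eqv1.aeval (Bd.const 0) V4)
  simpa [V4] using this

lemma l_eqv2 : Eqv 2 lf (fun n => Tf n - zf n) := by
  refine (l_eqv_log 2).trans ?_
  have h1 : Eqv 2 (fun n => Tf n + zf n * hf n) (fun n => Tf n + zf n * (-1)) :=
    (Eqv.refl 2 _).add h_eqv1.z_mul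
  have h2 : Eqv 2 (fun n => (-1 / 2) * (Tf n + zf n * hf n) ^ 2) (fun _ => 0) := by
    unfold Eqv
    simpa only [sub_zero] using ((T_add_O h_bd).pow 2).const_mul_left (-1 / 2)
  refine Eqv.trans (Eqv.of_eq (Eventually.of_forall fun n => ?_))
    ((h1.add h2).trans (Eqv.of_eq (Eventually.of_forall fun n => ?_)))
  · simp only [PL, Finset.sum_range_succ, Finset.sum_range_zero, map_add, map_mul, map_pow, aeval_X,
      aeval_C, map_zero, map_div₀, map_neg, map_one, map_natCast]
    push_cast
    ring
  · ring

lemma h_eqv2 : Eqv 2 hf (fun n => Tf n - 2 * zf n - 1) := by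
  refine (h_eqv3.mono (by norm_num)).trans ?_
  have h1 : Eqv 2 (fun n => aeval (vf n) V4) (fun n => 1 + zf n) := by
    have a1 : Eqv 2 vf zf := by
      refine (v_eqv3.mono (by norm_num)).trans ?_
      refine (mono_O 1 1 2 le_rfl (fun _ => -1) continuous_const).congr_left fun n => ?_
      ring
    have a2 : Eqv 2 (fun n => 3 * vf n ^ 2) (fun _ => 0) := by
      unfold Eqv
      simpa only [sub_zero] using ((v_O_z.trans z_O_T).pow 2).const_mul_left 3
    have := ((Eqv.refl 2 (fun _ => 1)).add a1).add a2
    simpa [V4] using this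
  refine (l_eqv2.sub h1).trans (Eqv.of_eq (Eventually.of_forall fun n => ?_))
  ring

lemma B_eqv3 : Eqv 3 (fun n => hf n + 1)
    (fun n => Tf n - 2 * zf n - (Tf n ^ 2 - 6 * Tf n * zf n + 11 * zf n ^ 2) / 2) := by
  have hg : Bd (fun n => Tf n + zf n * (Tf n - 2 * zf n - 1)) :=
    bd_cont (fun x => x.1 + x.2 * (x.1 - 2 * x.2 - 1)) (by fun_prop)
  have hv : Bd (fun n => zf n * (1 - Tf n)) := bd_cont (fun x => x.2 * (1 - x.1)) (by fun_prop)
  have h1 : Eqv 3 (fun n => Tf n + zf n * hf n) (fun n => Tf n + zf n * (Tf n - 2 * zf n - 1)) :=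
    (Eqv.refl 3 _).add h_eqv2.z_mul
  have h2 := (l_eqv_log 3).trans (h1.aeval hg _)
  have h3 := (h_eqv3.trans (h2.sub (v_eqv3.aeval hv V4))).add (Eqv.refl 3 (fun _ => (1:ℝ)))
  refine h3.trans ?_
  have o := (((mono_O 3 0 3 le_rfl (fun x => 1 / 3 + x.2 + x.2 ^ 2 + 1 / 3 * x.2 ^ 3) (by fun_prop)).add
    (mono_O 2 1 3 le_rfl (fun x => -2 - 15 / 2 * x.2 - 5 * x.2 ^ 2 - 2 * x.2 ^ 3) (by fun_prop))).add
    (mono_O 1 2 3 le_rfl (fun x => 10 + 7 * x.2 + 8 * x.2 ^ 2 + 4 * x.2 ^ 3) (by fun_prop))).add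
    (mono_O 0 3 3 le_rfl (fun x => -7 / 3 - 4 * x.2 - 4 * x.2 ^ 2 - 8 / 3 * x.2 ^ 3) (by fun_prop))
  refine o.congr_left fun n => ?_
  simp [PL, V4, Finset.sum_range_succ]
  ring

noncomputable def E2 (k : ℕ) : ℚ[X] := if k = 1 then X - C 2 else X ^ 2 - C 6 * X + C 11

lemma E2_family : IsCipollaFamily 2 E2 := by
  rw [family_iff]
  constructor
  · intro k hk
    rw [Finset.mem_Icc] at hk
    obtain rfl | rfl : k = 1 ∨ k = 2 := by omega
    · simp only [E2, if_true]
      exact ⟨monic_X_sub_C 2, natDegree_X_sub_C 2⟩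
    · simp only [E2, if_neg (by norm_num : ¬ (2 = 1))]
      have : (X ^ 2 - C 6 * X + C 11 : ℚ[X]) = X ^ 2 + (C (-6) * X + C 11) := by
        rw [C_neg]; ring
      rw [this]
      have hd : (C (-6 : ℚ) * X + C 11).degree < ((2 : ℕ) : WithBot ℕ) :=
        lt_of_le_of_lt degree_linear_le (by norm_num)
      refine ⟨monic_X_pow_add hd, ?_⟩
      rw [natDegree_add_eq_left_of_degree_lt (by rwa [degree_X_pow]), natDegree_X_pow]
  · refine B_eqv3.trans (Eqv.of_eq (Eventually.of_forall fun n => ?_))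
    have : Finset.Icc 1 2 = {1, 2} := by decide
    rw [this, Finset.sum_pair (by norm_num)]
    simp [E2, Tf]
    ring

end CipY

theorem cipolla_asymptotic (m : ℕ) (hm : 1 ≤ m) :
    ∃ R : ℕ → Polynomial ℚ, IsCipollaFamily m R ∧
      (∀ R' : ℕ → Polynomial ℚ, IsCipollaFamily m R' →
        ∀ k ∈ Finset.Icc 1 m, R' k = R k) ∧
      R 1 = X - C 2 ∧ (2 ≤ m → R 2 = X ^ 2 - C 6 * X + C 11) := by
  obtain ⟨R, hR⟩ := CipY.exists_family m
  refine ⟨R, hR, fun R' hR' => CipY.unique m hR hR', ?_, fun h2 => ?_⟩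
  · have := CipY.unique 1 (CipY.restrict (by norm_num) CipY.E2_family) (CipY.restrict hm hR) 1 (by simp)
    simpa [CipY.E2] using this
  · have := CipY.unique 2 CipY.E2_family (CipY.restrict h2 hR) 2 (by simp)
    simpa [CipY.E2] using this
end

section
/- For every integer n ≥ 1 one has 927·p_n²·log p_n + 5620·p_n² > 756·n·p_n·log² p_n + 117·n²·log³ p_n. -/
namespace NPL
open Finset Real
open ArithmeticFunction hiding log id
open scoped Nat

/-- weighted sum over a list of pairs (index, weight) -/
def wsum (l : List (ℕ × ℕ)) (F : ℕ → ℕ) : ℕ := (l.map (fun p => p.2 * F p.1)).sum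

/-- real version of the weighted sum -/
noncomputable def wsumR (l : List (ℕ × ℕ)) (F : ℕ → ℝ) : ℝ :=
  (l.map (fun p => (p.2 : ℝ) * F p.1)).sum

/-- positive coefficients, scaled by 972400 -/
def posL : List (ℕ × ℕ) := [(1, 972400), (6, 972400), (10, 972400), (14, 486200), (15, 486200),
  (21, 486200), (22, 486200), (28, 486200), (33, 486200), (35, 962875)]

/-- negative coefficients, scaled by 972400 -/
def negL : List (ℕ × ℕ) := [(2, 972400), (3, 972400), (5, 972400), (7, 972400), (11, 972400),
  (13, 486200), (17, 972400), (20, 486200), (24, 486200), (30, 972400)]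

/-- majorant jumps, scaled by 972400 -/
def hL : List (ℕ × ℕ) := [(15, 486200), (22, 486200), (35, 19448), (100, 525096), (275, 525096),
  (520, 194480), (3000, 4570280)]

/-- the pointwise test -/
def chk (j : ℕ) : Bool :=
  Nat.ble (972400 + wsum negL (fun d => j / d))
    (wsum posL (fun d => j / d) + wsum hL (fun k => bif Nat.ble k j then 1 else 0))

/-- test all values `1 ≤ j ≤ n` -/
def allBelow : ℕ → Bool
  | 0 => true
  | n + 1 => chk (n + 1) && allBelow n

lemma allBelow_spec (n : ℕ) (h : allBelow n = true) (j : ℕ) (h1 : 1 ≤ j) (h2 : j ≤ n) :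
    chk j = true := by
  induction n with
  | zero => omega
  | succ n ih =>
    simp only [allBelow, Bool.and_eq_true] at h
    rcases Nat.lt_or_ge n j with h3 | h3
    · have : j = n + 1 := by omega
      rw [this]; exact h.1
    · exact ih h.2 h3

lemma allBelow_3000 : allBelow 3000 = true := by decide +kernel

lemma pointwise (j : ℕ) (hj : 1 ≤ j) :
    972400 + wsum negL (fun d => j / d) ≤
    wsum posL (fun d => j / d) + wsum hL (fun k => if k ≤ j then 1 else 0) := by
  rcases Nat.lt_or_ge 3000 j with h | h
  · have e : ∀ k, k ≤ 3000 → (if k ≤ j then 1 else 0) = 1 := fun k hk => if_pos (by omega)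
    simp only [wsum, negL, posL, hL, List.map_cons, List.map_nil, List.sum_cons, List.sum_nil]
    rw [e 15 (by norm_num), e 22 (by norm_num), e 35 (by norm_num), e 100 (by norm_num),
      e 275 (by norm_num), e 520 (by norm_num), e 3000 (by norm_num)]
    have lo : ∀ d : ℕ, d * (j / d) ≤ j := fun d => Nat.mul_div_le j d
    have hi : ∀ d : ℕ, 0 < d → j + 1 ≤ d * (j / d) + d := fun d hd => by
      have := Nat.lt_mul_div_succ j hd
      rw [mul_add, mul_one] at this
      exact this
    have := lo 2; have := lo 3; have := lo 5; have := lo 7; have := lo 11; have := lo 13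
    have := lo 17; have := lo 20; have := lo 24; have := lo 30
    have := hi 6 (by norm_num); have := hi 10 (by norm_num); have := hi 14 (by norm_num)
    have := hi 15 (by norm_num); have := hi 21 (by norm_num); have := hi 22 (by norm_num)
    have := hi 28 (by norm_num); have := hi 33 (by norm_num); have := hi 35 (by norm_num)
    have := Nat.div_one j
    zify at *
    linarith
  · have := allBelow_spec 3000 allBelow_3000 j hj h
    rw [chk, Nat.ble_eq] at this
    refine this.trans (le_of_eq ?_)
    congr 2
    funext k
    by_cases hk : k ≤ j
    · have h1 : k.ble j = true := by rw [Nat.ble_eq]; exact hk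
      simp [h1, hk]
    · have h1 : k.ble j = false := by
        rw [Bool.eq_false_iff, Ne, Nat.ble_eq]; exact hk
      simp [h1, hk]

lemma log_fact (n : ℕ) : Real.log (n ! : ℝ) = ∑ m ∈ Ioc 0 n, Λ m * ((n / m : ℕ) : ℝ) := by
  rw [← sum_Ioc_mul_zeta_eq_sum, vonMangoldt_mul_zeta]
  induction n with
  | zero => simp
  | succ n ih =>
    rw [Finset.sum_Ioc_succ_top (by omega), ← ih, Nat.factorial_succ]
    push_cast
    rw [Real.log_mul (by positivity) (by positivity), add_comm]
    simp

lemma T_div (n d : ℕ) (hd : 0 < d) :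
    Real.log ((n / d)! : ℝ) = ∑ m ∈ Ioc 0 n, Λ m * ((n / m / d : ℕ) : ℝ) := by
  rw [log_fact]
  have hsub : Ioc 0 (n / d) ⊆ Ioc 0 n := Ioc_subset_Ioc_right (Nat.div_le_self n d)
  rw [← Finset.sum_subset hsub]
  · refine Finset.sum_congr rfl fun m hm => ?_
    rw [Nat.div_div_eq_div_mul, Nat.div_div_eq_div_mul, mul_comm d m]
  · intro m hm hm'
    simp only [mem_Ioc, not_and, not_le] at hm hm'
    have h := hm' hm.1
    have : n / m / d = 0 := by
      rw [Nat.div_div_eq_div_mul, mul_comm, ← Nat.div_div_eq_div_mul]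
      exact Nat.div_eq_of_lt h
    simp [this]

lemma psi_nat (n : ℕ) : Chebyshev.psi (n : ℝ) = ∑ m ∈ Ioc 0 n, Λ m := by
  simp [Chebyshev.psi]

lemma psi_div (n k : ℕ) (hk : 0 < k) :
    Chebyshev.psi ((n / k : ℕ) : ℝ) =
      ∑ m ∈ Ioc 0 n, Λ m * (((if k ≤ n / m then 1 else 0 : ℕ)) : ℝ) := by
  rw [psi_nat]
  have hsub : Ioc 0 (n / k) ⊆ Ioc 0 n := Ioc_subset_Ioc_right (Nat.div_le_self n k)
  have key : ∀ m, 0 < m → (k ≤ n / m ↔ m ≤ n / k) := fun m hm => by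
    rw [Nat.le_div_iff_mul_le hm, Nat.le_div_iff_mul_le hk, mul_comm]
  rw [← Finset.sum_subset hsub]
  · refine Finset.sum_congr rfl fun m hm => ?_
    rw [mem_Ioc] at hm
    rw [if_pos ((key m hm.1).2 hm.2)]; simp
  · intro m hm hm'
    simp only [mem_Ioc, not_and, not_le] at hm hm'
    have h := hm' hm.1
    rw [if_neg (by rw [key m hm.1]; omega)]; simp

lemma wsum_swap (l : List (ℕ × ℕ)) (s : Finset ℕ) (w : ℕ → ℝ) (F : ℕ → ℕ → ℕ) :
    ∑ m ∈ s, w m * ((wsum l (F m) : ℕ) : ℝ) =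
      wsumR l (fun d => ∑ m ∈ s, w m * ((F m d : ℕ) : ℝ)) := by
  induction l with
  | nil => simp [wsum, wsumR]
  | cons p l ih =>
    have h1 : ∀ m, wsum (p :: l) (F m) = p.2 * F m p.1 + wsum l (F m) := fun m => by simp [wsum]
    have h2 : ∀ G : ℕ → ℝ, wsumR (p :: l) G = p.2 * G p.1 + wsumR l G := fun m => by simp [wsumR]
    rw [h2, ← ih, Finset.mul_sum, ← Finset.sum_add_distrib]
    refine Finset.sum_congr rfl fun m _ => ?_
    rw [h1]; push_cast; ring

lemma wsumR_congr (l : List (ℕ × ℕ)) (F G : ℕ → ℝ) (h : ∀ p ∈ l, F p.1 = G p.1) :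
    wsumR l F = wsumR l G := by
  unfold wsumR
  congr 1
  refine List.map_congr_left fun p hp => ?_
  rw [h p hp]

lemma main_ineq (n : ℕ) :
    972400 * Chebyshev.psi (n : ℝ) + wsumR negL (fun d => Real.log ((n / d)! : ℝ)) ≤
      wsumR posL (fun d => Real.log ((n / d)! : ℝ)) +
        wsumR hL (fun k => Chebyshev.psi ((n / k : ℕ) : ℝ)) := by
  have e1 : wsumR negL (fun d => Real.log ((n / d)! : ℝ)) =
      ∑ m ∈ Ioc 0 n, Λ m * ((wsum negL (fun d => n / m / d) : ℕ) : ℝ) := by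
    rw [wsum_swap]
    refine wsumR_congr _ _ _ fun p hp => T_div n p.1 ?_
    revert p; decide
  have e2 : wsumR posL (fun d => Real.log ((n / d)! : ℝ)) =
      ∑ m ∈ Ioc 0 n, Λ m * ((wsum posL (fun d => n / m / d) : ℕ) : ℝ) := by
    rw [wsum_swap]
    refine wsumR_congr _ _ _ fun p hp => T_div n p.1 ?_
    revert p; decide
  have e3 : wsumR hL (fun k => Chebyshev.psi ((n / k : ℕ) : ℝ)) =
      ∑ m ∈ Ioc 0 n, Λ m * ((wsum hL (fun k => if k ≤ n / m then 1 else 0) : ℕ) : ℝ) := by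
    rw [wsum_swap]
    refine wsumR_congr _ _ _ fun p hp => psi_div n p.1 ?_
    revert p; decide
  rw [e1, e2, e3, psi_nat, Finset.mul_sum, ← Finset.sum_add_distrib, ← Finset.sum_add_distrib]
  refine Finset.sum_le_sum fun m hm => ?_
  rw [mem_Ioc] at hm
  have hp := pointwise (n / m) ((Nat.one_le_div_iff hm.1).2 hm.2)
  have hp' : (972400 : ℝ) + ((wsum negL (fun d => n / m / d) : ℕ) : ℝ) ≤
    ((wsum posL (fun d => n / m / d) : ℕ) : ℝ) +
      ((wsum hL (fun k => if k ≤ n / m then 1 else 0) : ℕ) : ℝ) := by exact_mod_cast hp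
  have hL : 0 ≤ Λ m := vonMangoldt_nonneg
  nlinarith [mul_le_mul_of_nonneg_left hp' hL]

end NPL


namespace NPL
open Finset Real
open ArithmeticFunction hiding log id
open scoped Nat

lemma gconv (a b : ℝ) (ha : 0 < a) (hb : 0 < b) :
    a * Real.log a - a + (b - a) * Real.log a ≤ b * Real.log b - b := by
  have h := Real.log_le_sub_one_of_pos (div_pos ha hb)
  rw [Real.log_div ha.ne' hb.ne'] at h
  have h2 := mul_le_mul_of_nonneg_left h hb.le
  have h3 : b * (a / b - 1) = a - b := by field_simp
  rw [h3] at h2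
  nlinarith

lemma fact_upper (q : ℕ) (hq : 1 ≤ q) :
    Real.log (q ! : ℝ) ≤ q * Real.log q - q + Real.log q / 2 + 1 := by
  obtain ⟨m, rfl⟩ : ∃ m, q = m + 1 := ⟨q - 1, by omega⟩
  have h := Stirling.log_stirlingSeq'_antitone (Nat.zero_le m)
  simp only [Function.comp, Nat.succ_eq_add_one] at h
  rw [Stirling.log_stirlingSeq_formula, Stirling.log_stirlingSeq_formula] at h
  have hm : (0 : ℝ) < ((m + 1 : ℕ) : ℝ) := by positivity
  rw [Real.log_mul (by norm_num) hm.ne', Real.log_div hm.ne' (Real.exp_pos 1).ne',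
    Real.log_exp] at h
  simp at h
  push_cast at h ⊢
  linarith

lemma T_upper (n d : ℕ) (hn : 1 ≤ n) (hd : 1 ≤ d) :
    Real.log ((n / d)! : ℝ) ≤ (n : ℝ) / d * (Real.log n - Real.log d) - n / d
      + Real.log n / 2 + 1 := by
  have hn' : (1 : ℝ) ≤ n := by exact_mod_cast hn
  have hd' : (1 : ℝ) ≤ d := by exact_mod_cast hd
  have hx : (0 : ℝ) < (n : ℝ) / d := by positivity
  rw [← Real.log_div (by positivity) (by positivity)]
  have hL : 0 ≤ Real.log n := Real.log_nonneg hn'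
  rcases Nat.eq_zero_or_pos (n / d) with h0 | h0
  · rw [h0]
    have := gconv 1 _ one_pos hx
    simp at this ⊢
    linarith
  · have hq : (1 : ℝ) ≤ ((n / d : ℕ) : ℝ) := by exact_mod_cast h0
    have hqx : ((n / d : ℕ) : ℝ) ≤ (n : ℝ) / d := Nat.cast_div_le
    have h1 := fact_upper _ h0
    have h2 := gconv _ _ (by linarith : (0:ℝ) < ((n / d : ℕ) : ℝ)) hx
    have h3 : 0 ≤ ((n : ℝ) / d - ((n / d : ℕ) : ℝ)) * Real.log ((n / d : ℕ) : ℝ) :=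
      mul_nonneg (by linarith) (Real.log_nonneg hq)
    have h4 : Real.log ((n / d : ℕ) : ℝ) ≤ Real.log n := by
      apply Real.log_le_log (by linarith)
      exact_mod_cast Nat.div_le_self n d
    linarith

lemma T_lower (n d : ℕ) (hn : 6 ≤ n) (hd : 2 ≤ d) :
    (n : ℝ) / d * (Real.log n - Real.log d) - n / d - Real.log n / 2 + Real.log 6 / 2
      ≤ Real.log ((n / d)! : ℝ) := by
  have hn' : (6 : ℝ) ≤ n := by exact_mod_cast hn
  have hd' : (2 : ℝ) ≤ d := by exact_mod_cast hd
  have hx : (0 : ℝ) < (n : ℝ) / d := by positivity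
  rw [← Real.log_div (by positivity) (by positivity)]
  have hL6 : Real.log 6 ≤ Real.log n := Real.log_le_log (by norm_num) hn'
  rcases Nat.eq_zero_or_pos (n / d) with h0 | h0
  · rw [h0]
    have hlt : (n : ℝ) / d < 1 := by
      rw [div_lt_one (by positivity)]
      have := (Nat.div_eq_zero_iff.1 h0)
      have : n < d := by omega
      exact_mod_cast this
    have : Real.log ((n : ℝ) / d) ≤ 0 := Real.log_nonpos hx.le hlt.le
    simp
    nlinarith
  · have hle : d ≤ n := by
      by_contra h
      rw [Nat.div_eq_of_lt (by omega)] at h0; omega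
    have h1x : (1 : ℝ) ≤ (n : ℝ) / d := by
      rw [le_div_iff₀ (by positivity)]
      have : (d : ℝ) ≤ n := by exact_mod_cast hle
      linarith
    set q := n / d with hq
    have hqx : (n : ℝ) / d ≤ ((q + 1 : ℕ) : ℝ) := by
      rw [div_le_iff₀ (by positivity)]
      have := (Nat.lt_mul_div_succ n (by omega : 0 < d)).le
      rw [mul_comm, ← hq] at this
      exact_mod_cast this
    have h1 := Stirling.le_log_factorial_stirling (n := q + 1) (by omega)
    have hq0 : (0 : ℝ) < ((q + 1 : ℕ) : ℝ) := by positivity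
    have h2 := gconv _ _ hx hq0
    have h3 : 0 ≤ (((q + 1 : ℕ) : ℝ) - (n : ℝ) / d) * Real.log ((n : ℝ) / d) :=
      mul_nonneg (by linarith) (Real.log_nonneg h1x)
    have h4 : Real.log ((q + 1 : ℕ) : ℝ) ≤ Real.log n := by
      apply Real.log_le_log hq0
      have : q ≤ n / 2 := Nat.div_le_div_left hd (by norm_num)
      have : q + 1 ≤ n := by omega
      exact_mod_cast this
    have h5 : Real.log ((q + 1)! : ℝ) = Real.log ((q + 1 : ℕ) : ℝ) + Real.log (q ! : ℝ) := by
      rw [Nat.factorial_succ]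
      push_cast
      rw [Real.log_mul (by positivity) (by positivity)]
    have h6 : Real.log 6 ≤ Real.log (2 * π) :=
      Real.log_le_log (by norm_num) (by linarith [Real.pi_gt_three])
    linarith

lemma log_succ_bounds (a : ℝ) (ha : 0 < a) :
    Real.log a + 1 / (a + 1) ≤ Real.log (a + 1) ∧ Real.log (a + 1) ≤ Real.log a + 1 / a := by
  constructor
  · have h := Real.log_le_sub_one_of_pos (div_pos ha (by linarith : 0 < a + 1))
    rw [Real.log_div ha.ne' (by linarith)] at h
    have : a / (a + 1) - 1 = - (1 / (a + 1)) := by field_simp; ring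
    linarith
  · have h := Real.log_le_sub_one_of_pos (div_pos (by linarith : 0 < a + 1) ha)
    rw [Real.log_div (by linarith) ha.ne'] at h
    have : (a + 1) / a - 1 = 1 / a := by field_simp; ring
    linarith

lemma log6 : Real.log 6 = Real.log 2 + Real.log 3 := by
  rw [← Real.log_mul (by norm_num) (by norm_num)]; norm_num

lemma log_mul_nat (a b : ℕ) (ha : 0 < a) (hb : 0 < b) :
    Real.log ((a * b : ℕ) : ℝ) = Real.log a + Real.log b := by
  push_cast
  rw [Real.log_mul (by positivity) (by positivity)]

lemma log7_bounds : 1.9458 ≤ Real.log 7 ∧ Real.log 7 ≤ 1.946 := by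
  have h := log_succ_bounds 2400 (by norm_num)
  have e1 : Real.log (2400 + 1) = 4 * Real.log 7 := by
    rw [show (2400 + 1 : ℝ) = 7 ^ 4 by norm_num, Real.log_pow]; norm_num
  have e2 : Real.log 2400 = 5 * Real.log 2 + Real.log 3 + 2 * Real.log 5 := by
    rw [show (2400 : ℝ) = 2 ^ 5 * 3 * 5 ^ 2 by norm_num, Real.log_mul (by norm_num) (by norm_num),
      Real.log_mul (by norm_num) (by norm_num), Real.log_pow, Real.log_pow]; norm_num
  rw [e1, e2] at h
  have := Real.log_two_gt_d9; have := Real.log_two_lt_d9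
  have := Real.log_three_gt_d9; have := Real.log_three_lt_d9
  have := Real.log_five_gt_d9; have := Real.log_five_lt_d9
  constructor <;> norm_num at * <;> linarith [h.1, h.2]

lemma log11_bounds : 2.3978 ≤ Real.log 11 ∧ Real.log 11 ≤ 2.398 := by
  have h := log_succ_bounds 120 (by norm_num)
  have e1 : Real.log (120 + 1) = 2 * Real.log 11 := by
    rw [show (120 + 1 : ℝ) = 11 ^ 2 by norm_num, Real.log_pow]; norm_num
  have e2 : Real.log 120 = 3 * Real.log 2 + Real.log 3 + Real.log 5 := by
    rw [show (120 : ℝ) = 2 ^ 3 * 3 * 5 by norm_num, Real.log_mul (by norm_num) (by norm_num),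
      Real.log_mul (by norm_num) (by norm_num), Real.log_pow]; norm_num
  rw [e1, e2] at h
  have := Real.log_two_gt_d9; have := Real.log_two_lt_d9
  have := Real.log_three_gt_d9; have := Real.log_three_lt_d9
  have := Real.log_five_gt_d9; have := Real.log_five_lt_d9
  constructor <;> norm_num at * <;> linarith [h.1, h.2]

lemma log13_bounds : 2.5647 ≤ Real.log 13 ∧ Real.log 13 ≤ 2.5652 := by
  have h := log_succ_bounds 168 (by norm_num)
  have e1 : Real.log (168 + 1) = 2 * Real.log 13 := by
    rw [show (168 + 1 : ℝ) = 13 ^ 2 by norm_num, Real.log_pow]; norm_num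
  have e2 : Real.log 168 = 3 * Real.log 2 + Real.log 3 + Real.log 7 := by
    rw [show (168 : ℝ) = 2 ^ 3 * 3 * 7 by norm_num, Real.log_mul (by norm_num) (by norm_num),
      Real.log_mul (by norm_num) (by norm_num), Real.log_pow]; norm_num
  rw [e1, e2] at h
  have := Real.log_two_gt_d9; have := Real.log_two_lt_d9
  have := Real.log_three_gt_d9; have := Real.log_three_lt_d9
  have := log7_bounds.1; have := log7_bounds.2
  constructor <;> norm_num at * <;> linarith [h.1, h.2]

lemma log17_bounds : 2.8331 ≤ Real.log 17 ∧ Real.log 17 ≤ 2.8333 := by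
  have h := log_succ_bounds 288 (by norm_num)
  have e1 : Real.log (288 + 1) = 2 * Real.log 17 := by
    rw [show (288 + 1 : ℝ) = 17 ^ 2 by norm_num, Real.log_pow]; norm_num
  have e2 : Real.log 288 = 5 * Real.log 2 + 2 * Real.log 3 := by
    rw [show (288 : ℝ) = 2 ^ 5 * 3 ^ 2 by norm_num, Real.log_mul (by norm_num) (by norm_num),
      Real.log_pow, Real.log_pow]; norm_num
  rw [e1, e2] at h
  have := Real.log_two_gt_d9; have := Real.log_two_lt_d9
  have := Real.log_three_gt_d9; have := Real.log_three_lt_d9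
  constructor <;> norm_num at * <;> linarith [h.1, h.2]

lemma log_le_sqrt (x : ℝ) (hx : 0 < x) : Real.log x ≤ 0.7358 * √x := by
  have hs : 0 < √x := Real.sqrt_pos.2 hx
  have h := Real.log_le_sub_one_of_pos (div_pos hs (Real.exp_pos 1))
  rw [Real.log_div hs.ne' (Real.exp_pos 1).ne', Real.log_exp, Real.log_sqrt hx.le] at h
  have he := Real.exp_one_gt_d9
  have : √x / Real.exp 1 ≤ 0.3679 * √x := by
    rw [div_le_iff₀ (Real.exp_pos 1)]
    nlinarith
  linarith

lemma sqrt_div_le (n k : ℕ) (r : ℝ) (hr : 0 ≤ r) (hk : 0 < k) (h : 1 ≤ k * r ^ 2) :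
    √((n / k : ℕ) : ℝ) ≤ √(n : ℝ) * r := by
  have hk' : (0 : ℝ) < k := by exact_mod_cast hk
  have h1 : ((n / k : ℕ) : ℝ) ≤ (n : ℝ) * r ^ 2 := by
    refine (Nat.cast_div_le (α := ℝ)).trans ?_
    rw [div_le_iff₀ hk']
    have : (0 : ℝ) ≤ n := by positivity
    nlinarith
  calc √((n / k : ℕ) : ℝ) ≤ √((n : ℝ) * r ^ 2) := Real.sqrt_le_sqrt h1
    _ = √(n : ℝ) * r := by rw [Real.sqrt_mul (by positivity), Real.sqrt_sq hr]

end NPL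


namespace NPL
open Finset Real
open ArithmeticFunction hiding log id
open scoped Nat

lemma psi_step (n : ℕ) (hn : 6 ≤ n) :
    972400 * Chebyshev.psi (n : ℝ) ≤ 972400 * (0.982 * n + 7.746 * Real.log n) +
        wsumR hL (fun k => Chebyshev.psi ((n / k : ℕ) : ℝ)) := by
  have h := main_ineq n
  have hnp : (0 : ℝ) ≤ n := by positivity
  have hlog : 0 ≤ Real.log n := Real.log_nonneg (by exact_mod_cast (by omega : 1 ≤ n))
  have up : ∀ d : ℕ, 1 ≤ d → Real.log ((n / d)! : ℝ) ≤
      (n : ℝ) / d * (Real.log n - Real.log d) - n / d + Real.log n / 2 + 1 :=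
    fun d hd => T_upper n d (by omega) hd
  have lo := fun d => T_lower n d hn
  have key : wsumR posL (fun d => Real.log ((n / d)! : ℝ)) -
      wsumR negL (fun d => Real.log ((n / d)! : ℝ)) ≤
      972400 * (0.982 * n + 7.746 * Real.log n) := by
    simp only [wsumR, negL, posL, List.map_cons, List.map_nil, List.sum_cons, List.sum_nil]
    have u1 := up 1 (by norm_num); have u2 := up 6 (by norm_num); have u3 := up 10 (by norm_num)
    have u4 := up 14 (by norm_num); have u5 := up 15 (by norm_num); have u6 := up 21 (by norm_num)
    have u7 := up 22 (by norm_num); have u8 := up 28 (by norm_num); have u9 := up 33 (by norm_num)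
    have u10 := up 35 (by norm_num)
    have l1 := lo 2 (by norm_num); have l2 := lo 3 (by norm_num); have l3 := lo 5 (by norm_num)
    have l4 := lo 7 (by norm_num); have l5 := lo 11 (by norm_num); have l6 := lo 13 (by norm_num)
    have l7 := lo 17 (by norm_num); have l8 := lo 20 (by norm_num); have l9 := lo 24 (by norm_num)
    have l10 := lo 30 (by norm_num)
    have e6 := log_mul_nat 2 3 (by norm_num) (by norm_num)
    have e10 := log_mul_nat 2 5 (by norm_num) (by norm_num)
    have e14 := log_mul_nat 2 7 (by norm_num) (by norm_num)
    have e15 := log_mul_nat 3 5 (by norm_num) (by norm_num)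
    have e21 := log_mul_nat 3 7 (by norm_num) (by norm_num)
    have e22 := log_mul_nat 2 11 (by norm_num) (by norm_num)
    have e28 := log_mul_nat 2 14 (by norm_num) (by norm_num)
    have e33 := log_mul_nat 3 11 (by norm_num) (by norm_num)
    have e35 := log_mul_nat 5 7 (by norm_num) (by norm_num)
    have e20 := log_mul_nat 2 10 (by norm_num) (by norm_num)
    have e12 := log_mul_nat 2 6 (by norm_num) (by norm_num)
    have e24 := log_mul_nat 2 12 (by norm_num) (by norm_num)
    have e30 := log_mul_nat 3 10 (by norm_num) (by norm_num)
    norm_num at e6 e10 e14 e15 e21 e22 e28 e33 e35 e20 e12 e24 e30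
    rw [e6] at e12
    rw [e12] at e24
    rw [e10] at e20 e30
    rw [e14] at e28
    push_cast at u1 u2 u3 u4 u5 u6 u7 u8 u9 u10 l1 l2 l3 l4 l5 l6 l7 l8 l9 l10 ⊢
    rw [Real.log_one] at u1
    rw [e6] at u2 l1 l2 l3 l4 l5 l6 l7 l8 l9 l10
    rw [e10] at u3
    rw [e14] at u4
    rw [e15] at u5
    rw [e21] at u6
    rw [e22] at u7
    rw [e28] at u8
    rw [e33] at u9
    rw [e35] at u10
    rw [e20] at l8
    rw [e24] at l9
    rw [e30] at l10
    have b2 := Real.log_two_gt_d9; have b2' := Real.log_two_lt_d9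
    have b3 := Real.log_three_gt_d9; have b3' := Real.log_three_lt_d9
    have b5 := Real.log_five_gt_d9; have b5' := Real.log_five_lt_d9
    obtain ⟨b7, b7'⟩ := log7_bounds
    obtain ⟨b11, b11'⟩ := log11_bounds
    obtain ⟨b13, b13'⟩ := log13_bounds
    obtain ⟨b17, b17'⟩ := log17_bounds
    have m2 := mul_le_mul_of_nonneg_left b2.le hnp
    have m2' := mul_le_mul_of_nonneg_left b2'.le hnp
    have m3 := mul_le_mul_of_nonneg_left b3.le hnp
    have m3' := mul_le_mul_of_nonneg_left b3'.le hnp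
    have m5 := mul_le_mul_of_nonneg_left b5.le hnp
    have m5' := mul_le_mul_of_nonneg_left b5'.le hnp
    have m7 := mul_le_mul_of_nonneg_left b7 hnp
    have m7' := mul_le_mul_of_nonneg_left b7' hnp
    have m11 := mul_le_mul_of_nonneg_left b11 hnp
    have m11' := mul_le_mul_of_nonneg_left b11' hnp
    have m13 := mul_le_mul_of_nonneg_left b13 hnp
    have m13' := mul_le_mul_of_nonneg_left b13' hnp
    have m17 := mul_le_mul_of_nonneg_left b17 hnp
    have m17' := mul_le_mul_of_nonneg_left b17' hnp
    linarith
  linarith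

lemma psi_bound (n : ℕ) : Chebyshev.psi (n : ℝ) ≤ 1.052 * n + 10 * √(n : ℝ) := by
  induction n using Nat.strong_induction_on with
  | _ n ih =>
    rcases Nat.lt_or_ge n 6 with h6 | h6
    · have h := Chebyshev.psi_le_const_mul_self (x := (n : ℝ)) (by positivity)
      have h4 : Real.log 4 = 2 * Real.log 2 := by
        rw [show (4 : ℝ) = 2 ^ 2 by norm_num, Real.log_pow]; norm_num
      have hl := Real.log_two_lt_d9
      have hn : (n : ℝ) ≤ 5 := by exact_mod_cast (by omega : n ≤ 5)
      have hn0 : (0 : ℝ) ≤ n := by positivity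
      have hs : 0.434 * (n : ℝ) ≤ √(n : ℝ) := by
        apply Real.le_sqrt_of_sq_le
        nlinarith
      have : (Real.log 4 + 4) * (n : ℝ) ≤ 5.387 * n := by
        apply mul_le_mul_of_nonneg_right _ hn0
        rw [h4]; linarith
      linarith
    · have h := psi_step n h6
      have hnp : (0 : ℝ) < n := by positivity
      have hlog := log_le_sqrt n hnp
      have st : ∀ (k : ℕ) (r : ℝ), 2 ≤ k → 0 ≤ r → 1 ≤ k * r ^ 2 →
          Chebyshev.psi ((n / k : ℕ) : ℝ) ≤ 1.052 * (n / k) + 10 * (√(n : ℝ) * r) := by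
        intro k r hk hr h
        have h1 := ih (n / k) (Nat.div_lt_self (by omega) (by omega))
        have h2 := sqrt_div_le n k r hr (by omega) h
        have h3 : ((n / k : ℕ) : ℝ) ≤ (n : ℝ) / k := Nat.cast_div_le
        linarith
      simp only [wsumR, hL, List.map_cons, List.map_nil, List.sum_cons, List.sum_nil] at h
      have s1 := st 15 0.2583 (by norm_num) (by norm_num) (by norm_num)
      have s2 := st 22 0.2133 (by norm_num) (by norm_num) (by norm_num)
      have s3 := st 35 0.1691 (by norm_num) (by norm_num) (by norm_num)
      have s4 := st 100 0.1 (by norm_num) (by norm_num) (by norm_num)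
      have s5 := st 275 0.0604 (by norm_num) (by norm_num) (by norm_num)
      have s6 := st 520 0.0439 (by norm_num) (by norm_num) (by norm_num)
      have s7 := st 3000 0.01826 (by norm_num) (by norm_num) (by norm_num)
      have hsq : 0 ≤ √(n : ℝ) := Real.sqrt_nonneg _
      push_cast at s1 s2 s3 s4 s5 s6 s7 h
      linarith

end NPL


namespace NPL
open Finset Real

lemma int_log_sq_le {a b : ℝ} (hab : a ≤ b) (one_lt : 1 < a) :
    ∫ x in a..b, 1 / Real.log x ^ 2 ≤ (b - a) / Real.log a ^ 2 := by
  calc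
  _ ≤ ∫ x in a..b, 1 / Real.log a ^ 2 := by
      refine intervalIntegral.integral_mono_on hab ?_ (by simp) fun x ⟨_, _⟩ ↦ by gcongr <;> bound
      apply Chebyshev.intervalIntegrable_one_div_log_sq <;> linarith
  _ ≤ _ := by simp [field]

lemma log_pow2 (k : ℕ) : Real.log ((2 : ℝ) ^ k) = k * Real.log 2 := Real.log_pow 2 k

lemma int_tail (x : ℝ) (hx : 64 ≤ x) :
    ∫ t in (64 : ℝ)..x, 1 / Real.log t ^ 2 ≤ 2 * x / Real.log x ^ 2 - 2 * 64 / Real.log 64 ^ 2 := by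
  have hl64 : 4 ≤ Real.log 64 := by
    have := log_pow2 6
    norm_num at this
    rw [this]; linarith [Real.log_two_gt_d9]
  have hder : ∀ t ∈ Set.uIcc (64 : ℝ) x,
      HasDerivAt (fun t => 2 * t / Real.log t ^ 2) (2 / Real.log t ^ 2 - 4 / Real.log t ^ 3) t := by
    intro t ht
    rw [Set.uIcc_of_le hx] at ht
    have ht0 : 0 < t := by linarith [ht.1]
    have hlt : 0 < Real.log t := Real.log_pos (by linarith [ht.1])
    have h1 := ((hasDerivAt_id t).const_mul 2).div ((Real.hasDerivAt_log ht0.ne').pow 2)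
      (pow_ne_zero 2 hlt.ne')
    refine (h1.congr_deriv ?_ : HasDerivAt (fun t => 2 * t / Real.log t ^ 2) _ t)
    simp only [id, Pi.pow_apply]
    field_simp
    ring
  have hIntg : IntervalIntegrable (fun t => 2 / Real.log t ^ 2 - 4 / Real.log t ^ 3)
      MeasureTheory.volume 64 x := by
    apply ContinuousOn.intervalIntegrable
    rw [Set.uIcc_of_le hx]
    intro t ht
    have ht0 : t ≠ 0 := by linarith [ht.1]
    have hlt : Real.log t ≠ 0 := (Real.log_pos (by linarith [ht.1])).ne'
    apply ContinuousAt.continuousWithinAt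
    fun_prop (disch := simp_all)
  rw [← intervalIntegral.integral_eq_sub_of_hasDerivAt hder hIntg]
  refine intervalIntegral.integral_mono_on hx
    (Chebyshev.intervalIntegrable_one_div_log_sq (by norm_num) (by linarith)) hIntg ?_
  intro t ht
  have hlt : 4 ≤ Real.log t := hl64.trans (Real.log_le_log (by norm_num) ht.1)
  have hlt0 : 0 < Real.log t := by linarith
  rw [← sub_nonneg]
  have : 2 / Real.log t ^ 2 - 4 / Real.log t ^ 3 - 1 / Real.log t ^ 2 =
    (Real.log t - 4) / Real.log t ^ 3 := by field_simp; ring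
  rw [this]
  exact div_nonneg (by linarith) (by positivity)

lemma int_total (x : ℝ) (hx : 64 ≤ x) :
    ∫ t in (2 : ℝ)..x, 1 / Real.log t ^ 2 ≤ 2 * x / Real.log x ^ 2 + 26 := by
  have ii := fun a b (ha : (1 : ℝ) < a) (hb : (1 : ℝ) < b) =>
    Chebyshev.intervalIntegrable_one_div_log_sq ha hb
  have h8 := int_log_sq_le (a := 2) (b := 8) (by norm_num) (by norm_num)
  have h64 := int_log_sq_le (a := 8) (b := 64) (by norm_num) (by norm_num)
  have ht := int_tail x hx
  rw [← intervalIntegral.integral_add_adjacent_intervals (ii 2 8 (by norm_num) (by norm_num))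
    (ii 8 x (by norm_num) (by linarith)),
    ← intervalIntegral.integral_add_adjacent_intervals (ii 8 64 (by norm_num) (by norm_num))
    (ii 64 x (by norm_num) (by linarith))]
  have e8 := log_pow2 3
  norm_num at e8
  have l2 := Real.log_two_gt_d9
  have b1 : (8 - 2) / Real.log 2 ^ 2 ≤ 12.6 := by
    rw [div_le_iff₀ (by positivity)]; nlinarith
  have b2 : (64 - 8) / Real.log 8 ^ 2 ≤ 13 := by
    rw [e8, div_le_iff₀ (by positivity)]; nlinarith
  have b3 : 0 ≤ 2 * 64 / Real.log 64 ^ 2 := by positivity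
  linarith

lemma pi_large (p : ℕ) (hp : 8192 ≤ p) :
    (Nat.count Nat.Prime (p + 1) : ℝ) * Real.log p ≤ (1.052 + 5 / Real.log p) * p := by
  have hp' : (8192 : ℝ) ≤ p := by exact_mod_cast hp
  have hp0 : (0 : ℝ) < p := by linarith
  have e13 := log_pow2 13
  norm_num at e13
  have l2 := Real.log_two_gt_d9
  have l2' := Real.log_two_lt_d9
  have hL9 : 9 ≤ Real.log p := by
    have := Real.log_le_log (by norm_num) hp'
    linarith
  have hL : 0 < Real.log p := by linarith
  have h := Chebyshev.primeCounting_eq_theta_div_log_add_integral (x := (p : ℝ)) (by linarith)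
  rw [Nat.floor_natCast] at h
  have hc : (Nat.primeCounting p : ℝ) = Nat.count Nat.Prime (p + 1) := rfl
  rw [hc] at h
  have hθ : Chebyshev.theta (p : ℝ) ≤ 1.052 * p + 10 * √(p : ℝ) :=
    (Chebyshev.theta_le_psi _).trans (psi_bound p)
  have hi : ∫ t in (2 : ℝ)..p, Chebyshev.theta t / (t * Real.log t ^ 2) ≤
      Real.log 4 * (2 * p / Real.log p ^ 2 + 26) := by
    calc _ ≤ ∫ t in (2 : ℝ)..p, Real.log 4 * (1 / Real.log t ^ 2) := by
          refine intervalIntegral.integral_mono_on (by linarith) ?_ ?_ ?_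
          · rw [intervalIntegrable_iff_integrableOn_Icc_of_le (by linarith)]
            exact Chebyshev.integrableOn_theta_div_id_mul_log_sq _
          · exact (Chebyshev.intervalIntegrable_one_div_log_sq (by norm_num)
              (by linarith)).const_mul _
          · intro t ht
            have ht0 : 0 < t := by linarith [ht.1]
            have hlt : 0 < Real.log t := Real.log_pos (by linarith [ht.1])
            have := Chebyshev.theta_le_log4_mul_x ht0.le
            rw [div_le_iff₀ (by positivity)]
            calc _ ≤ Real.log 4 * t := this
              _ = _ := by field_simp
      _ ≤ _ := by
          rw [intervalIntegral.integral_const_mul]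
          exact mul_le_mul_of_nonneg_left (int_total _ (by linarith)) (Real.log_nonneg (by norm_num))
  have e4 := log_pow2 2
  norm_num at e4
  set L := Real.log (p : ℝ) with hLdef
  set s := √(p : ℝ) with hs
  have hss : s * s = p := Real.mul_self_sqrt hp0.le
  have hs90 : 90.5 ≤ s := Real.le_sqrt_of_sq_le (by norm_num; linarith)
  have hs0 : 0 < s := by linarith
  have hLs : L ≤ 0.0997 * s := by
    have he : Real.exp 2 ≤ 8192 := by
      have h1 := Real.exp_one_lt_d9.le
      have : Real.exp 2 = Real.exp 1 * Real.exp 1 := by rw [← Real.exp_add]; norm_num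
      nlinarith [Real.exp_pos 1]
    have ha := Real.log_div_sqrt_antitoneOn (show (8192 : ℝ) ∈ Set.Ici (Real.exp 2) from he)
      (show (p : ℝ) ∈ Set.Ici (Real.exp 2) from he.trans hp') hp'
    simp only at ha
    rw [← hLdef, ← hs] at ha
    have hq : (90.5 : ℝ) ≤ √8192 := Real.le_sqrt_of_sq_le (by norm_num)
    have : Real.log 8192 / √8192 ≤ 0.0997 := by
      rw [div_le_iff₀ (by linarith)]
      linarith
    have := ha.trans this
    rwa [div_le_iff₀ hs0] at this
  rw [h]
  have hX : (Chebyshev.theta (p : ℝ) / L + ∫ t in (2 : ℝ)..p, Chebyshev.theta t / (t * Real.log t ^ 2))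
      ≤ (1.052 * p + 10 * s) / L + Real.log 4 * (2 * p / L ^ 2 + 26) := by gcongr
  have h4 : Real.log 4 ≤ 1.3863 := by linarith
  have hX2 : ((1.052 * p + 10 * s) / L + Real.log 4 * (2 * p / L ^ 2 + 26)) ≤
     (1.052 * p + 10 * s) / L + 1.3863 * (2 * p / L ^ 2 + 26) := by gcongr
  have hX3 : ((1.052 * p + 10 * s) / L + 1.3863 * (2 * p / L ^ 2 + 26)) * L =
     1.052 * p + (10 * s * L + 2.7726 * p + 36.0438 * L ^ 2) / L := by field_simp; ring
  calc _ ≤ _ := mul_le_mul_of_nonneg_right (hX.trans hX2) hL.le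
    _ = _ := hX3
    _ ≤ 1.052 * p + (5 * p) / L := by
      gcongr
      have h1 : s * L ≤ 0.0997 * p := by nlinarith
      have h2 : L ^ 2 ≤ 0.00995 * p := by nlinarith
      linarith
    _ = _ := by ring

end NPL


namespace NPL
open Finset Real

/-- product of the primes up to 89 -/
def prim89 : ℕ := 23768741896345550770650537601358310

/-- sieve test: numbers below 90 or coprime to all primes up to 89 -/
def sieve (s : ℕ) : Bool := Nat.blt s 90 || Nat.beq (Nat.gcd s prim89) 1

/-- number of sieve survivors in `[s, s + len)` (or an upper bound if the fuel is too small) -/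
def sieveCount : ℕ → ℕ → ℕ → ℕ
  | 0, _, len => len
  | f + 1, s, len =>
    bif Nat.beq len 1 then (bif sieve s then 1 else 0)
    else sieveCount f s (len / 2) + sieveCount f (s + len / 2) (len - len / 2)

lemma prim89_dvd : prim89 ∣ Nat.factorial 89 := by
  unfold prim89; decide +kernel

lemma sieve_of_prime (s : ℕ) (hs : s.Prime) : sieve s = true := by
  unfold sieve
  simp only [Bool.or_eq_true, Nat.blt_eq, Nat.beq_eq]
  by_cases h : s < 90
  · exact Or.inl h
  · right
    have h1 : Nat.Coprime s (Nat.factorial 89) := by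
      rw [Nat.Prime.coprime_iff_not_dvd hs, hs.dvd_factorial]
      omega
    exact h1.coprime_dvd_right prim89_dvd

lemma count_le_sieve (f : ℕ) : ∀ s len : ℕ,
    Nat.count Nat.Prime (s + len) ≤ Nat.count Nat.Prime s + sieveCount f s len := by
  induction f with
  | zero =>
    intro s len
    rw [Nat.count_add]
    have := Nat.count_le (p := fun k => Nat.Prime (s + k)) (n := len)
    simp only [sieveCount]
    omega
  | succ f ih =>
    intro s len
    simp only [sieveCount]
    by_cases h : len = 1
    · subst h
      rw [Nat.count_succ]
      by_cases hp : s.Prime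
      · simp [hp, sieve_of_prime s hp]
      · simp [hp]
    · have hb : Nat.beq len 1 = false := by
        rw [← Bool.not_eq_true, Nat.beq_eq]; exact h
      rw [hb]
      simp only [cond_false]
      have h1 := ih s (len / 2)
      have h2 := ih (s + len / 2) (len - len / 2)
      have h3 : s + len / 2 + (len - len / 2) = s + len := by omega
      rw [h3] at h2
      omega

lemma fin (n : ℕ) (p L X : ℝ) (hp : 0 < p) (hL : 0 < L) (hX : n * L ≤ X * p)
    (h : (756 * X + 117 * X ^ 2 - 927) * L < 5620) :
    756 * (n : ℝ) * p * L ^ 2 + 117 * (n : ℝ) ^ 2 * L ^ 3 < 927 * p ^ 2 * L + 5620 * p ^ 2 := by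
  have h0 : 0 ≤ n * L := by positivity
  have h1 : (n * L) ^ 2 ≤ (X * p) ^ 2 := by gcongr
  have h2 : L * (756 * (n * L) * p + 117 * (n * L) ^ 2) ≤
      L * (756 * (X * p) * p + 117 * (X * p) ^ 2) := by gcongr
  have h3 := mul_lt_mul_of_pos_left h (pow_pos hp 2)
  nlinarith

lemma chunk (a b m : ℕ) (la lb : ℝ) (ha : 3 ≤ a) (hla : Real.log a ≤ la) (hlb : Real.log b ≤ lb)
    (hm : Nat.count Nat.Prime b ≤ m)
    (h : (756 * (m * la / a) + 117 * (m * la / a) ^ 2 - 927) * lb < 5620)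
    (p : ℕ) (hap : a ≤ p) (hpb : p < b) :
    756 * (Nat.count Nat.Prime (p + 1) : ℝ) * p * Real.log p ^ 2 +
      117 * (Nat.count Nat.Prime (p + 1) : ℝ) ^ 2 * Real.log p ^ 3 <
      927 * (p : ℝ) ^ 2 * Real.log p + 5620 * (p : ℝ) ^ 2 := by
  have ha' : (3 : ℝ) ≤ a := by exact_mod_cast ha
  have hap' : (a : ℝ) ≤ p := by exact_mod_cast hap
  have hpb' : (p : ℝ) ≤ b := by exact_mod_cast hpb.le
  have hp0 : (0 : ℝ) < p := by linarith
  have hL : 0 < Real.log p := Real.log_pos (by linarith)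
  have hLb : Real.log p ≤ lb := (Real.log_le_log hp0 hpb').trans hlb
  have he : Real.exp 1 ≤ 3 := by linarith [Real.exp_one_lt_d9]
  have hanti := Real.log_div_self_antitoneOn (show (a : ℝ) ∈ Set.Ici (Real.exp 1) from he.trans ha')
    (show (p : ℝ) ∈ Set.Ici (Real.exp 1) from he.trans (ha'.trans hap')) hap'
  simp only at hanti
  have hn : (Nat.count Nat.Prime (p + 1) : ℝ) ≤ m := by
    exact_mod_cast (Nat.count_monotone _ (by omega : p + 1 ≤ b)).trans hm
  refine fin _ _ _ (m * la / a) hp0 hL ?_ ?_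
  · have h1 : Real.log p / p ≤ la / a := hanti.trans (by gcongr)
    rw [div_le_iff₀ hp0] at h1
    calc _ ≤ (m : ℝ) * (la / a * p) := by gcongr
      _ = _ := by ring
  · by_cases hc : 0 ≤ 756 * (m * la / a) + 117 * (m * la / a) ^ 2 - 927
    · exact (mul_le_mul_of_nonneg_left hLb hc).trans_lt h
    · have := mul_neg_of_neg_of_pos (not_le.mp hc) hL
      linarith

lemma log_smooth (i j : ℕ) : Real.log ((2 ^ i * 3 ^ j : ℕ) : ℝ) ≤
    i * 0.6931471808 + j * 1.0986122888 := by
  push_cast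
  rw [Real.log_mul (by positivity) (by positivity), Real.log_pow, Real.log_pow]
  have h2 := Real.log_two_lt_d9.le
  have h3 := Real.log_three_lt_d9.le
  gcongr

lemma count_step (a b m k : ℕ) (ha : Nat.count Nat.Prime a ≤ m) (hab : a ≤ b)
    (h : Nat.ble (m + sieveCount 13 a (b - a)) k = true) : Nat.count Nat.Prime b ≤ k := by
  have h1 := count_le_sieve 13 a (b - a)
  rw [Nat.add_sub_cancel' hab] at h1
  have := Nat.ble_eq ▸ h
  omega

lemma small (p : ℕ) (hp : 2 ≤ p) (hp2 : p < 8192) :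
    756 * (Nat.count Nat.Prime (p + 1) : ℝ) * p * Real.log p ^ 2 +
      117 * (Nat.count Nat.Prime (p + 1) : ℝ) ^ 2 * Real.log p ^ 3 <
      927 * (p : ℝ) ^ 2 * Real.log p + 5620 * (p : ℝ) ^ 2 := by
  have c0 : Nat.count Nat.Prime 3 ≤ 1 := by decide
  have c1 : Nat.count Nat.Prime 12 ≤ 5 := by decide +kernel
  have c2 : Nat.count Nat.Prime 32 ≤ 11 := by decide +kernel
  have c3 : Nat.count Nat.Prime 72 ≤ 20 := by decide +kernel
  have c4 : Nat.count Nat.Prime 144 ≤ 34 := by decide +kernel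
  have c5 : Nat.count Nat.Prime 243 ≤ 53 :=
    count_step 144 243 34 53 c4 (by norm_num) (by decide +kernel)
  have c6 : Nat.count Nat.Prime 432 ≤ 83 :=
    count_step 243 432 53 83 c5 (by norm_num) (by decide +kernel)
  have c7 : Nat.count Nat.Prime 729 ≤ 129 :=
    count_step 432 729 83 129 c6 (by norm_num) (by decide +kernel)
  have c8 : Nat.count Nat.Prime 1152 ≤ 190 :=
    count_step 729 1152 129 190 c7 (by norm_num) (by decide +kernel)
  have c9 : Nat.count Nat.Prime 1728 ≤ 269 :=
    count_step 1152 1728 190 269 c8 (by norm_num) (by decide +kernel)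
  have c10 : Nat.count Nat.Prime 2592 ≤ 377 :=
    count_step 1728 2592 269 377 c9 (by norm_num) (by decide +kernel)
  have c11 : Nat.count Nat.Prime 3888 ≤ 538 :=
    count_step 2592 3888 377 538 c10 (by norm_num) (by decide +kernel)
  have c12 : Nat.count Nat.Prime 5832 ≤ 765 :=
    count_step 3888 5832 538 765 c11 (by norm_num) (by decide +kernel)
  have c13 : Nat.count Nat.Prime 8192 ≤ 1028 :=
    count_step 5832 8192 765 1028 c12 (by norm_num) (by decide +kernel)
  have l3 := log_smooth 0 1
  have l12 := log_smooth 2 1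
  have l32 := log_smooth 5 0
  have l72 := log_smooth 3 2
  have l144 := log_smooth 4 2
  have l243 := log_smooth 0 5
  have l432 := log_smooth 4 3
  have l729 := log_smooth 0 6
  have l1152 := log_smooth 7 2
  have l1728 := log_smooth 6 3
  have l2592 := log_smooth 5 4
  have l3888 := log_smooth 4 5
  have l5832 := log_smooth 3 6
  have l8192 := log_smooth 13 0
  norm_num at l3 l12 l32 l72 l144 l243 l432 l729 l1152 l1728 l2592 l3888 l5832 l8192
  rcases Nat.lt_or_ge p 3 with h | h0
  · have : p = 2 := by omega
    subst this
    have hc : Nat.count Nat.Prime (2 + 1) = 1 := by decide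
    rw [hc]
    refine fin 1 _ _ 1 (by norm_num) (Real.log_pos (by norm_num)) ?_ ?_
    · push_cast; linarith [Real.log_two_lt_d9]
    · have := Real.log_pos (show (1 : ℝ) < 2 by norm_num)
      push_cast; linarith
  rcases Nat.lt_or_ge p 12 with h | h1
  · exact chunk 3 12 5 _ _ (by norm_num) (by exact_mod_cast l3) (by exact_mod_cast l12) c1
      (by norm_num) p h0 h
  rcases Nat.lt_or_ge p 32 with h | h2
  · exact chunk 12 32 11 _ _ (by norm_num) (by exact_mod_cast l12) (by exact_mod_cast l32) c2
      (by norm_num) p h1 h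
  rcases Nat.lt_or_ge p 72 with h | h3
  · exact chunk 32 72 20 _ _ (by norm_num) (by exact_mod_cast l32) (by exact_mod_cast l72) c3
      (by norm_num) p h2 h
  rcases Nat.lt_or_ge p 144 with h | h4
  · exact chunk 72 144 34 _ _ (by norm_num) (by exact_mod_cast l72) (by exact_mod_cast l144) c4
      (by norm_num) p h3 h
  rcases Nat.lt_or_ge p 243 with h | h5
  · exact chunk 144 243 53 _ _ (by norm_num) (by exact_mod_cast l144) (by exact_mod_cast l243) c5
      (by norm_num) p h4 h
  rcases Nat.lt_or_ge p 432 with h | h6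
  · exact chunk 243 432 83 _ _ (by norm_num) (by exact_mod_cast l243) (by exact_mod_cast l432) c6
      (by norm_num) p h5 h
  rcases Nat.lt_or_ge p 729 with h | h7
  · exact chunk 432 729 129 _ _ (by norm_num) (by exact_mod_cast l432) (by exact_mod_cast l729) c7
      (by norm_num) p h6 h
  rcases Nat.lt_or_ge p 1152 with h | h8
  · exact chunk 729 1152 190 _ _ (by norm_num) (by exact_mod_cast l729) (by exact_mod_cast l1152) c8
      (by norm_num) p h7 h
  rcases Nat.lt_or_ge p 1728 with h | h9
  · exact chunk 1152 1728 269 _ _ (by norm_num) (by exact_mod_cast l1152) (by exact_mod_cast l1728) c9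
      (by norm_num) p h8 h
  rcases Nat.lt_or_ge p 2592 with h | h10
  · exact chunk 1728 2592 377 _ _ (by norm_num) (by exact_mod_cast l1728) (by exact_mod_cast l2592) c10
      (by norm_num) p h9 h
  rcases Nat.lt_or_ge p 3888 with h | h11
  · exact chunk 2592 3888 538 _ _ (by norm_num) (by exact_mod_cast l2592) (by exact_mod_cast l3888) c11
      (by norm_num) p h10 h
  rcases Nat.lt_or_ge p 5832 with h | h12
  · exact chunk 3888 5832 765 _ _ (by norm_num) (by exact_mod_cast l3888) (by exact_mod_cast l5832) c12
      (by norm_num) p h11 h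
  rcases Nat.lt_or_ge p 8192 with h | h13
  · exact chunk 5832 8192 1028 _ _ (by norm_num) (by exact_mod_cast l5832) (by exact_mod_cast l8192) c13
      (by norm_num) p h12 h
  omega

end NPL

namespace NPL

lemma final (p : ℕ) (hp : 2 ≤ p) :
    756 * (Nat.count Nat.Prime (p + 1) : ℝ) * p * Real.log p ^ 2 +
      117 * (Nat.count Nat.Prime (p + 1) : ℝ) ^ 2 * Real.log p ^ 3 <
      927 * (p : ℝ) ^ 2 * Real.log p + 5620 * (p : ℝ) ^ 2 := by
  rcases Nat.lt_or_ge p 8192 with h | h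
  · exact small p hp h
  · have hp' : (8192 : ℝ) ≤ p := by exact_mod_cast h
    have e13 := log_pow2 13
    norm_num at e13
    have l2 := Real.log_two_gt_d9
    have hL9 : 9 ≤ Real.log p := by
      have := Real.log_le_log (by norm_num) hp'
      linarith
    have hL : 0 < Real.log (p : ℝ) := by linarith
    refine fin _ _ _ _ (by linarith) hL (pi_large p h) ?_
    have e : (756 * (1.052 + 5 / Real.log p) + 117 * (1.052 + 5 / Real.log p) ^ 2 - 927) *
        Real.log p = (756 * 1.052 + 117 * 1.052 ^ 2 - 927) * Real.log p +
          (3780 + 1170 * 1.052) + 2925 / Real.log p := by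
      field_simp; ring
    rw [e]
    have h3 : 2925 / Real.log (p : ℝ) ≤ 325 := by
      rw [div_le_iff₀ hL]; linarith
    norm_num
    nlinarith

end NPL

/-- For every integer `n ≥ 1`,
`927·p_n²·log p_n + 5620·p_n² > 756·n·p_n·log² p_n + 117·n²·log³ p_n`. -/
theorem nthPrime_log_inequality (n : ℕ) (hn : 1 ≤ n) :
    927 * (nthPrime n : ℝ) ^ 2 * Real.log (nthPrime n) + 5620 * (nthPrime n : ℝ) ^ 2 >
      756 * (n : ℝ) * (nthPrime n : ℝ) * Real.log (nthPrime n) ^ 2 +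
        117 * (n : ℝ) ^ 2 * Real.log (nthPrime n) ^ 3 := by
  have hp : (nthPrime n).Prime := Nat.prime_nth_prime _
  have hc : Nat.count Nat.Prime (nthPrime n + 1) = n := by
    rw [Nat.count_succ, if_pos hp]
    unfold nthPrime
    rw [Nat.count_nth_of_infinite Nat.infinite_setOfPred_prime]
    omega
  have h := NPL.final (nthPrime n) hp.two_le
  rw [hc] at h
  exact h
end
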